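/- Let n ≥ 2 and let g : ℝⁿ → ℝ be a positive definite radial kernel which is not identically zero. Let B = {x ∈ ℝⁿ : ‖x‖ < R} be the open ball of radius R > 0 centered at 0, with boundary sphere ∂B = {x : ‖x‖ = R} carrying the (n−1)-dimensional Hausdorff surface measure σ, and suppose F[B] = 0. Then for every continuous function v : ∂B → ℝ, the equality ∬_{∂B×∂B} g(x−y) v(x) v(y) dσ(x) dσ(y) = 0 holds if and only if v is a first-order spherical harmonic, i.e. there exists b ∈ ℝⁿ with v(x) = ⟨b, x⟩ for all x ∈ ∂B. -/

import Mathlib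

open MeasureTheory Metric
open scoped RealInnerProductSpace

/-- `g` is a positive definite radial kernel: continuous, depends only on the norm, and
for every smooth compactly supported complex test function `μ` the integral
`∬ g(x−y) μ(x) conj(μ(y))` is real and nonnegative. -/
def IsPosDefRadialKernel {n : ℕ} (g : EuclideanSpace ℝ (Fin n) → ℝ) : Prop :=
  Continuous g ∧
  (∀ x y, ‖x‖ = ‖y‖ → g x = g y) ∧
  ∀ μ : EuclideanSpace ℝ (Fin n) → ℂ, ContDiff ℝ (⊤ : ℕ∞) μ → HasCompactSupport μ →
    (∫ x, ∫ y, (g (x - y) : ℂ) * μ x * (starRingEnd ℂ) (μ y)).im = 0 ∧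
    0 ≤ (∫ x, ∫ y, (g (x - y) : ℂ) * μ x * (starRingEnd ℂ) (μ y)).re

/-- `T` is a global flow of the vector field `V`. -/
def IsGlobalFlow {n : ℕ} (V : EuclideanSpace ℝ (Fin n) → EuclideanSpace ℝ (Fin n))
    (T : ℝ → EuclideanSpace ℝ (Fin n) → EuclideanSpace ℝ (Fin n)) : Prop :=
  (∀ x, T 0 x = x) ∧ ∀ t x, HasDerivAt (fun s => T s x) (V (T t x)) t

namespace Bg
open PowerSeries Finset
open scoped Nat

/-- entire power series -/
def Ent (f : ℚ⟦X⟧) : Prop := ∀ r : ℝ, 0 ≤ r → Summable fun k => |((coeff k f : ℚ) : ℝ)| * r ^ k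

noncomputable def ev (f : ℚ⟦X⟧) (t : ℝ) : ℝ := ∑' k, ((coeff k f : ℚ) : ℝ) * t ^ k

/-- the Euler derivation `X d/dX`. -/
noncomputable def eu : Derivation ℚ ℚ⟦X⟧ ℚ⟦X⟧ := (X : ℚ⟦X⟧) • PowerSeries.derivative ℚ

lemma coeff_eu (f : ℚ⟦X⟧) (k : ℕ) : coeff k (eu f) = k * coeff k f := by
  have : eu f = X * PowerSeries.derivative ℚ f := rfl
  rw [this]
  cases k with
  | zero => simp
  | succ k => rw [coeff_succ_X_mul, PowerSeries.coeff_derivative]; push_cast; ring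

lemma Ent.norm {f : ℚ⟦X⟧} (hf : Ent f) (t : ℝ) :
    Summable fun k => ‖((coeff k f : ℚ) : ℝ) * t ^ k‖ := by
  refine (hf |t| (abs_nonneg t)).congr fun k => ?_
  rw [norm_mul, norm_pow]; rfl

lemma Ent.add {f g : ℚ⟦X⟧} (hf : Ent f) (hg : Ent g) : Ent (f + g) := by
  intro r hr
  refine Summable.of_nonneg_of_le (fun k => by positivity) (fun k => ?_) ((hf r hr).add (hg r hr))
  rw [map_add, ← add_mul]; push_cast
  gcongr; exact abs_add_le _ _

lemma ev_add {f g : ℚ⟦X⟧} (hf : Ent f) (hg : Ent g) (t : ℝ) : ev (f + g) t = ev f t + ev g t := by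
  unfold ev
  rw [← ((hf.norm t).of_norm).tsum_add ((hg.norm t).of_norm)]
  congr 1; ext k; rw [map_add]; push_cast; ring

lemma Ent.mul {f g : ℚ⟦X⟧} (hf : Ent f) (hg : Ent g) : Ent (f * g) := by
  intro r hr
  have h' := Summable.of_norm <| summable_norm_sum_mul_antidiagonal_of_summable_norm
    (f := fun k => |((coeff k f : ℚ) : ℝ)| * r ^ k) (g := fun k => |((coeff k g : ℚ) : ℝ)| * r ^ k)
    (by simpa [abs_mul, abs_of_nonneg hr] using hf r hr)
    (by simpa [abs_mul, abs_of_nonneg hr] using hg r hr)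
  refine Summable.of_nonneg_of_le (fun k => by positivity) (fun k => ?_) h'
  rw [coeff_mul]; push_cast
  calc _ ≤ (∑ x ∈ antidiagonal k, |((coeff x.1 f : ℚ) : ℝ)| * |((coeff x.2 g : ℚ) : ℝ)|) * r ^ k := by
        gcongr
        refine (abs_sum_le_sum_abs _ _).trans (le_of_eq ?_)
        exact sum_congr rfl fun x _ => abs_mul _ _
    _ = _ := by
        rw [sum_mul]
        refine sum_congr rfl fun x hx => ?_
        rw [← mem_antidiagonal.1 hx, pow_add]; ring

lemma ev_mul {f g : ℚ⟦X⟧} (hf : Ent f) (hg : Ent g) (t : ℝ) : ev (f * g) t = ev f t * ev g t := by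
  unfold ev
  rw [tsum_mul_tsum_eq_tsum_sum_antidiagonal_of_summable_norm (hf.norm t) (hg.norm t)]
  congr 1; ext k
  rw [coeff_mul]; push_cast; rw [sum_mul]
  refine sum_congr rfl fun x hx => ?_
  rw [← mem_antidiagonal.1 hx, pow_add]; ring

lemma Ent.poly (p : Polynomial ℚ) : Ent (p : ℚ⟦X⟧) := by
  intro r hr
  refine summable_of_ne_finset_zero (s := p.support) fun k hk => ?_
  rw [Polynomial.coeff_coe, Polynomial.notMem_support_iff.1 hk]; simp

lemma ev_poly (p : Polynomial ℚ) (t : ℝ) : ev (p : ℚ⟦X⟧) t = Polynomial.aeval t p := by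
  unfold ev
  rw [tsum_eq_sum (s := p.support) (fun k hk => by
    rw [Polynomial.coeff_coe, Polynomial.notMem_support_iff.1 hk]; simp)]
  rw [Polynomial.aeval_def, Polynomial.eval₂_eq_sum, Polynomial.sum_def]
  simp

lemma Ent.eu {f : ℚ⟦X⟧} (hf : Ent f) : Ent (eu f) := by
  intro r hr
  refine Summable.of_nonneg_of_le (fun k => by positivity) (fun k => ?_) (hf (2*r) (by positivity))
  rw [coeff_eu]; push_cast
  rw [abs_mul, mul_pow]
  have : |(k:ℝ)| ≤ 2^k := by
    rw [abs_of_nonneg (by positivity)]; exact_mod_cast Nat.lt_two_pow_self.le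
  calc _ ≤ 2^k * |((coeff k f : ℚ):ℝ)| * r^k := by gcongr
    _ = _ := by ring

lemma Ent.one : Ent 1 := by simpa using Ent.poly 1

lemma ev_one (t : ℝ) : ev 1 t = 1 := by simpa using ev_poly 1 t

lemma Ent.zero : Ent 0 := by simpa using Ent.poly 0

lemma ev_zero (t : ℝ) : ev 0 t = 0 := by simpa using ev_poly 0 t

lemma Ent.pow {f : ℚ⟦X⟧} (hf : Ent f) (k : ℕ) : Ent (f ^ k) := by
  induction k with
  | zero => simpa using Ent.one
  | succ k ih => rw [pow_succ]; exact ih.mul hf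

lemma ev_pow {f : ℚ⟦X⟧} (hf : Ent f) (k : ℕ) (t : ℝ) : ev (f ^ k) t = ev f t ^ k := by
  induction k with
  | zero => simp [ev_one]
  | succ k ih => rw [pow_succ, ev_mul (hf.pow k) hf, ih, pow_succ]

lemma Ent.sum {ι : Type*} (s : Finset ι) {f : ι → ℚ⟦X⟧} (hf : ∀ i ∈ s, Ent (f i)) :
    Ent (∑ i ∈ s, f i) ∧ ∀ t, ev (∑ i ∈ s, f i) t = ∑ i ∈ s, ev (f i) t := by
  classical
  induction s using Finset.induction_on with
  | empty => simp [Ent.zero, ev_zero]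
  | insert a s ha ih =>
    obtain ⟨h1, h2⟩ := ih fun i hi => hf i (mem_insert_of_mem hi)
    have h3 := hf a (mem_insert_self _ _)
    rw [sum_insert ha]
    refine ⟨h3.add h1, fun t => ?_⟩
    rw [ev_add h3 h1, h2, sum_insert ha]

lemma ev_analytic {f : ℚ⟦X⟧} (hf : Ent f) (t : ℝ) : AnalyticAt ℝ (ev f) t := by
  set c : ℕ → ℝ := fun k => ((coeff k f : ℚ) : ℝ)
  have hr : (FormalMultilinearSeries.ofScalars ℝ c).radius = ⊤ := by
    apply FormalMultilinearSeries.radius_eq_top_of_summable_norm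
    intro r
    refine Summable.of_nonneg_of_le (fun k => by positivity) (fun k => ?_) (hf r r.2)
    gcongr
    rw [FormalMultilinearSeries.ofScalars_norm]; rfl
  have h := (FormalMultilinearSeries.ofScalars ℝ c).hasFPowerSeriesOnBall (by rw [hr]; simp)
  have he : (FormalMultilinearSeries.ofScalars ℝ c).sum = ev f := by
    ext t
    have := FormalMultilinearSeries.ofScalars_sum_eq c t
    rw [show (FormalMultilinearSeries.ofScalars ℝ c).sum t = FormalMultilinearSeries.ofScalarsSum c t from rfl, this]
    simp [ev, c]
  rw [he] at h
  exact h.analyticAt_of_mem (by rw [hr]; simp)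

lemma ev_eu {f : ℚ⟦X⟧} (hf : Ent f) (t : ℝ) : ev (eu f) t = t * deriv (ev f) t := by
  have key : HasDerivAt (fun y => ∑' k, ((coeff k f : ℚ) : ℝ) * y ^ k)
      (∑' k, ((coeff k f : ℚ) : ℝ) * (k * t ^ (k-1))) t := by
    have hb : (0:ℝ) ≤ 2 * (|t| + 1) := by positivity
    refine hasDerivAt_tsum_of_isPreconnected (u := fun k => |((coeff k f : ℚ) : ℝ)| * (2*(|t|+1))^k)
      (t := Metric.ball 0 (|t|+1)) (y₀ := t) (hf _ hb) Metric.isOpen_ball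
      (convex_ball _ _).isPreconnected (g := fun k y => ((coeff k f : ℚ) : ℝ) * y ^ k)
      (g' := fun k y => ((coeff k f : ℚ) : ℝ) * (k * y ^ (k-1))) (y := t) ?_ ?_ ?_ ?_ ?_
    · intro k y _
      exact (hasDerivAt_pow k y).const_mul _
    · intro k y hy
      have hy' : |y| ≤ |t| + 1 := by simpa using (mem_ball_zero_iff.1 hy).le
      rw [norm_mul, mul_pow]
      refine mul_le_mul_of_nonneg_left ?_ (norm_nonneg _)
      rw [norm_mul, norm_pow]
      have h1 : ‖(k:ℝ)‖ ≤ 2^k := by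
        rw [Real.norm_of_nonneg (by positivity)]; exact_mod_cast Nat.lt_two_pow_self.le
      refine mul_le_mul h1 ?_ (by positivity) (by positivity)
      calc ‖y‖^(k-1) ≤ (|t|+1)^(k-1) := by gcongr; exact hy'
        _ ≤ (|t|+1)^k := pow_le_pow_right₀ (by linarith [abs_nonneg t]) (by omega)
    · simp
    · exact (hf.norm t).of_norm
    · simp
  have h2 : deriv (ev f) t = _ := key.deriv
  rw [h2, ← tsum_mul_left]
  unfold ev
  congr 1; ext k
  rw [coeff_eu]
  cases k with
  | zero => simp
  | succ k => push_cast; simp [pow_succ]; ring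

/-- class E -/
def EC (f : ℚ⟦X⟧) (q C : ℕ) : Prop :=
  1 ≤ C ∧ ∀ k, ∃ c : ℤ, coeff k f = c / ((2 * k + q)! : ℚ) ∧ |c| ≤ (C : ℤ) ^ (k + 1)

lemma EC.succ {f : ℚ⟦X⟧} {q C : ℕ} (h : EC f q C) : EC f (q + 1) (C * (q + 3)) := by
  refine ⟨Nat.mul_pos h.1 (by omega), fun k => ?_⟩
  obtain ⟨c, h1, h2⟩ := h.2 k
  refine ⟨c * (2 * k + q + 1 : ℕ), ?_, ?_⟩
  · rw [h1, show 2 * k + (q+1) = (2*k+q)+1 by ring, Nat.factorial_succ]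
    have : ((2*k+q)! : ℚ) ≠ 0 := by positivity
    push_cast; field_simp
  · rw [abs_mul]; push_cast
    rw [mul_pow]
    have hB : 1 + ((k+1:ℕ):ℤ) * ((q:ℤ)+2) ≤ (1 + ((q:ℤ)+2))^(k+1) :=
      one_add_mul_le_pow (by omega) _
    have h3 : |2 * (k:ℤ) + q + 1| ≤ ((q:ℤ)+3)^(k+1) := by
      rw [abs_of_nonneg (by positivity)]
      have e : (1 + ((q:ℤ)+2)) = q+3 := by ring
      rw [e] at hB
      push_cast at hB
      nlinarith [Int.natCast_nonneg k, Int.natCast_nonneg q, mul_nonneg (Int.natCast_nonneg k) (Int.natCast_nonneg q)]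
    exact mul_le_mul h2 h3 (abs_nonneg _) (by positivity)

lemma EC.mono {f : ℚ⟦X⟧} {q C : ℕ} (h : EC f q C) (r : ℕ) : ∃ C', EC f (q + r) C' := by
  induction r with
  | zero => exact ⟨C, h⟩
  | succ r ih => obtain ⟨C', h'⟩ := ih; exact ⟨_, h'.succ⟩

lemma EC.monoC {f : ℚ⟦X⟧} {q C C' : ℕ} (h : EC f q C) (hC : C ≤ C') : EC f q C' := by
  refine ⟨h.1.trans hC, fun k => ?_⟩
  obtain ⟨c, h1, h2⟩ := h.2 k
  exact ⟨c, h1, h2.trans (by gcongr)⟩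

lemma EC.eu {f : ℚ⟦X⟧} {q C : ℕ} (h : EC f q C) : EC (eu f) q (C * 2) := by
  refine ⟨Nat.mul_pos h.1 (by omega), fun k => ?_⟩
  obtain ⟨c, h1, h2⟩ := h.2 k
  refine ⟨c * k, ?_, ?_⟩
  · rw [coeff_eu, h1]; push_cast; ring
  · rw [abs_mul]; push_cast; rw [mul_pow]
    refine mul_le_mul h2 ?_ (abs_nonneg _) (by positivity)
    rw [abs_of_nonneg (by positivity)]
    exact_mod_cast (Nat.le_succ k).trans (Nat.lt_two_pow_self (n := k+1)).le

lemma EC.mul {f g : ℚ⟦X⟧} {q C q' C' : ℕ} (hf : EC f q C) (hg : EC g q' C') :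
    EC (f * g) (q + q') (C * C' * 8 * 2 ^ (q + q')) := by
  refine ⟨?_, fun m => ?_⟩
  · have := hf.1; have := hg.1
    exact Nat.succ_le_of_lt (by positivity)
  choose c h1 h2 using hf.2
  choose d h3 h4 using hg.2
  refine ⟨∑ x ∈ antidiagonal m, c x.1 * d x.2 * ((2*m+(q+q')).choose (2*x.1+q) : ℕ), ?_, ?_⟩
  · rw [coeff_mul, eq_div_iff (by positivity), sum_mul]
    push_cast
    refine sum_congr rfl fun x hx => ?_
    have hx := mem_antidiagonal.1 hx
    rw [h1, h3]
    have e : 2*m+(q+q') = (2*x.1+q)+(2*x.2+q') := by omega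
    have := Nat.add_choose_mul_factorial_mul_factorial (2*x.1+q) (2*x.2+q')
    rw [← Nat.choose_symm_add] at this
    rw [e, ← this]
    have a1 : ((2*x.1+q)! : ℚ) ≠ 0 := by positivity
    have a2 : ((2*x.2+q')! : ℚ) ≠ 0 := by positivity
    push_cast; field_simp
  · refine (abs_sum_le_sum_abs _ _).trans ?_
    have hC : (1:ℤ) ≤ C := by exact_mod_cast hf.1
    have hC' : (1:ℤ) ≤ C' := by exact_mod_cast hg.1
    have : ∀ x ∈ antidiagonal m, |c x.1 * d x.2 * ((2*m+(q+q')).choose (2*x.1+q) : ℕ)|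
        ≤ (C:ℤ)^(m+1) * (C':ℤ)^(m+1) * 2^(2*m+(q+q')) := by
      intro x hx
      have hx := mem_antidiagonal.1 hx
      rw [abs_mul, abs_mul]
      have b1 : |c x.1| ≤ (C:ℤ)^(m+1) := (h2 _).trans (pow_le_pow_right₀ hC (by omega))
      have b2 : |d x.2| ≤ (C':ℤ)^(m+1) := (h4 _).trans (pow_le_pow_right₀ hC' (by omega))
      have b3 : |(((2*m+(q+q')).choose (2*x.1+q) : ℕ) : ℤ)| ≤ 2^(2*m+(q+q')) := by
        rw [abs_of_nonneg (by positivity)]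
        exact_mod_cast Nat.choose_le_two_pow _ _
      gcongr
    refine (sum_le_sum this).trans ?_
    rw [sum_const, Nat.card_antidiagonal, nsmul_eq_mul]
    push_cast
    have b4 : ((m:ℤ)+1) ≤ 2^(m+1) := by exact_mod_cast (Nat.lt_two_pow_self (n := m+1)).le
    calc ((m:ℤ)+1) * ((C:ℤ)^(m+1) * (C':ℤ)^(m+1) * 2^(2*m+(q+q')))
        ≤ 2^(m+1) * ((C:ℤ)^(m+1) * (C':ℤ)^(m+1) * (4^(m+1) * (2^(q+q'))^(m+1))) := by
          gcongr
          rw [pow_add, pow_mul]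
          have : (1:ℤ) ≤ 2^(q+q') := one_le_pow₀ (by norm_num)
          gcongr
          · rw [show (2:ℤ)^2 = 4 by norm_num]
            exact pow_le_pow_right₀ (by norm_num) (by omega)
          · exact le_self_pow₀ this (by omega)
      _ = _ := by rw [show (8:ℤ) = 2 * 4 by norm_num]; simp only [mul_pow]; ring

lemma EC.one : EC 1 0 1 := by
  refine ⟨le_rfl, fun k => ?_⟩
  by_cases hk : k = 0
  · exact ⟨1, by simp [hk], by simp⟩
  · exact ⟨0, by simp [coeff_one, hk], by simp⟩

lemma EC.pow {f : ℚ⟦X⟧} {q C : ℕ} (h : EC f q C) (k : ℕ) : ∃ C', EC (f ^ k) (k * q) C' := by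
  induction k with
  | zero => exact ⟨1, by simpa using EC.one⟩
  | succ k ih =>
    obtain ⟨C', h'⟩ := ih
    have := h'.mul h
    rw [← pow_succ, ← Nat.succ_mul] at this
    exact ⟨_, this⟩

lemma EC.abs_le {f : ℚ⟦X⟧} {q C : ℕ} (h : EC f q C) (k : ℕ) :
    |((coeff k f : ℚ) : ℝ)| ≤ (C:ℝ)^(k+1) / (2*k+q)! := by
  obtain ⟨c, h1, h2⟩ := h.2 k
  rw [h1]; push_cast
  rw [abs_div, abs_of_nonneg (a := ((2*k+q)! : ℝ)) (by positivity)]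
  gcongr
  exact_mod_cast h2

lemma EC.ent {f : ℚ⟦X⟧} {q C : ℕ} (h : EC f q C) : Ent f := by
  intro r hr
  refine Summable.of_nonneg_of_le (fun k => by positivity) (fun k => ?_)
    ((Real.summable_pow_div_factorial (C * r)).mul_left (C:ℝ))
  calc _ ≤ (C:ℝ)^(k+1) / (2*k+q)! * r^k := by gcongr; exact h.abs_le k
    _ ≤ (C:ℝ)^(k+1) / k ! * r^k := by gcongr; omega
    _ = _ := by rw [mul_pow]; ring

end Bg

namespace Bg
open PowerSeries Finset
open scoped Nat

/-- coefficients of the normalised Bessel series with index `ν = n / 2`. -/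
def ca (n : ℕ) : ℕ → ℚ
  | 0 => 1
  | k + 1 => - 2 * ca n k / ((k + 1) * (n + 2 * k + 2))

def ee (n : ℕ) : ℕ → ℚ
  | 0 => 1
  | k + 1 => ee n k * (2 * (2 * k + n + 1)) / (k + 1)

lemma ee_rel (n k : ℕ) : ee (n+2) k * (n+1) = ee n k * (2*k+n+1) := by
  induction k with
  | zero => simp [ee]
  | succ k ih =>
    simp only [ee]
    have h : (k:ℚ) + 1 ≠ 0 := by positivity
    push_cast
    field_simp
    linear_combination (2 * (k:ℚ) * 1 + n + 3) * ih

lemma ee_rel2 (n k : ℕ) : ee (n+2) (k+1) = ee n (k+1) + 4 * ee (n+2) k := by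
  have h1 := ee_rel n (k+1)
  have h2 := ee_rel n k
  have h3 : ee n (k+1) * (k+1) = ee n k * (2 * (2 * k + n + 1)) := by
    simp only [ee]
    have h : (k:ℚ) + 1 ≠ 0 := by positivity
    field_simp
  have h : (n:ℚ) + 1 ≠ 0 := by positivity
  apply mul_right_cancel₀ h
  push_cast at h1
  linear_combination h1 - 4 * h2 + 2 * h3

lemma ee_int (n : ℕ) : ∀ k, ∃ z : ℤ, ee n k = z := by
  induction n using Nat.twoStepInduction with
  | zero =>
    intro k
    refine ⟨(k.centralBinom : ℤ), ?_⟩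
    induction k with
    | zero => simp [ee]
    | succ k ih =>
      have := Nat.succ_mul_centralBinom_succ k
      have h : (k:ℚ) + 1 ≠ 0 := by positivity
      simp only [ee, ih]
      field_simp
      push_cast
      have t : (((k+1) * (k+1).centralBinom : ℕ):ℚ) = ((2 * (2*k+1) * k.centralBinom : ℕ) : ℚ) := by rw [this]
      push_cast at t
      linear_combination -t
  | one =>
    intro k
    refine ⟨4^k, ?_⟩
    induction k with
    | zero => simp [ee]
    | succ k ih =>
      have h : (k:ℚ) + 1 ≠ 0 := by positivity
      simp only [ee, ih]
      field_simp
      push_cast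
      ring
  | more n h1 h2 =>
    intro k
    induction k with
    | zero => exact ⟨1, by simp [ee]⟩
    | succ k ih =>
      obtain ⟨a, ha⟩ := ih
      obtain ⟨b, hb⟩ := h1 (k+1)
      exact ⟨b + 4 * a, by rw [ee_rel2, ha, hb]; push_cast; ring⟩

lemma ca_eq (n k : ℕ) : ca n k = (-1)^k * n ! * ee n k / (2*k+n)! := by
  induction k with
  | zero =>
    have : ((n ! : ℕ):ℚ) ≠ 0 := by positivity
    simp [ca, ee, this]
  | succ k ih =>
    simp only [ca, ee, ih]
    rw [show 2*(k+1)+n = (2*k+n)+1+1 by ring, Nat.factorial_succ, Nat.factorial_succ]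
    have h : (k:ℚ) + 1 ≠ 0 := by positivity
    have h2 : ((2*k+n)! : ℚ) ≠ 0 := by positivity
    have h3 : (n:ℚ) + 2*k+2 ≠ 0 := by positivity
    have h4 : (2*k:ℚ)+n+1+1 ≠ 0 := by positivity
    have h5 : (2*k:ℚ)+n+1 ≠ 0 := by positivity
    push_cast
    field_simp
    ring

lemma ee_bound (n k : ℕ) : 0 ≤ ee n k ∧ ee n k ≤ (2*(n+2))^k := by
  induction k with
  | zero => simp [ee]
  | succ k ih =>
    simp only [ee]
    obtain ⟨h1, h2⟩ := ih
    refine ⟨by positivity, ?_⟩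
    rw [div_le_iff₀ (by positivity), pow_succ, mul_assoc]
    have : (0:ℚ) ≤ n * k := by positivity
    have h3 : 2 * (2 * (k:ℚ) + n + 1) ≤ (2*(n+2)) * (k+1) := by nlinarith
    exact mul_le_mul h2 h3 (by positivity) (by positivity)

noncomputable def Ph (n : ℕ) : ℚ⟦X⟧ := PowerSeries.mk (ca n)

lemma Ph_EC (n : ℕ) : EC (Ph n) n (n ! * (2*(n+2))) := by
  refine ⟨Nat.succ_le_of_lt (by positivity), fun k => ?_⟩
  obtain ⟨z, hz⟩ := ee_int n k
  obtain ⟨h1, h2⟩ := ee_bound n k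
  refine ⟨(-1)^k * n ! * z, ?_, ?_⟩
  · rw [Ph, coeff_mk, ca_eq, hz]; push_cast; rfl
  · rw [abs_mul, abs_mul, abs_pow, abs_neg, abs_one, one_pow, one_mul]
    rw [hz] at h1 h2
    have h1' : 0 ≤ z := by exact_mod_cast h1
    have h2' : z ≤ (2*(n+2))^k := by exact_mod_cast h2
    rw [abs_of_nonneg h1', abs_of_nonneg (by positivity)]
    push_cast
    rw [mul_pow]
    have : (1:ℤ) ≤ n ! := by exact_mod_cast Nat.factorial_pos n
    gcongr
    · exact le_self_pow₀ this (by omega)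
    · exact h2'.trans (pow_le_pow_right₀ (by omega) (by omega))

noncomputable def Ps (n : ℕ) : ℚ⟦X⟧ := eu (Ph n)

lemma Ps_ode (n : ℕ) : 2 • eu (Ps n) = - 2 • (X * Ph n) - n • Ps n := by
  ext k
  simp only [map_sub, map_nsmul, map_zsmul, Ps, coeff_eu, Ph, coeff_mk]
  cases k with
  | zero => simp
  | succ k =>
    rw [coeff_succ_X_mul, coeff_mk]
    simp only [ca]
    have h : (k:ℚ) + 1 ≠ 0 := by positivity
    have h3 : (n:ℚ) + 2*k+2 ≠ 0 := by positivity
    simp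
    field_simp
    ring

noncomputable def phi (n : ℕ) (t : ℝ) : ℝ := ev (Ph n) t

/-! forms -/
open Polynomial in
noncomputable def Dt (N n : ℕ) (p : ℕ → ℤ[X]) : ℕ → ℤ[X] := fun i =>
  2 * Polynomial.X * derivative (p i) - ((N - i : ℕ) * n : ℤ[X]) * p i
   + (if i < N then 2 * ((i:ℤ[X]) + 1) * p (i+1) else 0)
   - 2 * Polynomial.X * (match i with | 0 => 0 | j+1 => ((N - j : ℕ) : ℤ[X]) * p j)

section
variable {A : Type*} [CommRing A]
open Polynomial in
noncomputable def fev (N : ℕ) (τ x y : A) (p : ℕ → ℤ[X]) : A :=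
  ∑ i ∈ range (N+1), (p i).eval₂ (Int.castRingHom A) τ * (x ^ i * y ^ (N - i))

open Polynomial in
lemma fev_Dt (N n : ℕ) (δ' : A →+ A) (hδ : ∀ a b, δ' (a * b) = a * δ' b + b * δ' a)
    (τ x y : A) (hτ : δ' τ = τ) (hx : δ' x = y)
    (hy : 2 * δ' y = - 2 * (τ * x) - n * y) (p : ℕ → ℤ[X]) :
    fev N τ x y (Dt N n p) = 2 * δ' (fev N τ x y p) := by
  obtain ⟨δ, hδ'⟩ : ∃ δ : Derivation ℤ A A, ∀ a, δ' a = δ a :=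
    ⟨Derivation.mk' δ'.toIntLinearMap hδ, fun a => rfl⟩
  simp only [hδ'] at *
  have hev : ∀ q : ℤ[X], q.eval₂ (Int.castRingHom A) τ = aeval τ q := fun q => rfl
  unfold fev
  simp only [hev]
  rw [map_sum, mul_sum]
  have hterm : ∀ i ∈ range (N+1), 2 * δ (aeval τ (p i) * (x ^ i * y ^ (N - i)))
     = aeval τ (2 * Polynomial.X * derivative (p i) - ((N - i : ℕ) * n : ℤ[X]) * p i) * (x ^ i * y ^ (N - i))
       + 2 * (i * aeval τ (p i) * (x^(i-1) * y^(N-i+1)))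
       - 2 * τ * ((N - i : ℕ) * aeval τ (p i) * (x^(i+1) * y^(N-i-1))) := by
    intro i hi
    rw [Derivation.leibniz, Derivation.leibniz, Derivation.leibniz_pow, Derivation.leibniz_pow,
      Derivation.map_aeval, hτ, hx]
    simp only [smul_eq_mul, nsmul_eq_mul, map_sub, map_mul, map_natCast, aeval_X, map_ofNat]
    rcases Nat.eq_zero_or_pos (N - i) with h0 | h0
    · rw [h0]; simp; ring
    · obtain ⟨m, hm⟩ := Nat.exists_eq_succ_of_ne_zero h0.ne'
      rw [hm]
      simp only [Nat.succ_eq_add_one, Nat.add_sub_cancel, pow_succ]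
      linear_combination (((m+1:ℕ):A) * aeval τ (p i) * x^i * y^m) * hy
  rw [sum_congr rfl hterm, sum_sub_distrib, sum_add_distrib]
  simp only [Dt, map_sub, map_add, sub_mul, add_mul, sum_sub_distrib, sum_add_distrib]
  congr 1
  · congr 1
    rw [sum_range_succ, sum_range_succ']
    simp only [lt_irrefl, if_false, map_zero, zero_mul, add_zero, Nat.cast_zero, mul_zero]
    refine sum_congr rfl fun i hi => ?_
    have hi := mem_range.1 hi
    rw [if_pos hi]
    simp only [map_mul, map_add, map_natCast, map_one, map_ofNat, Nat.add_sub_cancel]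
    rw [show N - (i+1) + 1 = N - i by omega]
    push_cast; ring
  · rw [sum_range_succ', sum_range_succ]
    simp only [map_mul, map_zero, mul_zero, zero_mul, add_zero, Nat.sub_self, Nat.cast_zero]
    refine sum_congr rfl fun i hi => ?_
    simp only [map_natCast, map_ofNat, aeval_X, Nat.sub_add_eq]
    ring

end

/-- the series attached to a form -/
noncomputable def Rs (N n : ℕ) (p : ℕ → Polynomial ℤ) : ℚ⟦X⟧ := fev N (X : ℚ⟦X⟧) (Ph n) (Ps n) p

lemma eu_X : eu X = X := by
  ext k; rw [coeff_eu, coeff_X]; split_ifs with h <;> simp [h]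

lemma Rs_Dt (N n : ℕ) (p : ℕ → Polynomial ℤ) : Rs N n (Dt N n p) = 2 * eu (Rs N n p) := by
  refine fev_Dt N n (eu : ℚ⟦X⟧ →ₗ[ℚ] ℚ⟦X⟧).toAddMonoidHom (fun a b => ?_) _ _ _ eu_X rfl ?_ p
  · have := eu.leibniz a b
    simp only [smul_eq_mul] at this
    exact this
  · have := Ps_ode n
    simpa [Ps, nsmul_eq_mul, zsmul_eq_mul] using this

lemma aeval_X_eq (p : Polynomial ℤ) : p.eval₂ (Int.castRingHom ℚ⟦X⟧) (X : ℚ⟦X⟧)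
    = ((p.map (Int.castRingHom ℚ) : Polynomial ℚ) : ℚ⟦X⟧) := by
  induction p using Polynomial.induction_on' with
  | add p q hp hq => simp [hp, hq, Polynomial.eval₂_add]
  | monomial k a =>
    rw [Polynomial.eval₂_monomial, Polynomial.map_monomial, Polynomial.coe_monomial]
    have : ((a : ℚ⟦X⟧)) = PowerSeries.C (a:ℚ) := by simp
    rw [eq_intCast, eq_intCast, this, X_pow_eq, ← monomial_zero_eq_C_apply, monomial_mul_monomial]
    simp

lemma Ph_ent (n : ℕ) : Ent (Ph n) := (Ph_EC n).ent
lemma Ps_ent (n : ℕ) : Ent (Ps n) := (Ph_ent n).eu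

lemma Rs_ent (N n : ℕ) (p : ℕ → Polynomial ℤ) : Ent (Rs N n p) ∧
    ∀ t, ev (Rs N n p) t = fev N t (phi n t) (ev (Ps n) t) p := by
  have h1 : ∀ i ∈ range (N+1), Ent ((p i).eval₂ (Int.castRingHom ℚ⟦X⟧) (X : ℚ⟦X⟧) * ((Ph n) ^ i * (Ps n) ^ (N - i))) := by
    intro i _
    rw [aeval_X_eq]
    exact (Ent.poly _).mul (((Ph_ent n).pow _).mul ((Ps_ent n).pow _))
  obtain ⟨h2, h3⟩ := Ent.sum _ h1
  refine ⟨h2, fun t => ?_⟩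
  unfold Rs fev
  rw [h3]
  refine sum_congr rfl fun i _ => ?_
  rw [aeval_X_eq, ev_mul (Ent.poly _) (((Ph_ent n).pow _).mul ((Ps_ent n).pow _)),
    ev_mul ((Ph_ent n).pow _) ((Ps_ent n).pow _), ev_pow (Ph_ent n), ev_pow (Ps_ent n), ev_poly]
  rw [Polynomial.aeval_def, Polynomial.eval₂_map]
  congr 2
end Bg

namespace Bg
open PowerSeries Finset
open scoped Nat

attribute [local instance] Matrix.seminormedAddCommGroup

lemma coeff_polymul (P : Polynomial ℚ) (f : ℚ⟦X⟧) (L m : ℕ) (hP : P.natDegree ≤ L) :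
    coeff m ((P : ℚ⟦X⟧) * f) = ∑ j ∈ range (L+1), if j ≤ m then P.coeff j * coeff (m-j) f else 0 := by
  rw [coeff_mul, Finset.Nat.sum_antidiagonal_eq_sum_range_succ_mk]
  simp only [Polynomial.coeff_coe]
  rw [← sum_filter]
  apply sum_subset_zero_on_sdiff (s₁ := (range (L+1)).filter (· ≤ m)) _ _ _ |>.symm
  · intro j hj; simp at hj ⊢; omega
  · intro j hj
    simp at hj
    rw [Polynomial.coeff_eq_zero_of_natDegree_lt (by have := hj.2; omega), zero_mul]
  · intro j _; rfl

lemma siegel_aux (N n : ℕ) : ∃ C0 : ℕ, 1 ≤ C0 ∧ ∀ i ≤ N, EC (Ph n ^ i * Ps n ^ (N - i)) (N * n) C0 := by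
  have h : ∀ i ≤ N, ∃ C0, EC (Ph n ^ i * Ps n ^ (N - i)) (N * n) C0 := by
    intro i hi
    obtain ⟨C1, h1⟩ := (Ph_EC n).pow i
    obtain ⟨C2, h2⟩ := ((Ph_EC n).eu).pow (N - i)
    have := h1.mul h2
    rw [← add_mul, Nat.add_sub_cancel' hi] at this
    exact ⟨_, this⟩
  choose! C0 h0 using h
  refine ⟨∑ i ∈ range (N+1), C0 i + 1, by omega, fun i hi => (h0 i hi).monoC ?_⟩
  have := single_le_sum (f := C0) (fun i _ => Nat.zero_le _) (s := range (N+1)) (mem_range.2 (Nat.lt_succ_of_le hi))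
  omega

lemma succ_le_two_pow (L : ℕ) : L + 1 ≤ 2 ^ L := Nat.lt_two_pow_self

lemma siegel (N n : ℕ) (hN : 1 ≤ N) : ∃ C : ℕ, 1 ≤ C ∧ ∀ L, 1 ≤ L → ∃ p : ℕ → Polynomial ℤ,
    (∃ i ≤ N, p i ≠ 0) ∧ (∀ i, (p i).natDegree ≤ L) ∧ (∀ i, N < i → p i = 0) ∧
    (∀ i j, |(p i).coeff j| ≤ (2*L)! * (C:ℤ)^L) ∧ (∀ m < N * L, coeff m (Rs N n p) = 0) ∧
    ∀ m, |((coeff m (Rs N n p) : ℚ) : ℝ)| ≤ (2*L)! * (C:ℝ)^(L+m) / (2*m)! := by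
  obtain ⟨C0, hC0, hEC⟩ := siegel_aux N n
  have : ∀ i k, ∃ c : ℤ, i ≤ N → coeff k (Ph n ^ i * Ps n ^ (N - i)) = c / ((2 * k + N * n)! : ℚ)
      ∧ |c| ≤ (C0 : ℤ) ^ (k + 1) := by
    intro i k
    by_cases hi : i ≤ N
    · obtain ⟨c, hc⟩ := (hEC i hi).2 k; exact ⟨c, fun _ => hc⟩
    · exact ⟨0, fun h => absurd h hi⟩
  choose c hc using this
  set q := N * n with hq
  set K0 : ℕ := 2^(2*N+q) * C0^(N+1) with hK0
  have hK0' : 1 ≤ K0 := Nat.succ_le_of_lt (by positivity)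
  set K1 : ℕ := (2*(N+1)*K0)^N with hK1
  have hK1' : 1 ≤ K1 := Nat.succ_le_of_lt (by positivity)
  refine ⟨2*(N+1)*K1*2^q*C0*4, Nat.succ_le_of_lt (by positivity), fun L hL => ?_⟩
  let a : ℕ → ℕ → ℕ → ℤ := fun m i j => if j ≤ m then ((2*m+q).choose (2*j) : ℤ) * c i (m-j) else 0
  have ha : ∀ m i j, i ≤ N → |a m i j| ≤ 2^(2*m+q) * (C0:ℤ)^(m+1) := by
    intro m i j hi
    simp only [a]
    split_ifs with h
    · rw [abs_mul, abs_of_nonneg (by positivity)]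
      have h1 : ((2*m+q).choose (2*j) : ℤ) ≤ 2^(2*m+q) := by
        exact_mod_cast Nat.choose_le_two_pow _ _
      have h2 : |c i (m-j)| ≤ (C0:ℤ)^(m+1) := (hc i (m-j) hi).2.trans
        (pow_le_pow_right₀ (by exact_mod_cast hC0) (by omega))
      exact mul_le_mul h1 h2 (abs_nonneg _) (by positivity)
    · rw [abs_zero]; positivity
  let A : Matrix (Fin (N*L)) (Fin (N+1) × Fin (L+1)) ℤ := fun m ij => a m ij.1 ij.2
  have hA : ‖A‖ ≤ ((K0:ℝ)^L) := by
    rw [Matrix.norm_le_iff (by positivity)]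
    intro m ij
    have h1 := ha m ij.1 ij.2 (Nat.le_of_lt_succ ij.1.2)
    have h2 : 2^(2*(m:ℕ)+q) * (C0:ℤ)^((m:ℕ)+1) ≤ (K0:ℤ)^L := by
      rw [hK0]; push_cast
      rw [mul_pow, ← pow_mul, ← pow_mul]
      have hm := m.2
      have e1 : 2*(m:ℕ)+q ≤ (2*N+q)*L := by nlinarith
      have e2 : (m:ℕ)+1 ≤ (N+1)*L := by nlinarith
      gcongr
      · norm_num
      · exact_mod_cast hC0
    rw [Int.norm_eq_abs]
    exact_mod_cast h1.trans h2
  obtain ⟨t, ht0, htA, htn⟩ := Int.Matrix.exists_ne_zero_int_vec_norm_le A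
    (by simp; nlinarith) (by rw [Fintype.card_fin]; positivity)
  have htn' : ‖t‖ ≤ (K1:ℝ)^L := by
    refine htn.trans ?_
    simp only [Fintype.card_prod, Fintype.card_fin]
    have hb1 : (1:ℝ) ≤ (K0:ℝ)^L := one_le_pow₀ (by exact_mod_cast hK0')
    have hb : (((N+1)*(L+1):ℕ):ℝ) * max 1 ‖A‖ ≤ ((2*(N+1)*K0:ℕ):ℝ)^L := by
      calc (((N+1)*(L+1):ℕ):ℝ) * max 1 ‖A‖ ≤ (((N+1)^L*2^L:ℕ):ℝ) * (K0:ℝ)^L := by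
            refine mul_le_mul ?_ (max_le hb1 hA) (by positivity) (by positivity)
            exact_mod_cast Nat.mul_le_mul (Nat.le_self_pow (by omega) _) (succ_le_two_pow L)
        _ = _ := by push_cast; rw [mul_pow, mul_pow]; ring
    have hb0 : (1:ℝ) ≤ (((N+1)*(L+1):ℕ):ℝ) * max 1 ‖A‖ := by
      have e1 : (1:ℝ) ≤ (((N+1)*(L+1):ℕ):ℝ) := by exact_mod_cast Nat.succ_le_of_lt (by positivity)
      have e2 := le_max_left (1:ℝ) ‖A‖
      nlinarith
    calc _ ≤ ((((N+1)*(L+1):ℕ):ℝ) * max 1 ‖A‖) ^ (N:ℝ) := by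
          apply Real.rpow_le_rpow_of_exponent_le hb0
          push_cast
          have h0 : (0:ℝ) < (N+1)*(L+1) - N*L := by
            have : (0:ℝ) ≤ N := by positivity
            have : (0:ℝ) ≤ L := by positivity
            nlinarith
          rw [div_le_iff₀ h0]
          have : (0:ℝ) ≤ N := by positivity
          nlinarith
      _ = ((((N+1)*(L+1):ℕ):ℝ) * max 1 ‖A‖) ^ N := Real.rpow_natCast _ _
      _ ≤ (((2*(N+1)*K0:ℕ):ℝ)^L)^N := by gcongr
      _ = _ := by rw [hK1]; push_cast; rw [← pow_mul, ← pow_mul, mul_comm L N]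
  have htb : ∀ ij, |t ij| ≤ (K1:ℤ)^L := by
    intro ij
    have h1 := (norm_le_pi_norm t ij).trans htn'
    rw [Int.norm_eq_abs] at h1
    exact_mod_cast h1
  -- coefficients
  let s : ℕ → ℕ → ℤ := fun i j => if h : i < N+1 ∧ j < L+1 then t (⟨i, h.1⟩, ⟨j, h.2⟩) else 0
  have hsb : ∀ i j, |s i j| ≤ (K1:ℤ)^L := by
    intro i j; simp only [s]; split_ifs
    · exact htb _
    · rw [abs_zero]; positivity
  let f : ℕ → ℤ := fun j => (((2*L)! / (2*j)! : ℕ) : ℤ)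
  have hf : ∀ j ≤ L, (f j : ℚ) = (2*L)! / (2*j)! := by
    intro j hj
    simp only [f]
    rw [Int.cast_natCast, Nat.cast_div (Nat.factorial_dvd_factorial (by omega)) (by positivity)]
  let p : ℕ → Polynomial ℤ := fun i => ∑ j ∈ range (L+1), Polynomial.monomial j (s i j * f j)
  have hpc : ∀ i j, (p i).coeff j = if j < L+1 then s i j * f j else 0 := by
    intro i j
    simp only [p, Polynomial.finsetSum_coeff, Polynomial.coeff_monomial]
    simp
  have hpd : ∀ i, (p i).natDegree ≤ L := by
    intro i
    rw [Polynomial.natDegree_le_iff_coeff_eq_zero]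
    intro j hj
    rw [hpc, if_neg (by omega)]
  have hR : ∀ m, coeff m (Rs N n p) = ((2*L)! / (2*m+q)! : ℚ) *
      ∑ i ∈ range (N+1), ∑ j ∈ range (L+1), (a m i j * s i j : ℤ) := by
    intro m
    unfold Rs fev
    rw [map_sum, Int.cast_sum, mul_sum]
    refine sum_congr rfl fun i hi => ?_
    have hi : i ≤ N := Nat.le_of_lt_succ (mem_range.1 hi)
    rw [aeval_X_eq, coeff_polymul _ _ L m ((Polynomial.natDegree_map_le).trans (hpd i)), Int.cast_sum, mul_sum]
    refine sum_congr rfl fun j hj => ?_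
    have hj := mem_range.1 hj
    rw [Polynomial.coeff_map, hpc, if_pos hj]
    simp only [a]
    split_ifs with hjm
    · rw [(hc i (m-j) hi).1]
      push_cast
      have hch := Nat.choose_mul_factorial_mul_factorial (n := 2*m+q) (k := 2*j) (by omega)
      rw [show 2*m+q-2*j = 2*(m-j)+q by omega] at hch
      have hch' : ((2*m+q).choose (2*j) : ℚ) * (2*j)! * (2*(m-j)+q)! = (2*m+q)! := by exact_mod_cast hch
      have n1 : ((2*j)! : ℚ) ≠ 0 := by positivity
      have n2 : ((2*(m-j)+q)! : ℚ) ≠ 0 := by positivity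
      have n3 : ((2*m+q).choose (2*j) : ℚ) ≠ 0 := by
        have := Nat.choose_pos (n := 2*m+q) (k := 2*j) (by omega)
        positivity
      simp only [eq_intCast, Int.cast_mul, hf j (show j ≤ L by omega)]
      rw [← hch']
      field_simp
    · simp
  refine ⟨p, ?_, hpd, ?_, ?_, ?_, ?_⟩
  · obtain ⟨⟨i, j⟩, hij⟩ := Function.ne_iff.1 ht0
    refine ⟨i, Nat.le_of_lt_succ i.2, fun h => ?_⟩
    have := hpc i j
    rw [h, if_pos j.2] at this
    have hs : s i j = t (i, j) := by simp only [s]; rw [dif_pos ⟨i.2, j.2⟩]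
    rw [hs, Polynomial.coeff_zero] at this
    rcases mul_eq_zero.1 this.symm with h | h
    · exact hij h
    · simp only [f] at h
      have h' : (2*L)! / (2*(j:ℕ))! = 0 := by exact_mod_cast h
      rw [Nat.div_eq_zero_iff] at h'
      rcases h' with h' | h'
      · exact (Nat.factorial_pos _).ne' h'
      · exact absurd (Nat.factorial_le (show 2*(j:ℕ) ≤ 2*L by have := j.2; omega)) (by omega)
  · intro i hi
    ext j
    rw [hpc]
    have : s i j = 0 := by simp only [s]; rw [dif_neg (by omega)]
    simp [this]
  · intro i j
    rw [hpc]
    split_ifs with hj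
    · rw [abs_mul, mul_comm]
      have h1 : |f j| ≤ (2*L)! := by
        simp only [f]; rw [Nat.abs_cast]; exact_mod_cast Nat.div_le_self _ _
      have h2 : (K1:ℤ)^L ≤ ((2*(N+1)*K1*2^q*C0*4 : ℕ):ℤ)^L := by
        gcongr
        rw [show 2*(N+1)*K1*2^q*C0*4 = K1 * (2*(N+1)*2^q*C0*4) by ring]
        exact Nat.le_mul_of_pos_right _ (by positivity)
      exact mul_le_mul h1 ((hsb i j).trans h2) (abs_nonneg _) (by positivity)
    · rw [abs_zero]; positivity
  · intro m hm
    rw [hR]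
    have h1 := congrFun htA ⟨m, hm⟩
    have h2 : ∑ i ∈ range (N+1), ∑ j ∈ range (L+1), (a m i j * s i j : ℤ) = 0 := by
      refine Eq.trans ?_ h1
      simp only [Matrix.mulVec, dotProduct, Fintype.sum_prod_type]
      rw [Finset.sum_range]
      refine sum_congr rfl fun i _ => ?_
      rw [Finset.sum_range]
      refine sum_congr rfl fun j _ => ?_
      have hs : s i j = t (i, j) := by simp only [s]; rw [dif_pos ⟨i.2, j.2⟩]
      rw [hs]
    rw [h2, Int.cast_zero, mul_zero]
  · intro m
    rw [hR]
    have h1 : |∑ i ∈ range (N+1), ∑ j ∈ range (L+1), (a m i j * s i j : ℤ)| ≤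
        (N+1) * ((L+1) * (2^(2*m+q) * (C0:ℤ)^(m+1) * (K1:ℤ)^L)) := by
      refine (abs_sum_le_sum_abs _ _).trans ?_
      have : ∀ i ∈ range (N+1), |∑ j ∈ range (L+1), (a m i j * s i j : ℤ)| ≤
          ((L+1) * (2^(2*m+q) * (C0:ℤ)^(m+1) * (K1:ℤ)^L)) := by
        intro i hi
        have hi : i ≤ N := Nat.le_of_lt_succ (mem_range.1 hi)
        refine (abs_sum_le_sum_abs _ _).trans ?_
        have : ∀ j ∈ range (L+1), |(a m i j * s i j : ℤ)| ≤ (2^(2*m+q) * (C0:ℤ)^(m+1) * (K1:ℤ)^L) := by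
          intro j _
          rw [abs_mul]
          exact mul_le_mul (ha m i j hi) (hsb i j) (abs_nonneg _) (by positivity)
        refine (sum_le_card_nsmul _ _ _ this).trans (le_of_eq ?_)
        simp
      refine (sum_le_card_nsmul _ _ _ this).trans (le_of_eq ?_)
      simp
    have h2 : |((∑ i ∈ range (N+1), ∑ j ∈ range (L+1), (a m i j * s i j : ℤ) : ℤ) : ℝ)| ≤
        (N+1) * ((L+1) * (2^(2*m+q) * (C0:ℝ)^(m+1) * (K1:ℝ)^L)) := by exact_mod_cast h1
    have h3 : (N+1) * ((L+1) * (2^(2*m+q) * C0^(m+1) * K1^L)) ≤ (2*(N+1)*K1*2^q*C0*4)^(L+m) := by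
      calc (N+1) * ((L+1) * (2^(2*m+q) * C0^(m+1) * K1^L))
          ≤ (N+1)^L * (2^L * ((2^q)^L * 4^m * (C0^L * C0^m) * K1^L)) := by
            have e1 : 2^(2*m+q) = 2^q * 4^m := by
              rw [pow_add, pow_mul]; norm_num [mul_comm]
            have e2 : C0^(m+1) = C0 * C0^m := pow_succ' _ _
            rw [e1, e2]
            have g1 : N+1 ≤ (N+1)^L := Nat.le_self_pow (by omega) _
            have g2 := succ_le_two_pow L
            have g3 : 2^q ≤ (2^q)^L := Nat.le_self_pow (by omega) _
            have g4 : C0 ≤ C0^L := Nat.le_self_pow (by omega) _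
            gcongr
        _ = (2*(N+1)*K1*2^q*C0)^L * (4*C0)^m := by simp only [mul_pow]; ring
        _ ≤ (2*(N+1)*K1*2^q*C0*4)^L * (2*(N+1)*K1*2^q*C0*4)^m := by
            refine Nat.mul_le_mul (Nat.pow_le_pow_left ?_ _) (Nat.pow_le_pow_left ?_ _)
            · exact Nat.le_mul_of_pos_right _ (by norm_num)
            · rw [show 2*(N+1)*K1*2^q*C0*4 = 4*C0 * (2*(N+1)*K1*2^q) by ring]
              exact Nat.le_mul_of_pos_right _ (by positivity)
        _ = _ := by rw [pow_add]
    have h4 : (N+1) * ((L+1) * (2^(2*m+q) * (C0:ℝ)^(m+1) * (K1:ℝ)^L)) ≤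
      ((2*(N+1)*K1*2^q*C0*4 : ℕ) : ℝ)^(L+m) := by exact_mod_cast h3
    have h5 : (((2*m)! : ℕ) : ℝ) ≤ (2*m+q)! := by exact_mod_cast Nat.factorial_le (by omega)
    push_cast at h2 h4 ⊢
    rw [abs_mul, abs_of_nonneg (a := ((2*L)! / (2*m+q)! : ℝ)) (by positivity)]
    calc _ ≤ ((2*L)! / (2*m)! : ℝ) * (2*(N+1)*K1*2^q*C0*4)^(L+m) := by
          gcongr
          exact h2.trans h4
      _ = _ := by ring
end Bg

namespace Bg
open Finset Filter Topology
open scoped Nat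

section ord
variable {𝕜 : Type*} [NontriviallyNormedField 𝕜]

lemma vo_mul_right {f g : 𝕜 → 𝕜} {β : 𝕜} {m : ℕ} (hf : AnalyticAt 𝕜 f β) (hg : AnalyticAt 𝕜 g β)
    (h : (m : ℕ∞) ≤ analyticOrderAt g β) : (m : ℕ∞) ≤ analyticOrderAt (f * g) β := by
  rw [analyticOrderAt_mul hf hg]
  exact h.trans le_add_self

lemma vo_sum {ι : Type*} (s : Finset ι) {f : ι → 𝕜 → 𝕜} {β : 𝕜} {m : ℕ}
    (h : ∀ i ∈ s, AnalyticAt 𝕜 (f i) β ∧ (m : ℕ∞) ≤ analyticOrderAt (f i) β) :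
    AnalyticAt 𝕜 (∑ i ∈ s, f i) β ∧ (m : ℕ∞) ≤ analyticOrderAt (∑ i ∈ s, f i) β := by
  classical
  induction s using Finset.induction_on with
  | empty =>
    refine ⟨by rw [sum_empty]; exact analyticAt_const (v := (0:𝕜)), ?_⟩
    have : analyticOrderAt (∑ i ∈ (∅ : Finset ι), f i) β = ⊤ := by
      rw [analyticOrderAt_eq_top]; simp
    rw [this]; exact le_top
  | insert a s ha ih =>
    rw [sum_insert ha]
    obtain ⟨h1, h2⟩ := ih (fun i hi => h i (mem_insert_of_mem hi))
    obtain ⟨h3, h4⟩ := h a (mem_insert_self _ _)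
    exact ⟨h3.add h1, (le_min h4 h2).trans le_analyticOrderAt_add⟩

lemma analyticAt_poly (p : Polynomial 𝕜) (β : 𝕜) : AnalyticAt 𝕜 (fun z => p.eval z) β := by
  have := AnalyticAt.aeval_polynomial (analyticAt_id (𝕜 := 𝕜) (z := β)) p
  simpa using this

lemma vo_poly {p : Polynomial 𝕜} {β : 𝕜} {m : ℕ}
    (h : (m : ℕ∞) ≤ analyticOrderAt (fun z => p.eval z) β) : (Polynomial.X - Polynomial.C β) ^ m ∣ p := by
  by_cases hp : p = 0
  · simp [hp]
  obtain ⟨q, hq, hq'⟩ := Polynomial.exists_eq_pow_rootMultiplicity_mul_and_not_dvd p hp β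
  have hqβ : q.eval β ≠ 0 := fun h => hq' (Polynomial.dvd_iff_isRoot.2 h)
  have hord : analyticOrderAt (fun z => p.eval z) β = (p.rootMultiplicity β : ℕ) := by
    rw [(analyticAt_poly p β).analyticOrderAt_eq_natCast]
    refine ⟨fun z => q.eval z, analyticAt_poly q β, hqβ, Eventually.of_forall fun z => ?_⟩
    conv_lhs => rw [hq]
    simp
  rw [hord] at h
  have h : m ≤ p.rootMultiplicity β := by exact_mod_cast h
  exact (pow_dvd_pow _ h).trans (Polynomial.pow_rootMultiplicity_dvd p β)

lemma vo_det {ι : Type*} [Fintype ι] [DecidableEq ι] (M : Matrix ι ι (Polynomial 𝕜)) (y : ι → 𝕜 → 𝕜)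
    (β : 𝕜) (m : ℕ) (hy : ∀ j, AnalyticAt 𝕜 (y j) β) (j0 : ι) (hj0 : y j0 β ≠ 0)
    (h : ∀ k, (m : ℕ∞) ≤ analyticOrderAt (fun z => ∑ j, (M k j).eval z * y j z) β) :
    (Polynomial.X - Polynomial.C β) ^ m ∣ M.det := by
  apply vo_poly
  have hF : ∀ k, AnalyticAt 𝕜 (fun z => ∑ j, (M k j).eval z * y j z) β := by
    intro k
    exact Finset.analyticAt_fun_sum _ fun j _ => (analyticAt_poly _ _).mul (hy j)
  have h1 := vo_sum (m := m) (β := β) univ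
    (f := fun k => (fun z => (M.adjugate j0 k).eval z) * (fun z => ∑ j, (M k j).eval z * y j z))
    (fun k _ => ⟨(analyticAt_poly _ _).mul (hF k), vo_mul_right (analyticAt_poly _ _) (hF k) (h k)⟩)
  have h2 : (∑ k, (fun z => (M.adjugate j0 k).eval z) * (fun z => ∑ j, (M k j).eval z * y j z))
      = (fun z => M.det.eval z) * y j0 := by
    ext z
    rw [Finset.sum_apply]
    simp only [Pi.mul_apply, mul_sum]
    rw [sum_comm]
    have h3 : ∀ j, ∑ k, M.adjugate j0 k * M k j = if j0 = j then M.det else 0 := by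
      intro j
      have := congrFun (congrFun (Matrix.adjugate_mul M) j0) j
      rw [Matrix.mul_apply] at this
      rw [this]
      simp [Matrix.smul_apply, Matrix.one_apply]
    have h4 : ∀ j, ∑ k, (M.adjugate j0 k).eval z * ((M k j).eval z * y j z)
        = (if j0 = j then M.det else 0 : Polynomial 𝕜).eval z * y j z := by
      intro j
      rw [← h3 j, Polynomial.eval_finsetSum, sum_mul]
      refine sum_congr rfl fun k _ => ?_
      rw [Polynomial.eval_mul]; ring
    rw [sum_congr rfl fun j _ => h4 j, sum_eq_single j0]
    · simp
    · intro j _ hj; simp [hj.symm]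
    · simp
  rw [h2, analyticOrderAt_mul (analyticAt_poly _ _) (hy j0),
    ((hy j0).analyticOrderAt_eq_zero).2 hj0, add_zero] at h1
  exact h1.2

lemma two_points {p : Polynomial 𝕜} (hp : p ≠ 0) {α β : 𝕜} (hαβ : α ≠ β) {a b : ℕ}
    (h1 : (Polynomial.X - Polynomial.C α) ^ a ∣ p) (h2 : (Polynomial.X - Polynomial.C β) ^ b ∣ p) :
    a + b ≤ p.natDegree := by
  have hc : IsCoprime ((Polynomial.X - Polynomial.C α) ^ a) ((Polynomial.X - Polynomial.C β) ^ b) :=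
    (Polynomial.isCoprime_X_sub_C_of_isUnit_sub (sub_ne_zero.2 hαβ).isUnit).pow
  have h3 := Polynomial.natDegree_le_of_dvd (hc.mul_dvd h1 h2) hp
  rw [Polynomial.natDegree_mul (pow_ne_zero _ (Polynomial.X_sub_C_ne_zero _))
    (pow_ne_zero _ (Polynomial.X_sub_C_ne_zero _))] at h3
  simpa using h3

variable [CompleteSpace 𝕜] [CharZero 𝕜]

lemma vo_deriv {f : 𝕜 → 𝕜} {β : 𝕜} {m : ℕ} (hf : AnalyticAt 𝕜 f β)
    (h : ((m + 1 : ℕ) : ℕ∞) ≤ analyticOrderAt f β) : (m : ℕ∞) ≤ analyticOrderAt (deriv f) β := by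
  have h0 : f β = 0 := apply_eq_zero_of_analyticOrderAt_ne_zero (fun h' => by rw [h'] at h; simp at h)
  have := hf.analyticOrderAt_deriv_add_one
  simp only [h0, sub_zero] at this
  rw [← this] at h
  push_cast at h
  exact (ENat.add_le_add_iff_right ENat.one_ne_top).1 h

lemma vo_of_deriv {f : 𝕜 → 𝕜} {β : 𝕜} {m : ℕ} (hf : AnalyticAt 𝕜 f β) (h0 : f β = 0)
    (h : (m : ℕ∞) ≤ analyticOrderAt (deriv f) β) : ((m + 1 : ℕ) : ℕ∞) ≤ analyticOrderAt f β := by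
  have := hf.analyticOrderAt_deriv_add_one
  simp only [h0, sub_zero] at this
  rw [← this]
  push_cast
  gcongr

lemma vo_iter_deriv {f : 𝕜 → 𝕜} {β : 𝕜} {m : ℕ} (k : ℕ) (hf : AnalyticAt 𝕜 f β)
    (h : ((m + k : ℕ) : ℕ∞) ≤ analyticOrderAt f β) : (m : ℕ∞) ≤ analyticOrderAt (deriv^[k] f) β := by
  induction k generalizing f with
  | zero => simpa using h
  | succ k ih =>
    rw [Function.iterate_succ_apply]
    have h1 : (((m + k) + 1 : ℕ) : ℕ∞) ≤ analyticOrderAt f β := h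
    have h2 := vo_deriv hf h1
    exact ih hf.deriv h2
end ord

lemma ent_eu_iter {f : PowerSeries ℚ} (hf : Ent f) (k : ℕ) : Ent (eu^[k] f) := by
  induction k generalizing f with
  | zero => exact hf
  | succ k ih => rw [Function.iterate_succ_apply]; exact ih hf.eu

lemma ord_eu {f : PowerSeries ℚ} (hf : Ent f) {α : ℝ} (hα : α ≠ 0) :
    analyticOrderAt (ev (eu f)) α = analyticOrderAt (deriv (ev f)) α := by
  have : ev (eu f) = (fun t => t) * deriv (ev f) := by ext t; rw [ev_eu hf]; rfl
  have hid : AnalyticAt ℝ (fun t : ℝ => t) α := analyticAt_id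
  rw [this, analyticOrderAt_mul hid (ev_analytic hf α).deriv,
    (hid.analyticOrderAt_eq_zero).2 hα, zero_add]

lemma vo_of_eu {f : PowerSeries ℚ} (hf : Ent f) {α : ℝ} (hα : α ≠ 0) (K : ℕ)
    (h : ∀ k < K, ev (eu^[k] f) α = 0) : (K : ℕ∞) ≤ analyticOrderAt (ev f) α := by
  induction K generalizing f with
  | zero => simp
  | succ K ih =>
    refine vo_of_deriv (ev_analytic hf α) (h 0 (by omega)) ?_
    rw [← ord_eu hf hα]
    exact ih hf.eu (fun k hk => h (k+1) (by omega))

lemma vo_eu_iter {f : PowerSeries ℚ} (hf : Ent f) {α : ℝ} (hα : α ≠ 0) (m k : ℕ)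
    (h : ((m + k : ℕ) : ℕ∞) ≤ analyticOrderAt (ev f) α) :
    (m : ℕ∞) ≤ analyticOrderAt (ev (eu^[k] f)) α := by
  induction k generalizing f with
  | zero => simpa using h
  | succ k ih =>
    rw [Function.iterate_succ_apply]
    apply ih hf.eu
    rw [ord_eu hf hα]
    exact vo_deriv (ev_analytic hf α) h

lemma vo_zero {f : PowerSeries ℚ} (hf : Ent f) (m : ℕ) (h : ∀ k < m, PowerSeries.coeff k f = 0) :
    (m : ℕ∞) ≤ analyticOrderAt (ev f) 0 := by
  obtain ⟨g, hg⟩ := PowerSeries.X_pow_dvd_iff.2 h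
  have hgE : Ent g := by
    intro r hr
    have h1 := hf (r+1) (by positivity)
    have h2 := (summable_nat_add_iff m).2 h1
    refine Summable.of_nonneg_of_le (fun k => by positivity) (fun k => ?_) h2
    rw [hg, mul_comm (PowerSeries.X ^ m) g, PowerSeries.coeff_mul_X_pow]
    gcongr
    calc r^k ≤ (r+1)^k := by gcongr; linarith
      _ ≤ (r+1)^(k+m) := pow_le_pow_right₀ (by linarith) (by omega)
  rw [natCast_le_analyticOrderAt (ev_analytic hf 0)]
  refine ⟨ev g, ev_analytic hgE 0, Eventually.of_forall fun z => ?_⟩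
  have := ev_poly (Polynomial.X ^ m) z
  have hX : Ent ((PowerSeries.X : PowerSeries ℚ)^m) := by simpa using Ent.poly (Polynomial.X^m)
  rw [hg, ev_mul hX hgE]
  simp at this
  simp [this]
end Bg

namespace Bg
open Finset Filter Topology
open scoped Nat

noncomputable def psi (n : ℕ) (t : ℝ) : ℝ := ev (Ps n) t

lemma phi_zero (n : ℕ) : phi n 0 = 1 := by
  unfold phi ev
  rw [tsum_eq_single 0]
  · simp [Ph, ca]
  · intro k hk; simp [hk]

lemma phi_diff (n : ℕ) (t : ℝ) (ht : t ≠ 0) : HasDerivAt (phi n) (psi n t / t) t := by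
  have h := (ev_analytic (Ph_ent n) t).differentiableAt.hasDerivAt
  have h2 := ev_eu (Ph_ent n) t
  have : deriv (ev (Ph n)) t = psi n t / t := by
    rw [psi, Ps, h2]; field_simp
  rw [this] at h
  exact h

lemma psi_ode (n : ℕ) (t : ℝ) : ev (eu (Ps n)) t = - t * phi n t - n / 2 * psi n t := by
  have h := Rs_Dt 1 n (fun i => if i = 0 then 1 else 0)
  have e := (Rs_ent 1 n (fun i => if i = 0 then 1 else 0)).2 t
  have e2 := (Rs_ent 1 n (Dt 1 n (fun i => if i = 0 then 1 else 0))).2 t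
  have hr : Rs 1 n (fun i => if i = 0 then 1 else 0) = Ps n := by
    simp [Rs, fev, sum_range_succ]
  rw [hr] at h
  rw [h] at e2
  have h3 : ev (2 * eu (Ps n)) t = 2 * ev (eu (Ps n)) t := by
    rw [two_mul, ev_add (Ps_ent n).eu (Ps_ent n).eu, two_mul]
  rw [h3] at e2
  simp [fev, sum_range_succ, Dt] at e2
  unfold psi
  linarith

lemma psi_diff (n : ℕ) (t : ℝ) (ht : t ≠ 0) : HasDerivAt (psi n) (- phi n t - n / 2 * psi n t / t) t := by
  have h := (ev_analytic (Ps_ent n) t).differentiableAt.hasDerivAt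
  have h2 := ev_eu (Ps_ent n) t
  rw [psi_ode] at h2
  have : deriv (ev (Ps n)) t = - phi n t - n / 2 * psi n t / t := by
    field_simp
    linarith
  rw [this] at h
  exact h

lemma phi_osc (n : ℕ) (T : ℝ) : ∃ t > T, phi n t = 0 := by
  by_contra! hne
  set ν : ℝ := n / 2 with hν
  have hν0 : 0 ≤ ν := by positivity
  set u : ℝ → ℝ := fun t => psi n t / phi n t with hu
  set T0 : ℝ := max T 0 + ν^2 + 1 with hT0
  have hT0T : ∀ t, T0 ≤ t → T < t ∧ 0 < t ∧ ν^2 ≤ t := by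
    intro t ht
    have h1 := le_max_left T 0
    have h2 := le_max_right T 0
    have h3 := sq_nonneg ν
    refine ⟨by linarith, by linarith, by linarith⟩
  have hud : ∀ t, T0 ≤ t → HasDerivAt u (-1 - (ν * u t + u t ^ 2) / t) t := by
    intro t ht
    obtain ⟨h1, h2, h3⟩ := hT0T t ht
    have h4 := hne t h1
    have := (psi_diff n t h2.ne').div (phi_diff n t h2.ne') h4
    convert! this using 1
    simp only [hu]
    field_simp
    ring
  have key1 : AntitoneOn (fun t => u t + t / 2) (Set.Ici T0) := by
    have hd : ∀ t, T0 ≤ t → HasDerivAt (fun t => u t + t / 2) (-1 - (ν * u t + u t ^ 2) / t + 1 / 2) t :=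
      fun t ht => (hud t ht).add ((hasDerivAt_id t).div_const 2)
    apply antitoneOn_of_deriv_nonpos (convex_Ici T0)
    · exact fun t ht => (hd t ht).continuousAt.continuousWithinAt
    · intro t ht
      rw [interior_Ici] at ht
      exact (hd t ht.le).differentiableAt.differentiableWithinAt
    · intro t ht
      rw [interior_Ici] at ht
      rw [(hd t ht.le).deriv]
      obtain ⟨h1, h2, h3⟩ := hT0T t ht.le
      have : -(ν * u t + u t ^ 2) / t ≤ 1 / 4 := by
        rw [div_le_iff₀ h2]
        nlinarith [sq_nonneg (u t + ν / 2)]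
      have e : -(ν * u t + u t ^ 2) / t = - ((ν * u t + u t ^ 2) / t) := by ring
      linarith
  set T1 : ℝ := T0 + 2 * |u T0| + 4 * ν + 2 with hT1
  have hT01 : T0 ≤ T1 := by
    have := abs_nonneg (u T0)
    linarith
  have hsm : ∀ t, T1 ≤ t → u t ≤ - 2 * ν - 1 := by
    intro t ht
    have := key1 (Set.mem_Ici.2 le_rfl) (Set.mem_Ici.2 (hT01.trans ht)) (hT01.trans ht)
    simp only at this
    have h2 := le_abs_self (u T0)
    linarith
  have key2 : AntitoneOn (fun t => - (u t)⁻¹ + Real.log t / 2) (Set.Ici T1) := by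
    have hd : ∀ t, T1 ≤ t → HasDerivAt (fun t => - (u t)⁻¹ + Real.log t / 2)
        (-(-(-1 - (ν * u t + u t ^ 2) / t) / u t ^ 2) + t⁻¹ / 2) t := by
      intro t ht
      have h1 := hT0T t (hT01.trans ht)
      have h2 := hsm t ht
      exact ((hud t (hT01.trans ht)).inv (by linarith)).neg.add ((Real.hasDerivAt_log h1.2.1.ne').div_const 2)
    apply antitoneOn_of_deriv_nonpos (convex_Ici T1)
    · exact fun t ht => (hd t ht).continuousAt.continuousWithinAt
    · intro t ht
      rw [interior_Ici] at ht
      exact (hd t ht.le).differentiableAt.differentiableWithinAt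
    · intro t ht
      rw [interior_Ici] at ht
      rw [(hd t ht.le).deriv]
      obtain ⟨h1, h2, h3⟩ := hT0T t (hT01.trans ht.le)
      have h4 := hsm t ht.le
      have h5 : u t < 0 := by linarith
      have h6 : u t ^ 2 / 2 ≤ ν * u t + u t ^ 2 := by nlinarith
      have h8 : u t ≠ 0 := h5.ne
      have h7 : 0 < u t ^ 2 := by positivity
      have : -(-(-1 - (ν * u t + u t ^ 2) / t) / u t ^ 2) + t⁻¹ / 2
          = (- t - (ν * u t + u t ^ 2 - u t ^ 2 / 2)) / (t * u t ^ 2) := by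
        field_simp; ring
      rw [this]
      apply div_nonpos_of_nonpos_of_nonneg
      · linarith
      · positivity
  set M := - (u T1)⁻¹ + Real.log T1 / 2 with hM
  have hb : ∀ t, T1 ≤ t → Real.log t / 2 ≤ M := by
    intro t ht
    have h := key2 (Set.mem_Ici.2 le_rfl) (Set.mem_Ici.2 ht) ht
    simp only at h
    have h4 := hsm t ht
    have h5 : (u t)⁻¹ < 0 := inv_lt_zero.2 (by linarith)
    linarith
  have h1 := hb (max T1 (Real.exp (2 * M + 2))) (le_max_left _ _)
  have h2 : 2 * M + 2 ≤ Real.log (max T1 (Real.exp (2 * M + 2))) := by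
    rw [← Real.log_exp (2 * M + 2)]
    apply Real.log_le_log (Real.exp_pos _)
    rw [Real.log_exp]
    exact le_max_right _ _
  linarith

lemma Rs_iter (N n : ℕ) (p : ℕ → Polynomial ℤ) (k : ℕ) :
    Rs N n ((Dt N n)^[k] p) = 2 ^ k * eu^[k] (Rs N n p) := by
  induction k generalizing p with
  | zero => simp
  | succ k ih =>
    rw [Function.iterate_succ_apply, ih, Rs_Dt, Function.iterate_succ_apply]
    have : ∀ (k : ℕ) (f : PowerSeries ℚ), eu^[k] (2 * f) = 2 * eu^[k] f := by
      intro k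
      induction k with
      | zero => intro f; rfl
      | succ k ih =>
        intro f
        rw [Function.iterate_succ_apply, Function.iterate_succ_apply, ← ih]
        congr 1
        rw [two_mul, map_add, two_mul]
    rw [this, pow_succ]; ring

lemma ev_two_pow {f : PowerSeries ℚ} (hf : Ent f) (k : ℕ) (t : ℝ) : ev (2 ^ k * f) t = 2 ^ k * ev f t := by
  induction k with
  | zero => simp
  | succ k ih =>
    have h2 : Ent (2 ^ k * f) := by
      have e : ((2 ^ k : Polynomial ℚ) : PowerSeries ℚ) = 2 ^ k := by
        rw [Polynomial.coe_pow]; congr 1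
        exact map_ofNat (Polynomial.coeToPowerSeries.ringHom) 2
      rw [← e]; exact (Ent.poly (2^k)).mul hf
    rw [pow_succ', mul_assoc, two_mul, ev_add h2 h2, ih]; ring

lemma psi_ne_zero (n : ℕ) (α : ℝ) (hα : α ≠ 0) (h : phi n α = 0) : psi n α ≠ 0 := by
  intro h2
  have hv : ∀ p, ev (Rs 1 n p) α = 0 := by
    intro p
    rw [(Rs_ent 1 n p).2]
    change ev (Ps n) α = 0 at h2
    simp [fev, sum_range_succ, h, h2]
  set p : ℕ → Polynomial ℤ := fun i => if i = 1 then 1 else 0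
  have hp : Rs 1 n p = Ph n := by simp [Rs, fev, sum_range_succ, p]
  have hall : ∀ k, ev (eu^[k] (Ph n)) α = 0 := by
    intro k
    have := hv ((Dt 1 n)^[k] p)
    rw [Rs_iter, hp, ev_two_pow (ent_eu_iter (Ph_ent n) k)] at this
    simpa using this
  have htop : analyticOrderAt (ev (Ph n)) α = ⊤ := by
    rw [ENat.eq_top_iff_forall_ge]
    intro m
    exact vo_of_eu (Ph_ent n) hα m (fun k _ => hall k)
  have hA : AnalyticOnNhd ℝ (ev (Ph n)) Set.univ := fun t _ => ev_analytic (Ph_ent n) t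
  have := hA.eqOn_zero_of_preconnected_of_eventuallyEq_zero isPreconnected_univ (Set.mem_univ α)
    (analyticOrderAt_eq_top.1 htop) (Set.mem_univ 0)
  have h0 := phi_zero n
  unfold phi at h0
  rw [this] at h0
  simp at h0

lemma Rs_ne_zero (N n : ℕ) (p : ℕ → Polynomial ℤ) (hp : ∃ i ≤ N, p i ≠ 0) : Rs N n p ≠ 0 := by
  induction N generalizing p with
  | zero =>
    obtain ⟨i, hi, hpi⟩ := hp
    obtain rfl : i = 0 := by omega
    unfold Rs fev
    simp only [zero_add, sum_range_one, pow_zero, mul_one, Nat.sub_self]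
    rw [aeval_X_eq]
    rw [Ne, Polynomial.coe_eq_zero_iff, Polynomial.map_eq_zero_iff (RingHom.injective_int (Int.castRingHom ℚ))]
    exact hpi
  | succ N ih =>
    intro h0
    have hz : ∀ α, 0 < α → phi n α = 0 → (p 0).eval₂ (Int.castRingHom ℝ) α = 0 := by
      intro α hα hα0
      have h1 := (Rs_ent (N+1) n p).2 α
      rw [h0, ev_zero] at h1
      unfold fev at h1
      rw [sum_range_succ', sum_eq_zero] at h1
      · have := psi_ne_zero n α hα.ne' hα0
        simp only [psi] at this
        simpa [this] using h1.symm
      · intro i _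
        simp [hα0]
    have hp0 : p 0 = 0 := by
      by_contra hne
      have hne' : (p 0).map (Int.castRingHom ℝ) ≠ 0 := by
        simpa [Polynomial.map_eq_zero_iff (RingHom.injective_int (Int.castRingHom ℝ))] using hne
      obtain ⟨B, hB⟩ := (((p 0).map (Int.castRingHom ℝ)).roots.toFinset).bddAbove
      obtain ⟨t, ht, ht0⟩ := phi_osc n (max B 0)
      have hmem : t ∈ ((p 0).map (Int.castRingHom ℝ)).roots.toFinset := by
        rw [Multiset.mem_toFinset, Polynomial.mem_roots hne', Polynomial.IsRoot, Polynomial.eval_map]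
        exact hz t (lt_of_le_of_lt (le_max_right _ _) ht) ht0
      exact absurd (hB hmem) (not_le.2 (lt_of_le_of_lt (le_max_left _ _) ht))
    have hfac : Rs (N+1) n p = Ph n * Rs N n (fun i => p (i+1)) := by
      unfold Rs fev
      rw [sum_range_succ', hp0, mul_sum]
      simp only [Polynomial.eval₂_zero, zero_mul, add_zero]
      refine sum_congr rfl fun i _ => ?_
      rw [Nat.add_sub_add_right]; ring
    rw [hfac] at h0
    rcases mul_eq_zero.1 h0 with h | h
    · have := congrArg (PowerSeries.coeff 0) h
      simp [Ph, ca] at this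
    · obtain ⟨i, hi, hpi⟩ := hp
      obtain ⟨j, rfl⟩ : ∃ j, i = j + 1 := by
        cases i with
        | zero => exact absurd hp0 hpi
        | succ j => exact ⟨j, rfl⟩
      exact ih (fun i => p (i+1)) ⟨j, by omega, hpi⟩ h
end Bg

namespace Bg
open Finset
open scoped Nat

section gen
variable {K : Type*} [Field K] [Differential K]
def LD : K →+ K := (Differential.deriv : Derivation ℤ K K).toLinearMap.toAddMonoidHom

lemma LD_one : LD (1 : K) = 0 := (Differential.deriv : Derivation ℤ K K).map_one_eq_zero

noncomputable def De : Polynomial K →+ Polynomial K :=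
  (Differential.implicitDeriv 1 : Derivation ℤ (Polynomial K) (Polynomial K)).toLinearMap.toAddMonoidHom

lemma De_coeff (e : Polynomial K) (i : ℕ) :
    (De e).coeff i = LD (e.coeff i) + e.coeff (i+1) * (i+1) := by
  have : (Differential.implicitDeriv 1 e).coeff i = (Differential.deriv : Derivation ℤ K K) (e.coeff i) + e.coeff (i+1) * (i+1) := by
    unfold Differential.implicitDeriv
    simp [Polynomial.coeff_derivative]
  exact this

lemma De_mul (a b : Polynomial K) : De (a * b) = a * De b + b * De a :=
  (Differential.implicitDeriv 1 : Derivation ℤ (Polynomial K) (Polynomial K)).leibniz a b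

lemma De_C (a : K) : De (Polynomial.C a) = Polynomial.C (LD a) := by
  ext1 i
  rw [De_coeff, Polynomial.coeff_C, Polynomial.coeff_C, Polynomial.coeff_C]
  by_cases hi : i = 0 <;> simp [hi]

lemma De_X : De (Polynomial.X : Polynomial K) = 1 := by
  have : Differential.implicitDeriv 1 (Polynomial.X : Polynomial K) = 1 := by simp
  exact this

lemma De_span (e : Polynomial K) (k : ℕ) (u : Polynomial K)
    (hu : u ∈ Submodule.span K ((fun j => De^[j] e) '' {j | j ≤ k})) :
    De u ∈ Submodule.span K ((fun j => De^[j] e) '' {j | j ≤ k+1}) := by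
  have hmono : Submodule.span K ((fun j => De^[j] e) '' {j | j ≤ k}) ≤
      Submodule.span K ((fun j => De^[j] e) '' {j | j ≤ k+1}) :=
    Submodule.span_mono (Set.image_mono fun j (hj : j ≤ k) => show j ≤ k+1 by omega)
  refine Submodule.span_induction (p := fun u _ => De u ∈ Submodule.span K ((fun j => De^[j] e) '' {j | j ≤ k+1})) ?_ ?_ ?_ ?_ hu
  · rintro _ ⟨j, hj, rfl⟩
    refine Submodule.subset_span ⟨j+1, ?_, ?_⟩
    · simp at hj ⊢; exact hj
    · simp only [Function.iterate_succ_apply']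
  · simp
  · intro x y _ _ hx hy
    rw [map_add]; exact Submodule.add_mem _ hx hy
  · intro a x hx0 hx
    rw [Polynomial.smul_eq_C_mul, De_mul, De_C]
    refine Submodule.add_mem _ ?_ ?_
    · rw [← Polynomial.smul_eq_C_mul]; exact Submodule.smul_mem _ _ hx
    · rw [mul_comm, ← Polynomial.smul_eq_C_mul]; exact Submodule.smul_mem _ _ (hmono hx0)

lemma De_full (hK : ∀ (a : K) (m : ℕ), m ≠ 0 → LD a + m ≠ 0) : ∀ (N : ℕ) (e : Polynomial K), e.natDegree ≤ N → e.coeff N ≠ 0 → ∀ f : Polynomial K,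
    f.natDegree ≤ N → f ∈ Submodule.span K ((fun j => De^[j] e) '' {j | j ≤ N}) := by
  intro N
  induction N with
  | zero =>
    intro e he he0 f hf
    rw [Polynomial.eq_C_of_natDegree_le_zero he, Polynomial.eq_C_of_natDegree_le_zero hf]
    have : Polynomial.C (f.coeff 0) = (f.coeff 0 / e.coeff 0) • Polynomial.C (e.coeff 0) := by
      rw [Polynomial.smul_C, smul_eq_mul, div_mul_cancel₀ _ he0]
    rw [this]
    exact Submodule.smul_mem _ _ (Submodule.subset_span ⟨0, by simp, rfl⟩)
  | succ N ih =>
    intro e he he0 f hf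
    set V := Submodule.span K ((fun j => De^[j] e) '' {j | j ≤ N+1}) with hV
    set q : Polynomial K := (e.coeff (N+1))⁻¹ • e with hq
    have heV : ∀ k, e ∈ Submodule.span K ((fun j => De^[j] e) '' {j | j ≤ k}) := fun k =>
      Submodule.subset_span ⟨0, Nat.zero_le k, rfl⟩
    have hqV : ∀ k, q ∈ Submodule.span K ((fun j => De^[j] e) '' {j | j ≤ k}) := fun k =>
      Submodule.smul_mem _ _ (heV k)
    have hq1 : q.coeff (N+1) = 1 := by rw [hq, Polynomial.coeff_smul, smul_eq_mul, inv_mul_cancel₀ he0]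
    have hqd : q.natDegree ≤ N+1 := (Polynomial.natDegree_smul_le _ _).trans he
    have hq0 : ∀ i, N+1 < i → q.coeff i = 0 := fun i hi =>
      Polynomial.coeff_eq_zero_of_natDegree_lt (by omega)
    have hdq : (De q).natDegree ≤ N := by
      rw [Polynomial.natDegree_le_iff_coeff_eq_zero]
      intro i hi
      rw [De_coeff, hq0 (i+1) (by omega)]
      rcases Nat.lt_or_ge (N+1) i with h | h
      · rw [hq0 i h]; simp
      · rw [show i = N+1 by omega, hq1]; simp [LD_one]
    have hdq0 : (De q).coeff N ≠ 0 := by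
      rw [De_coeff, hq1, one_mul]
      exact_mod_cast hK _ (N+1) (by omega)
    have hstep := ih (De q) hdq hdq0
    have hDq : ∀ j, De^[j] q ∈ Submodule.span K ((fun j => De^[j] e) '' {i | i ≤ j}) := by
      intro j
      induction j with
      | zero => exact hqV 0
      | succ j ihj => rw [Function.iterate_succ_apply']; exact De_span _ _ _ ihj
    have hsub : Submodule.span K ((fun j => De^[j] (De q)) '' {j | j ≤ N}) ≤ V := by
      rw [Submodule.span_le]
      rintro _ ⟨j, hj, rfl⟩
      simp only [← Function.iterate_succ_apply]
      have hj' : j ≤ N := hj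
      exact Submodule.span_mono (Set.image_mono fun i (hi : i ≤ j+1) => show i ≤ N+1 by omega) (hDq (j+1))
    have : f = (f - f.coeff (N+1) • q) + f.coeff (N+1) • q := by ring
    rw [this]
    refine Submodule.add_mem _ (hsub (hstep _ ?_)) (Submodule.smul_mem _ _ (hqV (N+1)))
    rw [Polynomial.natDegree_le_iff_coeff_eq_zero]
    intro i hi
    rw [Polynomial.coeff_sub, Polynomial.coeff_smul]
    rcases Nat.lt_or_ge (N+1) i with h | h
    · rw [hq0 i h, Polynomial.coeff_eq_zero_of_natDegree_lt (by omega)]; simp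
    · rw [show i = N+1 by omega, hq1]; simp

lemma De_indep (hK : ∀ (a : K) (m : ℕ), m ≠ 0 → LD a + m ≠ 0) (N : ℕ) (e : Polynomial K) (he : e.natDegree ≤ N) (he0 : e.coeff N ≠ 0) :
    LinearIndependent K (fun j : Fin (N+1) => De^[(j:ℕ)] e) := by
  rw [linearIndependent_iff_card_le_finrank_span]
  have h1 : Polynomial.degreeLT K (N+1) ≤ Submodule.span K (Set.range fun j : Fin (N+1) => De^[(j:ℕ)] e) := by
    intro f hf
    rw [Polynomial.mem_degreeLT] at hf
    have := De_full hK N e he he0 f (Polynomial.natDegree_le_iff_coeff_eq_zero.2 fun i hi => Polynomial.coeff_eq_zero_of_degree_lt (hf.trans_le (by exact_mod_cast hi)))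
    refine Submodule.span_mono ?_ this
    rintro _ ⟨j, hj, rfl⟩
    have hj' : j ≤ N := hj
    exact ⟨⟨j, by omega⟩, rfl⟩
  have : FiniteDimensional K (Submodule.span K (Set.range fun j : Fin (N+1) => De^[(j:ℕ)] e)) :=
    FiniteDimensional.span_of_finite _ (Set.finite_range _)
  have h2 := Submodule.finrank_mono h1
  rw [LinearEquiv.finrank_eq (Polynomial.degreeLTEquiv K (N+1)), Module.finrank_fin_fun] at h2
  rw [Fintype.card_fin]
  exact h2
end gen

abbrev LL := LaurentSeries ℚ

lemma LL_pwo (f : LL) : (Function.support fun m : ℤ => (m:ℚ) * f.coeff m).IsPWO :=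
  f.isPWO_support.mono fun m hm => by
    simp only [Function.mem_support, HahnSeries.mem_support] at *
    exact fun h => hm (by rw [h, mul_zero])

noncomputable def LDf (f : LL) : LL := ⟨fun m : ℤ => (m:ℚ) * f.coeff m, LL_pwo f⟩

lemma LDf_coeff (f : LL) (m : ℤ) : (LDf f).coeff m = m * f.coeff m := rfl

lemma LDf_supp (f : LL) : (LDf f).support ⊆ f.support := by
  intro m hm
  simp only [HahnSeries.mem_support, LDf_coeff] at *
  exact fun h => hm (by rw [h, mul_zero])

lemma LDf_mul (f g : LL) : LDf (f * g) = f * LDf g + g * LDf f := by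
  ext m
  rw [mul_comm g, HahnSeries.coeff_add, LDf_coeff, HahnSeries.coeff_mul,
    HahnSeries.coeff_mul_right' g.isPWO_support (LDf_supp g),
    HahnSeries.coeff_mul_left' f.isPWO_support (LDf_supp f), mul_sum, ← sum_add_distrib]
  refine sum_congr rfl fun ij hij => ?_
  rw [Finset.mem_antidiagonal] at hij
  rw [← hij.2.2, LDf_coeff, LDf_coeff]
  push_cast; ring


def mkDiff {K : Type*} [Field K] (D : K →+ K) (h : ∀ a b, D (a * b) = a * D b + b * D a) :
    Differential K := ⟨Derivation.mk' D.toIntLinearMap h⟩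

noncomputable instance : Differential LL := mkDiff
    { toFun := LDf
      map_zero' := by ext m; simp [LDf_coeff]
      map_add' := fun f g => by ext m; simp [LDf_coeff, mul_add] } LDf_mul

lemma LD_coeff (f : LL) (m : ℤ) : (LD f).coeff m = m * f.coeff m := rfl

lemma LD_ne (a : LL) (m : ℕ) (hm : m ≠ 0) : LD a + m ≠ 0 := by
  intro h
  have := congrArg (fun f : LL => f.coeff 0) h
  have h2 : ((m:LL)).coeff 0 = (m:ℚ) := by
    rw [show ((m:LL)) = HahnSeries.C (m:ℚ) from (map_natCast HahnSeries.C m).symm]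
    rw [HahnSeries.C_apply, HahnSeries.coeff_single_same]
  simp [LD_coeff, h2] at this
  exact hm this

end Bg

namespace Bg
open Finset
open scoped Nat

lemma fev_map {A B : Type*} [CommRing A] [CommRing B] (f : A →+* B) (N : ℕ) (τ x y : A) (p : ℕ → Polynomial ℤ) :
    f (fev N τ x y p) = fev N (f τ) (f x) (f y) p := by
  unfold fev
  rw [map_sum]
  refine sum_congr rfl fun i _ => ?_
  rw [map_mul, map_mul, map_pow, map_pow, Polynomial.hom_eval₂]
  congr 2
  exact RingHom.ext_int _ _

def wc (ν : ℕ) : ℕ → ℚ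
  | 0 => - ν
  | k + 1 => (k + 1) * (ν - k - 1) * wc ν k

def uc (ν : ℕ) : ℕ → ℚ
  | 0 => 0
  | k + 1 => (- (2 * (k + 1) + ν) * ca (2*ν) (k+1) - uc ν k) / ((k+1)^2 + ν * (k+1))

def xs (ν : ℕ) : ℤ → ℚ
  | Int.ofNat k => uc ν k
  | Int.negSucc k => wc ν k

lemma wc_zero (ν : ℕ) (hν : 1 ≤ ν) (k : ℕ) (hk : ν ≤ k) : wc ν k = 0 := by
  induction k, hk using Nat.le_induction with
  | base =>
    obtain ⟨m, rfl⟩ := Nat.exists_eq_add_of_le' hν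
    simp [wc]
  | succ k hk ih => simp [wc, ih]

noncomputable def chi (ν : ℕ) (hν : 1 ≤ ν) : LL := HahnSeries.ofSuppBddBelow (xs ν) (by
  refine ⟨- (ν : ℤ), fun m hm => ?_⟩
  by_contra h
  push Not at h
  cases m with
  | ofNat k => have : (0:ℤ) ≤ Int.ofNat k := Int.natCast_nonneg k
               omega
  | negSucc k => exact hm (wc_zero ν hν k (by omega)))

lemma chi_coeff (ν : ℕ) (hν : 1 ≤ ν) (m : ℤ) : (chi ν hν).coeff m = xs ν m := rfl

noncomputable abbrev io : PowerSeries ℚ →+* LL := HahnSeries.ofPowerSeries ℤ ℚ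

lemma io_coeff (f : PowerSeries ℚ) (k : ℕ) : (io f).coeff (k:ℤ) = PowerSeries.coeff k f :=
  HahnSeries.ofPowerSeries_apply_coeff f k

lemma io_coeff_neg (f : PowerSeries ℚ) (k : ℕ) : (io f).coeff (Int.negSucc k) = 0 := by
  rw [HahnSeries.ofPowerSeries_apply]
  apply HahnSeries.embDomain_of_notMem_range
  rintro ⟨j, hj⟩
  simp at hj
  

lemma LD_io (f : PowerSeries ℚ) : LD (io f) = io (eu f) := by
  ext m
  rw [LD_coeff]
  cases m with
  | ofNat k =>
    rw [Int.ofNat_eq_natCast, io_coeff, io_coeff, coeff_eu]; simp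
  | negSucc k => rw [io_coeff_neg, io_coeff_neg, mul_zero]

noncomputable def ta : LL := HahnSeries.single 1 1

lemma io_X : io PowerSeries.X = ta := HahnSeries.ofPowerSeries_X

lemma ta_coeff (f : LL) (m : ℤ) : (ta * f).coeff m = f.coeff (m - 1) := by
  have := HahnSeries.coeff_single_mul_add (r := (1:ℚ)) (x := f) (a := m - 1) (b := 1)
  rw [sub_add_cancel, one_mul] at this
  exact this

lemma LLnat_mul_coeff (k : ℕ) (f : LL) (m : ℤ) : ((k:LL) * f).coeff m = k * f.coeff m := by
  have := HahnSeries.coeff_single_zero_mul (r := (k:ℚ)) (x := f) (a := m)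
  exact this

lemma chi_eq (ν : ℕ) (hν : 1 ≤ ν) : LD (LD (chi ν hν)) + (ν:LL) * LD (chi ν hν) + ta * chi ν hν
    = - ((2:ℕ) * io (Ps (2*ν)) + (ν:LL) * io (Ph (2*ν))) := by
  ext m
  simp only [HahnSeries.coeff_add, HahnSeries.coeff_neg, LLnat_mul_coeff, ta_coeff, LD_coeff, chi_coeff]
  cases m with
  | ofNat k =>
    rw [Int.ofNat_eq_natCast, io_coeff, io_coeff, Ps, coeff_eu, Ph, PowerSeries.coeff_mk]
    cases k with
    | zero => 
      simp only [show ((0:ℕ):ℤ) = Int.ofNat 0 from rfl, show Int.ofNat 0 - 1 = Int.negSucc 0 from rfl, xs, uc, wc, ca]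
      simp
    | succ k =>
      rw [show ((k+1:ℕ):ℤ) - 1 = Int.ofNat k by simp]
      simp only [show ((k+1:ℕ):ℤ) = Int.ofNat (k+1) from rfl, xs, uc]
      have : ((k:ℚ)+1)^2 + ν * (k+1) ≠ 0 := by positivity
      simp
      field_simp
      ring
  | negSucc k =>
    rw [io_coeff_neg, io_coeff_neg]
    rw [show Int.negSucc k - 1 = Int.negSucc (k+1) from rfl]
    simp only [xs, wc, Int.cast_negSucc]
    push_cast
    ring

noncomputable def xx (ν : ℕ) (hν : 1 ≤ ν) : Polynomial LL :=
  Polynomial.C (io (Ph (2*ν))) * Polynomial.X + Polynomial.C (chi ν hν)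
noncomputable def yy (ν : ℕ) (hν : 1 ≤ ν) : Polynomial LL :=
  Polynomial.C (io (Ps (2*ν))) * Polynomial.X + Polynomial.C (io (Ph (2*ν)) + LD (chi ν hν))

lemma De_xx (ν : ℕ) (hν : 1 ≤ ν) : De (xx ν hν) = yy ν hν := by
  unfold xx yy
  rw [map_add, De_mul, De_C, De_C, De_X, LD_io, ← Ps, map_add]
  ring

lemma De_yy (ν : ℕ) (hν : 1 ≤ ν) : 2 * De (yy ν hν) =
    - 2 * (Polynomial.C ta * xx ν hν) - (2*ν:ℕ) * yy ν hν := by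
  have h1 := chi_eq ν hν
  have h2 := congrArg io (Ps_ode (2*ν))
  rw [map_nsmul, map_sub, map_nsmul, map_zsmul, map_mul, io_X] at h2
  simp only [nsmul_eq_mul, zsmul_eq_mul] at h2
  have h1 := congrArg (fun a => Polynomial.C a) h1
  have h2 := congrArg (fun a => Polynomial.C a) h2
  simp only [map_add, map_sub, map_neg, map_mul, map_natCast, map_intCast] at h1 h2
  unfold xx yy
  rw [map_add, De_mul, De_C, De_C, De_X, map_add LD, LD_io, LD_io, ← Ps]
  simp only [map_add]
  push_cast at h1 h2 ⊢
  linear_combination 2 * h1 + Polynomial.X * h2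

lemma fev_iter {A : Type*} [CommRing A] (N n : ℕ) (δ' : A →+ A) (hδ : ∀ a b, δ' (a * b) = a * δ' b + b * δ' a)
    (τ x y : A) (hτ : δ' τ = τ) (hx : δ' x = y)
    (hy : 2 * δ' y = - 2 * (τ * x) - n * y) (p : ℕ → Polynomial ℤ) (k : ℕ) :
    fev N τ x y ((Dt N n)^[k] p) = 2 ^ k * δ'^[k] (fev N τ x y p) := by
  induction k with
  | zero => simp
  | succ k ih =>
    rw [Function.iterate_succ_apply', fev_Dt N n δ' hδ τ x y hτ hx hy, ih, Function.iterate_succ_apply',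
      pow_succ', mul_assoc]
    congr 1
    have : (2:A)^k * δ'^[k] (fev N τ x y p) = (2^k : ℕ) • δ'^[k] (fev N τ x y p) := by
      rw [nsmul_eq_mul]; push_cast; rfl
    rw [this, map_nsmul, nsmul_eq_mul]; push_cast; rfl

lemma top_coeff {K : Type*} [CommRing K] (N : ℕ) (a b c d τ : K) (p : ℕ → Polynomial ℤ) :
    (fev N (Polynomial.C τ) (Polynomial.C a * Polynomial.X + Polynomial.C b) (Polynomial.C c * Polynomial.X + Polynomial.C d) p).natDegree ≤ N ∧
    (fev N (Polynomial.C τ) (Polynomial.C a * Polynomial.X + Polynomial.C b) (Polynomial.C c * Polynomial.X + Polynomial.C d) p).coeff N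
      = fev N τ a c p := by
  have hlin : ∀ a b : K, (Polynomial.C a * Polynomial.X + Polynomial.C b).natDegree ≤ 1 := fun a b =>
    Polynomial.natDegree_linear_le
  have hpow : ∀ (a b : K) (i : ℕ), ((Polynomial.C a * Polynomial.X + Polynomial.C b)^i).natDegree ≤ i := fun a b i => by
    have := Polynomial.natDegree_pow_le_of_le i (hlin a b); simpa using this
  have hev : ∀ q : Polynomial ℤ, q.eval₂ (Int.castRingHom (Polynomial K)) (Polynomial.C τ) = Polynomial.C (q.eval₂ (Int.castRingHom K) τ) := by
    intro q
    rw [Polynomial.hom_eval₂]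
    congr 1
  have hc : ∀ (a b : K) (i : ℕ), ((Polynomial.C a * Polynomial.X + Polynomial.C b)^i).coeff i = a^i := fun a b i => by
    have := Polynomial.coeff_pow_of_natDegree_le (m := i) (hlin a b)
    rw [mul_one] at this
    rw [this]; simp
  unfold fev
  constructor
  · refine Polynomial.natDegree_sum_le_of_forall_le _ _ fun i hi => ?_
    have hi := mem_range.1 hi
    rw [hev]
    refine (Polynomial.natDegree_C_mul_le _ _).trans ?_
    have := Polynomial.natDegree_mul_le_of_le (hpow a b i) (hpow c d (N-i))
    rwa [show i + (N - i) = N by omega] at this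
  · rw [Polynomial.finsetSum_coeff]
    refine sum_congr rfl fun i hi => ?_
    have hi := mem_range.1 hi
    rw [hev, Polynomial.coeff_C_mul]
    congr 1
    have := Polynomial.coeff_mul_add_eq_of_natDegree_le (hpow a b i) (hpow c d (N-i))
    rw [show i + (N - i) = N by omega] at this
    rw [this, hc, hc]

lemma io_inj : Function.Injective io := HahnSeries.ofPowerSeries_injective

lemma ev_ta_inj (q : Polynomial ℤ) (h : q.eval₂ (Int.castRingHom LL) ta = 0) : q = 0 := by
  have h1 : io (q.eval₂ (Int.castRingHom _) PowerSeries.X) = 0 := by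
    rw [Polynomial.hom_eval₂, io_X, ← h]
    congr 1
    exact RingHom.ext_int _ _
  rw [map_eq_zero_iff _ io_inj, aeval_X_eq, Polynomial.coe_eq_zero_iff] at h1
  exact (Polynomial.map_eq_zero_iff (RingHom.injective_int _)).1 h1

lemma fev_smul_sum {A : Type*} [CommRing A] (N : ℕ) (τ x y : A) {m : ℕ} (c : Fin m → Polynomial ℤ)
    (p : Fin m → ℕ → Polynomial ℤ) :
    fev N τ x y (fun i => ∑ k, c k * p k i) = ∑ k, (c k).eval₂ (Int.castRingHom A) τ * fev N τ x y (p k) := by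
  unfold fev
  simp only [mul_sum]
  rw [sum_comm]
  refine sum_congr rfl fun i _ => ?_
  rw [Polynomial.eval₂_finsetSum, sum_mul]
  refine sum_congr rfl fun k _ => ?_
  rw [Polynomial.eval₂_mul]; ring

noncomputable def DM (N n : ℕ) (p : ℕ → Polynomial ℤ) : Matrix (Fin (N+1)) (Fin (N+1)) (Polynomial ℤ) :=
  Matrix.of fun k i => (Dt N n)^[(k:ℕ)] p i

lemma det_ne_even (N ν : ℕ) (hν : 1 ≤ ν) (p : ℕ → Polynomial ℤ) (hp : ∃ i ≤ N, p i ≠ 0) :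
    (DM N (2*ν) p).det ≠ 0 := by
  intro hdet
  obtain ⟨c, hc0, hc⟩ := Matrix.exists_vecMul_eq_zero_iff.2 hdet
  apply hc0
  set H := fev N (Polynomial.C ta) (xx ν hν) (yy ν hν) p with hH
  have htop := top_coeff N (io (Ph (2*ν))) (chi ν hν) (io (Ps (2*ν))) (io (Ph (2*ν)) + LD (chi ν hν)) ta p
  have hR := Rs_ne_zero N (2*ν) p hp
  have hind := De_indep LD_ne N H htop.1 (by
    rw [hH]; unfold xx yy; rw [htop.2, ← io_X, ← fev_map]
    exact (map_ne_zero_iff _ io_inj).2 hR)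
  have hta : LD ta = ta := by rw [← io_X, LD_io, eu_X]
  have hit : ∀ k, fev N (Polynomial.C ta) (xx ν hν) (yy ν hν) ((Dt N (2*ν))^[k] p) = 2^k * De^[k] H := by
    intro k
    refine fev_iter N (2*ν) De De_mul _ _ _ ?_ (De_xx ν hν) (De_yy ν hν) p k
    rw [De_C, hta]
  have hsum := fev_smul_sum N (Polynomial.C ta) (xx ν hν) (yy ν hν) c (fun k => (Dt N (2*ν))^[(k:ℕ)] p)
  have hz : fev N (Polynomial.C ta) (xx ν hν) (yy ν hν) (fun i => ∑ k, c k * (Dt N (2*ν))^[(k:ℕ)] p i) = 0 := by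
    unfold fev
    refine sum_eq_zero fun i hi => ?_
    have hi := mem_range.1 hi
    have := congrFun hc ⟨i, hi⟩
    simp only [Matrix.vecMul, dotProduct, DM, Matrix.of_apply, Pi.zero_apply] at this
    beta_reduce
    rw [this, Polynomial.eval₂_zero, zero_mul]
  rw [hz] at hsum
  have hev : ∀ q : Polynomial ℤ, q.eval₂ (Int.castRingHom (Polynomial LL)) (Polynomial.C ta) = Polynomial.C (q.eval₂ (Int.castRingHom LL) ta) := by
    intro q
    rw [Polynomial.hom_eval₂]
    congr 1
  rw [Fintype.linearIndependent_iff] at hind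
  have := hind (fun k => (c k).eval₂ (Int.castRingHom LL) ta * 2^(k:ℕ)) (by
    rw [hsum]
    refine sum_congr rfl fun k _ => ?_
    rw [hit, hev, Polynomial.smul_eq_C_mul]
    simp only [map_mul, map_pow, map_ofNat]
    ring)
  funext k
  have h3 := this k
  exact ev_ta_inj _ ((mul_eq_zero.1 h3).resolve_right (pow_ne_zero _ (by
    rw [← map_ofNat io 2]
    exact (map_ne_zero_iff _ io_inj).2 (fun h => by
      have := congrArg PowerSeries.constantCoeff h
      rw [map_ofNat, map_zero] at this
      norm_num at this))))
end Bg

namespace Bg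
open Finset
open scoped Nat

/-- zero estimate -/
def ZE (n : ℕ) : Prop := ∀ (N : ℕ) (α : ℝ), 0 < α → phi n α = 0 → ∃ c : ℕ, ∀ L, 1 ≤ L → ∀ p : ℕ → Polynomial ℤ,
  (∃ i ≤ N, p i ≠ 0) → (∀ i, (p i).natDegree ≤ L) →
  (∀ m < N * L, PowerSeries.coeff m (Rs N n p) = 0) →
  ∃ k ≤ 2 * L + c, ev (eu^[k] (Rs N n p)) α ≠ 0

lemma Dt_deg (N n : ℕ) (p : ℕ → Polynomial ℤ) (L : ℕ) (h : ∀ i, (p i).natDegree ≤ L) (i : ℕ) :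
    (Dt N n p i).natDegree ≤ L + 1 := by
  have h2X : (2 * Polynomial.X : Polynomial ℤ).natDegree ≤ 1 := by
    compute_degree
  unfold Dt
  have hsub : ∀ q r : Polynomial ℤ, q.natDegree ≤ L + 1 → r.natDegree ≤ L + 1 → (q - r).natDegree ≤ L + 1 :=
    fun q r hq hr => (Polynomial.natDegree_sub_le_of_le hq hr).trans (by simp)
  have hadd : ∀ q r : Polynomial ℤ, q.natDegree ≤ L + 1 → r.natDegree ≤ L + 1 → (q + r).natDegree ≤ L + 1 :=
    fun q r hq hr => (Polynomial.natDegree_add_le_of_le hq hr).trans (by simp)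
  refine hsub _ _ (hadd _ _ (hsub _ _ ?_ ?_) ?_) ?_
  · have := Polynomial.natDegree_mul_le_of_le h2X ((Polynomial.natDegree_derivative_le (p i)).trans (Nat.sub_le_sub_right (h i) 1))
    omega
  · have : (((N - i : ℕ) : Polynomial ℤ) * (n : Polynomial ℤ)).natDegree ≤ 0 := by
      rw [← Nat.cast_mul]; exact (Polynomial.natDegree_natCast _).le
    have := Polynomial.natDegree_mul_le_of_le this (h i)
    omega
  · split_ifs with hi
    · have h0 : (2 * ((i : Polynomial ℤ) + 1)).natDegree ≤ 0 := by
        have : (2 * ((i : Polynomial ℤ) + 1)) = ((2 * (i+1) : ℕ) : Polynomial ℤ) := by push_cast; ring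
        rw [this]; exact (Polynomial.natDegree_natCast _).le
      have := Polynomial.natDegree_mul_le_of_le h0 (h (i+1))
      omega
    · simp
  · have : ∀ q : Polynomial ℤ, q.natDegree ≤ L → (2 * Polynomial.X * q).natDegree ≤ L + 1 := fun q hq => by
      have := Polynomial.natDegree_mul_le_of_le h2X hq
      omega
    apply this
    cases i with
    | zero => simp
    | succ j =>
      have := Polynomial.natDegree_mul_le_of_le (Polynomial.natDegree_natCast (R := ℤ) (N-j)).le (h j)
      simpa using this

lemma Dt_iter_deg (N n : ℕ) (p : ℕ → Polynomial ℤ) (L : ℕ) (h : ∀ i, (p i).natDegree ≤ L) (k i : ℕ) :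
    ((Dt N n)^[k] p i).natDegree ≤ L + k := by
  induction k generalizing i with
  | zero => exact h i
  | succ k ih => rw [Function.iterate_succ_apply']; exact Dt_deg N n _ (L+k) ih i

lemma det_deg {A : Type*} [CommRing A] {m : ℕ} (M : Matrix (Fin m) (Fin m) (Polynomial A)) (D : ℕ)
    (h : ∀ i j, (M i j).natDegree ≤ D) : M.det.natDegree ≤ m * D := by
  rw [Matrix.det_apply]
  refine Polynomial.natDegree_sum_le_of_forall_le _ _ fun σ _ => ?_
  refine (Polynomial.natDegree_smul_le _ _).trans ?_
  refine (Polynomial.natDegree_prod_le _ _).trans ?_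
  refine (sum_le_sum fun i _ => h _ _).trans ?_
  simp

lemma eu_iter_coeff (f : PowerSeries ℚ) (k m : ℕ) (h : PowerSeries.coeff m f = 0) :
    PowerSeries.coeff m (eu^[k] f) = 0 := by
  induction k with
  | zero => exact h
  | succ k ih => rw [Function.iterate_succ_apply', coeff_eu, ih, mul_zero]

lemma ZE_even (ν : ℕ) (hν : 1 ≤ ν) : ZE (2*ν) := by
  intro N α hα hφ
  refine ⟨N + N * (N+1), fun L hL p hp hdeg hco => ?_⟩
  by_contra hcon
  push Not at hcon
  set n := 2*ν with hn
  set K := 2*L + (N + N*(N+1)) + 1 with hK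
  set R := Rs N n p with hR
  have hRE : Ent R := (Rs_ent N n p).1
  set M : Matrix (Fin (N+1)) (Fin (N+1)) (Polynomial ℝ) := (DM N n p).map (Polynomial.mapRingHom (Int.castRingHom ℝ)) with hM
  have hdet : M.det ≠ 0 := by
    have : M.det = Polynomial.mapRingHom (Int.castRingHom ℝ) (DM N n p).det := by
      rw [RingHom.map_det]; rfl
    rw [this]
    exact (map_ne_zero_iff _ (Polynomial.map_injective _ (RingHom.injective_int _))).2 (det_ne_even N ν hν p hp)
  have hdd : M.det.natDegree ≤ (N+1) * (L + N) := by
    refine det_deg M _ fun k i => ?_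
    refine (Polynomial.natDegree_map_le).trans ?_
    refine (Dt_iter_deg N n p L hdeg k i).trans ?_
    have := k.2
    omega
  set y : Fin (N+1) → ℝ → ℝ := fun i z => phi n z ^ (i:ℕ) * psi n z ^ (N - (i:ℕ)) with hy
  have hya : ∀ i β, AnalyticAt ℝ (y i) β := fun i β =>
    ((ev_analytic (Ph_ent n) β).pow _).mul ((ev_analytic (Ps_ent n) β).pow _)
  have hF : ∀ k : Fin (N+1), (fun z => ∑ j, (M k j).eval z * y j z) = fun z => 2^(k:ℕ) * ev (eu^[(k:ℕ)] R) z := by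
    intro k
    funext z
    rw [← ev_two_pow (ent_eu_iter hRE _), hR, ← Rs_iter, (Rs_ent N n _).2, fev, Finset.sum_range]
    refine sum_congr rfl fun j _ => ?_
    simp only [hM, hy, DM, Matrix.map_apply, Matrix.of_apply, Polynomial.coe_mapRingHom, Polynomial.eval_map]
    rfl
  have hord : ∀ (k : Fin (N+1)) (β : ℝ) (m : ℕ), (m : ℕ∞) ≤ analyticOrderAt (ev (eu^[(k:ℕ)] R)) β →
      (m : ℕ∞) ≤ analyticOrderAt (fun z => ∑ j, (M k j).eval z * y j z) β := by
    intro k β m h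
    rw [hF]
    exact vo_mul_right (f := fun _ => (2:ℝ)^(k:ℕ)) analyticAt_const (ev_analytic (ent_eu_iter hRE _) β) h
  have h0 := vo_det M y 0 (N*L) (fun j => hya j 0) (Fin.last N) (by simp [hy, phi_zero]) (fun k => hord k 0 _
    (vo_zero (ent_eu_iter hRE _) _ fun m hm => eu_iter_coeff _ _ _ (hco m hm)))
  have hKo : (K : ℕ∞) ≤ analyticOrderAt (ev R) α := vo_of_eu hRE hα.ne' K fun k hk => hcon k (by omega)
  have h1 := vo_det M y α (K - N) (fun j => hya j α) 0 (by simp [hy, psi_ne_zero n α hα.ne' hφ]) (fun k => hord k α _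
    (vo_eu_iter hRE hα.ne' _ _ (le_trans (by have := k.2; exact_mod_cast (by omega)) hKo)))
  have h2 := two_points hdet hα.ne h0 h1
  have h3 := h2.trans hdd
  have h4 : (N+1)*(L+N) = N*L + L + N*(N+1) := by ring
  omega
end Bg

namespace Bg
open Finset Filter Topology
open scoped Nat

lemma ent_fac {f g : PowerSeries ℚ} (hf : Ent f) (m : ℕ) (hg : f = PowerSeries.X ^ m * g) :
    Ent g ∧ ∀ z, ev f z = z ^ m * ev g z := by
  have hgE : Ent g := by
    intro r hr
    have h1 := hf (r+1) (by positivity)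
    have h2 := (summable_nat_add_iff m).2 h1
    refine Summable.of_nonneg_of_le (fun k => by positivity) (fun k => ?_) h2
    rw [hg, mul_comm (PowerSeries.X ^ m) g, PowerSeries.coeff_mul_X_pow]
    gcongr
    calc r^k ≤ (r+1)^k := by gcongr; linarith
      _ ≤ (r+1)^(k+m) := pow_le_pow_right₀ (by linarith) (by omega)
  refine ⟨hgE, fun z => ?_⟩
  have := ev_poly (Polynomial.X ^ m) z
  have hX : Ent ((PowerSeries.X : PowerSeries ℚ)^m) := by simpa using Ent.poly (Polynomial.X^m)
  rw [hg, ev_mul hX hgE]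
  simp at this
  simp [this]

lemma ev_at_zero (f : PowerSeries ℚ) : ev f 0 = PowerSeries.coeff 0 f := by
  unfold ev
  rw [tsum_eq_single 0]
  · simp
  · intro k hk; simp [hk]

lemma ent_ne {f : PowerSeries ℚ} (hf : Ent f) (h0 : f ≠ 0) : ∃ t > 0, ev f t ≠ 0 := by
  obtain ⟨m, hm, hmin⟩ : ∃ m, PowerSeries.coeff m f ≠ 0 ∧ ∀ k < m, PowerSeries.coeff k f = 0 := by
    classical
    have : ∃ m, PowerSeries.coeff m f ≠ 0 := by
      by_contra h; push Not at h; exact h0 (PowerSeries.ext h)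
    exact ⟨Nat.find this, Nat.find_spec this, fun k hk => not_not.1 (Nat.find_min this hk)⟩
  obtain ⟨g, hg⟩ := PowerSeries.X_pow_dvd_iff.2 hmin
  obtain ⟨hgE, hfg⟩ := ent_fac hf m hg
  have hg0 : ev g 0 ≠ 0 := by
    rw [ev_at_zero]
    have : PowerSeries.coeff m f = PowerSeries.coeff 0 g := by
      rw [hg]
      have := PowerSeries.coeff_X_pow_mul g m 0
      simpa using this
    rw [← this]; exact_mod_cast hm
  have hc : ContinuousAt (ev g) 0 := (ev_analytic hgE 0).continuousAt
  have h1 : ∀ᶠ t in 𝓝 (0:ℝ), ev g t ≠ 0 := hc.eventually_ne hg0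
  have h2 : ∀ᶠ t in 𝓝[>] (0:ℝ), ev g t ≠ 0 := h1.filter_mono nhdsWithin_le_nhds
  obtain ⟨t, ht, ht0⟩ := (h2.and self_mem_nhdsWithin).exists
  have ht0' : (0:ℝ) < t := ht0
  exact ⟨t, ht0', by rw [hfg]; exact mul_ne_zero (by positivity) ht⟩

lemma vo_cplx {G : ℂ → ℂ} {x0 : ℝ} (hG : AnalyticAt ℂ G x0) (m : ℕ) (C : ℝ)
    (h : ∀ᶠ x : ℝ in 𝓝 x0, ‖G x‖ ≤ C * |x - x0| ^ m) : (m : ℕ∞) ≤ analyticOrderAt G x0 := by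
  by_contra hlt
  push Not at hlt
  obtain ⟨d, hd⟩ := ENat.ne_top_iff_exists.1 (ne_top_of_lt hlt)
  rw [← hd] at hlt
  have hdm : d < m := by exact_mod_cast hlt
  obtain ⟨g, hg, hg0, hGg⟩ := (hG.analyticOrderAt_eq_natCast).1 hd.symm
  have hofr : Tendsto (fun x : ℝ => (x:ℂ)) (𝓝[≠] x0) (𝓝 (x0:ℂ)) :=
    (Complex.continuous_ofReal.tendsto x0).mono_left nhdsWithin_le_nhds
  have hlim : Tendsto (fun x : ℝ => ‖g x‖) (𝓝[≠] x0) (𝓝 ‖g x0‖) :=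
    (hg.continuousAt.tendsto.comp hofr).norm
  have hlim2 : Tendsto (fun x : ℝ => C * |x - x0|^(m-d)) (𝓝[≠] x0) (𝓝 0) := by
    have : ContinuousAt (fun x : ℝ => C * |x - x0|^(m-d)) x0 := by fun_prop
    have := this.tendsto.mono_left (nhdsWithin_le_nhds (s := {x0}ᶜ))
    simpa [show m - d ≠ 0 by omega] using this
  have hle : ∀ᶠ x : ℝ in 𝓝[≠] x0, ‖g x‖ ≤ C * |x - x0|^(m-d) := by
    filter_upwards [h.filter_mono nhdsWithin_le_nhds, hofr.eventually hGg, self_mem_nhdsWithin] with x h1 h2 h3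
    have hx : 0 < |x - x0| := abs_pos.2 (sub_ne_zero.2 h3)
    rw [h2, smul_eq_mul, norm_mul, norm_pow, ← Complex.ofReal_sub, Complex.norm_real, Real.norm_eq_abs] at h1
    have : |x - x0|^m = |x-x0|^d * |x-x0|^(m-d) := by rw [← pow_add]; congr 1; omega
    rw [this] at h1
    have hp : 0 < |x-x0|^d := by positivity
    nlinarith
  have := le_of_tendsto_of_tendsto hlim hlim2 hle
  exact hg0 (norm_le_zero_iff.1 this)

lemma ord_bound {f : ℝ → ℝ} {t0 : ℝ} (hf : AnalyticAt ℝ f t0) (m : ℕ) (h : (m : ℕ∞) ≤ analyticOrderAt f t0) :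
    ∃ C ≥ 0, ∀ᶠ t in 𝓝 t0, |f t| ≤ C * |t - t0|^m := by
  obtain ⟨g, hg, hfg⟩ := (natCast_le_analyticOrderAt hf).1 h
  refine ⟨|g t0| + 1, by positivity, ?_⟩
  have hc : ∀ᶠ t in 𝓝 t0, |g t| < |g t0| + 1 := hg.continuousAt.abs.eventually_lt continuousAt_const (by simp)
  filter_upwards [hc, hfg] with t h1 h2
  rw [h2, smul_eq_mul, abs_mul, abs_pow, mul_comm]
  gcongr

open Polynomial in
noncomputable def Tl (l : ℂ) (q : ℂ[X]) : ℂ[X] := derivative q + C l * q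

open Polynomial in
lemma Tl_iter (l : ℂ) (q : ℂ[X]) (d : ℕ) (hq : q.natDegree ≤ d) (k : ℕ) :
    ((Tl l)^[k] q).natDegree ≤ d ∧ ((Tl l)^[k] q).coeff d = l^k * q.coeff d := by
  induction k with
  | zero => simpa using hq
  | succ k ih =>
    rw [Function.iterate_succ_apply', Tl]
    constructor
    · refine (natDegree_add_le_of_le ((natDegree_derivative_le _).trans (Nat.sub_le_sub_right ih.1 1)) ((natDegree_C_mul_le _ _).trans ih.1)).trans ?_
      omega
    · rw [coeff_add, coeff_derivative, coeff_C_mul, ih.2, coeff_eq_zero_of_natDegree_lt (by omega), pow_succ]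
      ring

open Polynomial in
lemma coeff_prod_le {ι : Type*} (s : Finset ι) (f : ι → ℂ[X]) (d : ι → ℕ) (h : ∀ i ∈ s, (f i).natDegree ≤ d i) :
    (∏ i ∈ s, f i).natDegree ≤ ∑ i ∈ s, d i ∧ (∏ i ∈ s, f i).coeff (∑ i ∈ s, d i) = ∏ i ∈ s, (f i).coeff (d i) := by
  classical
  induction s using Finset.induction_on with
  | empty => simp
  | insert a s ha ih =>
    rw [prod_insert ha, sum_insert ha, prod_insert ha]
    have ih := ih fun i hi => h i (mem_insert_of_mem hi)
    have ha' := h a (mem_insert_self a s)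
    exact ⟨natDegree_mul_le_of_le ha' ih.1, by rw [coeff_mul_add_eq_of_natDegree_le ha' ih.1, ih.2]⟩

open Polynomial in
lemma det_ne_odd {r : ℕ} (Q : Fin r → ℂ[X]) (l : Fin r → ℂ) (hl : Function.Injective l) (hQ : ∀ j, Q j ≠ 0) :
    (Matrix.of fun k j : Fin r => (Tl (l j))^[(k:ℕ)] (Q j)).det ≠ 0 := by
  intro h
  have h1 := congrArg (fun q => q.coeff (∑ j, (Q j).natDegree)) h
  simp only [coeff_zero] at h1
  rw [Matrix.det_apply, finsetSum_coeff] at h1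
  have h2 : (Matrix.of fun k j : Fin r => l j ^ (k:ℕ) * (Q j).leadingCoeff).det = 0 := by
    rw [Matrix.det_apply, ← h1]
    refine sum_congr rfl fun σ _ => ?_
    simp only [Matrix.of_apply]
    rw [Units.smul_def, Units.smul_def, coeff_smul,
     (coeff_prod_le univ _ _ fun i _ => (Tl_iter (l i) (Q i) _ le_rfl (σ i)).1).2]
    congr 1
    refine prod_congr rfl fun i _ => ?_
    rw [(Tl_iter (l i) (Q i) _ le_rfl (σ i)).2]; rfl
  have h3 : (Matrix.of fun k j : Fin r => l j ^ (k:ℕ) * (Q j).leadingCoeff)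
      = (Matrix.vandermonde l).transpose * Matrix.diagonal fun j => (Q j).leadingCoeff := by
    ext k j
    rw [Matrix.mul_diagonal]; rfl
  rw [h3, Matrix.det_mul, Matrix.det_transpose, Matrix.det_diagonal] at h2
  rcases mul_eq_zero.1 h2 with h | h
  · exact Matrix.det_vandermonde_ne_zero_iff.2 hl h
  · obtain ⟨j, _, hj⟩ := prod_eq_zero_iff.1 h
    exact hQ j (leadingCoeff_eq_zero.1 hj)

open Polynomial in
lemma Tl_deriv {r : ℕ} (Q : Fin r → ℂ[X]) (l : Fin r → ℂ) (k : ℕ) :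
    deriv^[k] (fun z => ∑ j, (Q j).eval z * Complex.exp (l j * z)) =
      fun z => ∑ j, ((Tl (l j))^[k] (Q j)).eval z * Complex.exp (l j * z) := by
  induction k with
  | zero => rfl
  | succ k ih =>
    rw [Function.iterate_succ_apply', ih]
    funext z
    have : HasDerivAt (fun z => ∑ j, ((Tl (l j))^[k] (Q j)).eval z * Complex.exp (l j * z))
       (∑ j, ((Tl (l j))^[k+1] (Q j)).eval z * Complex.exp (l j * z)) z := by
      refine HasDerivAt.fun_sum fun j _ => ?_
      have h1 := (((Tl (l j))^[k] (Q j)).hasDerivAt z).mul (((hasDerivAt_id z).const_mul (l j)).cexp)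
      refine h1.congr_deriv ?_
      rw [Function.iterate_succ_apply', Tl, eval_add, eval_mul, eval_C]
      simp only [id]
      ring
    exact this.deriv

open Polynomial in
lemma exp_zero_est {r D : ℕ} (Q : Fin r → ℂ[X]) (l : Fin r → ℂ) (hl : Function.Injective l) (hQ : ∀ j, Q j ≠ 0)
    (hr : 0 < r) (hD : ∀ j, (Q j).natDegree ≤ D) (x0 : ℂ) (hx0 : x0 ≠ 0) (a b : ℕ)
    (h0 : (a : ℕ∞) ≤ analyticOrderAt (fun z => ∑ j, (Q j).eval z * Complex.exp (l j * z)) 0)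
    (h1 : (b : ℕ∞) ≤ analyticOrderAt (fun z => ∑ j, (Q j).eval z * Complex.exp (l j * z)) x0) :
    (a - r) + (b - r) ≤ r * D := by
  set M := (Matrix.of fun k j : Fin r => (Tl (l j))^[(k:ℕ)] (Q j)) with hM
  have hdet := det_ne_odd Q l hl hQ
  have hdeg : M.det.natDegree ≤ r * D := det_deg M D fun k j => (Tl_iter (l j) (Q j) D (hD j) k).1
  have hya : ∀ j β, AnalyticAt ℂ (fun z => Complex.exp (l j * z)) β := fun j β => by fun_prop
  have hGa : ∀ β, AnalyticAt ℂ (fun z => ∑ j, (Q j).eval z * Complex.exp (l j * z)) β := fun β =>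
    Finset.analyticAt_fun_sum _ fun j _ => (analyticAt_poly _ _).mul (hya j β)
  have key : ∀ (β : ℂ) (m : ℕ), (m : ℕ∞) ≤ analyticOrderAt (fun z => ∑ j, (Q j).eval z * Complex.exp (l j * z)) β →
      (X - C β)^(m - r) ∣ M.det := by
    intro β m hm
    rcases Nat.lt_or_ge m r with hmr | hmr
    · rw [Nat.sub_eq_zero_of_le hmr.le]; simp
    refine vo_det M (fun j z => Complex.exp (l j * z)) β _ (fun j => hya j β) ⟨0, hr⟩ (Complex.exp_ne_zero _) fun k => ?_
    have := vo_iter_deriv (m := m - r) k (hGa β) (le_trans (by have := k.2; exact_mod_cast (by omega)) hm)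
    rw [Tl_deriv] at this
    exact this
  exact (two_points hdet hx0.symm (key 0 a h0) (key x0 b h1)).trans hdeg
end Bg

namespace Bg
open Finset Filter Topology
open scoped Nat

/-- exponential representation of a real function at nonzero points -/
def ER (f : ℝ → ℝ) (a : ℕ) : Prop := ∃ A B : Polynomial ℂ, ∀ x : ℝ, x ≠ 0 →
  (x:ℂ)^a * (f x : ℂ) = A.eval (x:ℂ) * Complex.exp (Complex.I * x) + B.eval (x:ℂ) * Complex.exp (-(Complex.I * x))

lemma phi_one (x : ℝ) : x * phi 1 (x^2/4) = Real.sin x := by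
  have hca : ∀ k, ((ca 1 k : ℚ) : ℝ) = (-1)^k * 4^k / ((2*k+1)! : ℝ) := by
    intro k
    induction k with
    | zero => simp [ca]
    | succ k ih =>
      have hf : ((2*(k+1)+1)! : ℝ) = (2*k+3)*((2*k+2)*((2*k+1)! : ℝ)) := by
        rw [show 2*(k+1)+1 = (2*k+1)+1+1 by ring, Nat.factorial_succ (2*k+1+1), Nat.factorial_succ (2*k+1)]
        push_cast; ring
      rw [hf, ca.eq_2]
      push_cast
      rw [ih]
      have : ((2*k+1)! : ℝ) ≠ 0 := by positivity
      generalize ((2*k+1)! : ℝ) = w at *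
      field_simp
      ring
  rw [phi, ev, ← tsum_mul_left]
  rw [← (Real.hasSum_sin x).tsum_eq]
  congr 1; ext k
  rw [Ph, PowerSeries.coeff_mk, hca, div_pow]
  field_simp
  ring

lemma psi_next (n : ℕ) (t : ℝ) : t * phi (n+2) t = - ((n:ℝ)/2 + 1) * psi n t := by
  have hca : ∀ k, (k+1) * ca n (k+1) * ((n:ℚ)+2) = - 2 * ca (n+2) k := by
    intro k
    induction k with
    | zero => 
      simp [ca]; field_simp
    | succ k ih =>
      rw [ca.eq_2 n (k+1), ca.eq_2 (n+2) k]
      have e : ca n (k+1) = - 2 * ca (n+2) k / ((k+1) * (n+2)) := by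
        field_simp; linear_combination ih
      rw [e]
      push_cast
      have h2 : (n:ℚ) + 2 * (k+1) + 2 ≠ 0 := by positivity
      have h3 : (n:ℚ) + 2 + 2 * k + 2 ≠ 0 := by positivity
      field_simp
      ring
  have hs : Summable fun k => ((PowerSeries.coeff k (Ps n) : ℚ) : ℝ) * t ^ k := (Ps_ent n).norm t |>.of_norm
  have hn : (n:ℝ) + 2 ≠ 0 := by positivity
  have h1 : psi n t = ∑' k, t * (-2 / ((n:ℝ)+2)) * (((PowerSeries.coeff k (Ph (n+2)) : ℚ) : ℝ) * t ^ k) := by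
    rw [psi, ev, hs.tsum_eq_zero_add]
    have h0 : ((PowerSeries.coeff 0 (Ps n) : ℚ) : ℝ) = 0 := by
      rw [Ps, coeff_eu]; simp
    rw [h0, zero_mul, zero_add]
    congr 1; ext k
    rw [Ps, coeff_eu, Ph, PowerSeries.coeff_mk, Ph, PowerSeries.coeff_mk]
    have := congrArg (fun q : ℚ => (q : ℝ)) (hca k)
    push_cast at this ⊢
    rw [pow_succ]
    field_simp
    linear_combination t * t^k * this
  rw [tsum_mul_left] at h1
  rw [h1, phi, ev]
  field_simp

lemma ER_psi (n a : ℕ) (h : ER (fun x => phi n (x^2/4)) a) : ER (fun x => psi n (x^2/4)) a := by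
  obtain ⟨A, B, hAB⟩ := h
  open Polynomial in
  refine ⟨C (1/2) * (X * (derivative A + C Complex.I * A) - C (a:ℂ) * A),
    C (1/2) * (X * (derivative B - C Complex.I * B) - C (a:ℂ) * B), fun x hx => ?_⟩
  have ht : x^2/4 ≠ 0 := by positivity
  have hid : HasDerivAt (fun x : ℝ => (x:ℂ)) 1 x := Complex.ofRealCLM.hasDerivAt
  have h1 : HasDerivAt (fun x : ℝ => phi n (x^2/4)) (psi n (x^2/4) * (2 / x)) x := by
    have := (phi_diff n (x^2/4) ht).comp x (((hasDerivAt_id x).pow 2).div_const 4)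
    refine this.congr_deriv ?_
    simp
    field_simp
  have hL := (hid.pow a).mul h1.ofReal_comp
  have hR : HasDerivAt (fun x : ℝ => A.eval (x:ℂ) * Complex.exp (Complex.I * x) + B.eval (x:ℂ) * Complex.exp (-(Complex.I * x)))
     _ x := (((A.hasDerivAt (x:ℂ)).comp x hid).mul ((hid.const_mul Complex.I).cexp)).add
     (((B.hasDerivAt (x:ℂ)).comp x hid).mul ((hid.const_mul Complex.I).neg.cexp))
  have heq : (fun x : ℝ => A.eval (x:ℂ) * Complex.exp (Complex.I * x) + B.eval (x:ℂ) * Complex.exp (-(Complex.I * x)))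
     =ᶠ[𝓝 x] (fun x : ℝ => (x:ℂ)^a) * (fun x : ℝ => ((phi n (x^2/4) : ℝ) : ℂ)) := by
    filter_upwards [isOpen_ne.mem_nhds hx] with y hy
    exact (hAB y hy).symm
  have hu := (hR.congr_of_eventuallyEq heq.symm).unique hL
  have hxC : (x:ℂ) ≠ 0 := by exact_mod_cast hx
  have h0 := hAB x hx
  simp only [Polynomial.eval_mul, Polynomial.eval_add, Polynomial.eval_sub, Polynomial.eval_C, Polynomial.eval_X]
  simp only [mul_one, Function.comp, Complex.ofReal_mul, Complex.ofReal_div, Pi.pow_apply] at hu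
  have hpow : (x:ℂ) * ((a:ℂ) * (x:ℂ)^(a-1)) = a * (x:ℂ)^a := by
    cases a with
    | zero => simp
    | succ a => rw [Nat.add_sub_cancel, pow_succ]; ring
  have hx2 : (x:ℂ) * (((psi n (x^2/4) : ℝ) : ℂ) * (((2:ℝ):ℂ) / x)) = 2 * ((psi n (x^2/4) : ℝ) : ℂ) := by
    push_cast; field_simp
  linear_combination (-(1/2) * (x:ℂ)) * hu + (-(1/2) * (a:ℂ)) * h0 - (1/2) * ((phi n (x^2/4) : ℝ) : ℂ) * hpow - (1/2) * (x:ℂ)^a * hx2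

lemma ER_phi (μ : ℕ) : ∃ a, ER (fun x => phi (2*μ+1) (x^2/4)) a := by
  induction μ with
  | zero =>
    refine ⟨1, Polynomial.C (-Complex.I/2), Polynomial.C (Complex.I/2), fun x hx => ?_⟩
    have := congrArg (fun r : ℝ => (r:ℂ)) (phi_one x)
    push_cast at this
    simp only [pow_one, Polynomial.eval_C, mul_zero, zero_add]
    push_cast
    rw [this, Complex.sin]
    rw [show Complex.I * (x:ℂ) = x * Complex.I by ring, show -(x:ℂ) * Complex.I = -(x * Complex.I) by ring]
    ring
  | succ μ ih =>
    obtain ⟨a, ha⟩ := ih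
    obtain ⟨A, B, hAB⟩ := ER_psi _ _ ha
    set c : ℂ := - (((2*μ+1:ℕ):ℂ)/2+1) * 4 with hc
    refine ⟨a + 2, Polynomial.C c * A, Polynomial.C c * B, fun x hx => ?_⟩
    have h1 := hAB x hx
    have h2 := congrArg (fun r : ℝ => (r:ℂ)) (psi_next (2*μ+1) (x^2/4))
    simp only [Complex.ofReal_mul, Complex.ofReal_neg] at h2
    rw [show 2*(μ+1)+1 = 2*μ+1+2 by ring]
    simp only [Polynomial.eval_mul, Polynomial.eval_C]
    push_cast at h1 h2 hc ⊢
    rw [hc, pow_add]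
    linear_combination (- ((2 * (μ:ℂ)+1)/2+1) * 4) * h1 + 4 * (x:ℂ)^a * h2
end Bg

namespace Bg
open Finset Filter Topology
open scoped Nat

lemma fev_homog {A : Type*} [CommRing A] (N : ℕ) (s τ x y : A) (p : ℕ → Polynomial ℤ) :
    fev N τ (s * x) (s * y) p = s^N * fev N τ x y p := by
  unfold fev
  rw [mul_sum]
  refine sum_congr rfl fun i hi => ?_
  have hi : i ≤ N := by simpa [Nat.lt_succ_iff] using hi
  obtain ⟨j, rfl⟩ := Nat.exists_eq_add_of_le hi
  rw [Nat.add_sub_cancel_left, mul_pow, mul_pow, pow_add]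
  ring

/-- all coefficients have degree at most `d` -/
def cdeg (W : Polynomial (Polynomial ℂ)) (d : ℕ) : Prop := ∀ j, (W.coeff j).natDegree ≤ d

lemma cdeg_mul {U V : Polynomial (Polynomial ℂ)} {a b : ℕ} (hU : cdeg U a) (hV : cdeg V b) : cdeg (U * V) (a + b) := by
  intro j
  rw [Polynomial.coeff_mul]
  refine Polynomial.natDegree_sum_le_of_forall_le _ _ fun q _ => ?_
  exact Polynomial.natDegree_mul_le.trans (add_le_add (hU _) (hV _))

lemma cdeg_pow {U : Polynomial (Polynomial ℂ)} {a : ℕ} (hU : cdeg U a) (k : ℕ) : cdeg (U ^ k) (k * a) := by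
  induction k with
  | zero =>
    intro j
    rw [pow_zero, Polynomial.coeff_one]
    split_ifs <;> simp
  | succ k ih =>
    rw [pow_succ, Nat.succ_mul]
    exact cdeg_mul ih hU

lemma cdeg_mono {U : Polynomial (Polynomial ℂ)} {a b : ℕ} (hU : cdeg U a) (h : a ≤ b) : cdeg U b := fun j => (hU j).trans h

lemma cdeg_lin (A B : Polynomial ℂ) (d : ℕ) (hA : A.natDegree ≤ d) (hB : B.natDegree ≤ d) :
    cdeg (Polynomial.C A * Polynomial.X + Polynomial.C B) d := by
  intro j
  rw [Polynomial.coeff_add, Polynomial.coeff_C_mul, Polynomial.coeff_X, Polynomial.coeff_C]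
  refine (Polynomial.natDegree_add_le _ _).trans (max_le ?_ ?_)
  · split_ifs <;> simp [hA]
  · split_ifs <;> simp [hB]

lemma cdeg_fev (N L d : ℕ) (A B A2 B2 : Polynomial ℂ) (hA : A.natDegree ≤ d) (hB : B.natDegree ≤ d)
    (hA2 : A2.natDegree ≤ d) (hB2 : B2.natDegree ≤ d) (p : ℕ → Polynomial ℤ) (hp : ∀ i, (p i).natDegree ≤ L) :
    cdeg (fev N (Polynomial.C (Polynomial.C (1/4) * Polynomial.X^2)) (Polynomial.C A * Polynomial.X + Polynomial.C B)
      (Polynomial.C A2 * Polynomial.X + Polynomial.C B2) p) (2 * L + N * d) := by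
  unfold fev
  intro j
  rw [Polynomial.finsetSum_coeff]
  refine Polynomial.natDegree_sum_le_of_forall_le _ _ fun i hi => ?_
  have hi : i ≤ N := by simpa [Nat.lt_succ_iff] using hi
  have h1 : cdeg ((p i).eval₂ (Int.castRingHom _) (Polynomial.C (Polynomial.C (1/4:ℂ) * Polynomial.X^2))) (2 * L) := by
    intro j
    rw [Polynomial.eval₂_eq_sum_range, Polynomial.finsetSum_coeff]
    refine Polynomial.natDegree_sum_le_of_forall_le _ _ fun k hk => ?_
    have hk : k ≤ L := (by simpa [Nat.lt_succ_iff] using hk : k ≤ (p i).natDegree).trans (hp i)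
    rw [← Polynomial.C_pow, show (Int.castRingHom (Polynomial (Polynomial ℂ))) ((p i).coeff k) = Polynomial.C (Polynomial.C (((p i).coeff k : ℤ):ℂ)) by simp,
      ← Polynomial.C_mul, Polynomial.coeff_C]
    split_ifs
    · refine (Polynomial.natDegree_C_mul_le _ _).trans ?_
      refine (Polynomial.natDegree_pow_le).trans ?_
      have := Polynomial.natDegree_C_mul_X_pow_le (1/4:ℂ) 2
      nlinarith
    · simp
  have h2 := cdeg_mul h1 (cdeg_mul (cdeg_pow (cdeg_lin A B d hA hB) i) (cdeg_pow (cdeg_lin A2 B2 d hA2 hB2) (N-i)))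
  have h3 := h2 j
  refine h3.trans (le_of_eq ?_)
  rw [← add_mul, Nat.add_sub_cancel' hi]

lemma vo_cplx' {G : ℂ → ℂ} {x0 : ℝ} (hG : AnalyticAt ℂ G x0) (m : ℕ) (C : ℝ)
    (h : ∀ᶠ x : ℝ in 𝓝[≠] x0, ‖G x‖ ≤ C * |x - x0| ^ m) : (m : ℕ∞) ≤ analyticOrderAt G x0 := by
  refine vo_cplx hG m C ?_
  have h2 : ‖G x0‖ ≤ C * |x0 - x0| ^ m := by
    have c1 : ContinuousAt (fun x : ℝ => ‖G x‖) x0 := by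
      refine ContinuousAt.norm ?_
      exact ContinuousAt.comp (f := fun x : ℝ => (x:ℂ)) hG.continuousAt Complex.continuous_ofReal.continuousAt
    have c2 : ContinuousAt (fun x : ℝ => C * |x - x0|^m) x0 := by fun_prop
    exact le_of_tendsto_of_tendsto (c1.tendsto.mono_left nhdsWithin_le_nhds) (c2.tendsto.mono_left nhdsWithin_le_nhds) h
  rw [eventually_nhdsWithin_iff] at h
  filter_upwards [h] with x hx
  by_cases hxx : x = x0
  · rw [hxx]; exact h2
  · exact hx hxx

theorem ZE_odd (μ : ℕ) : ZE (2*μ+1) := by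
  intro N α hα hφ
  obtain ⟨a, A, B, h1⟩ := ER_phi μ
  obtain ⟨A2, B2, h2⟩ := ER_psi (2*μ+1) a ⟨A, B, h1⟩
  set d := max (max A.natDegree B.natDegree) (max A2.natDegree B2.natDegree) with hd
  refine ⟨(N+1) * (N * d) + 2 * (N+1) , fun L hL p hp hdeg hco => ?_⟩
  by_contra hcon
  push Not at hcon
  set K := 2 * L + ((N+1) * (N * d) + 2 * (N+1)) with hK
  set n := 2*μ+1 with hn
  set W := fev N (Polynomial.C (Polynomial.C (1/4:ℂ) * Polynomial.X^2)) (Polynomial.C A * Polynomial.X + Polynomial.C B)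
      (Polynomial.C A2 * Polynomial.X + Polynomial.C B2) p with hW
  have hWd : W.natDegree ≤ N := (top_coeff N A B A2 B2 _ p).1
  have hWc : cdeg W (2 * L + N * d) := cdeg_fev N L d A B A2 B2 (by simp [hd]) (by simp [hd]) (by simp [hd]) (by simp [hd]) p hdeg
  obtain ⟨hRE, hRev⟩ := Rs_ent N n p
  set Rr := Rs N n p with hRr
  -- the exponential polynomial
  have key : ∀ x : ℝ, x ≠ 0 → ∑ j ∈ range (N+1), (W.coeff j).eval (x:ℂ) * Complex.exp (2 * Complex.I * j * x)
      = (Complex.exp (Complex.I * x) * (x:ℂ)^a)^N * (ev Rr (x^2/4) : ℝ) := by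
    intro x hx
    have e1 := h1 x hx
    have e2 := h2 x hx
    have hE : Complex.exp (Complex.I * x) * Complex.exp (-(Complex.I * x)) = 1 := by
      rw [← Complex.exp_add]; simp
    set E := Complex.exp (Complex.I * x) with hEd
    have s1 : ∑ j ∈ range (N+1), (W.coeff j).eval (x:ℂ) * Complex.exp (2 * Complex.I * j * x)
       = (W.map (Polynomial.evalRingHom (x:ℂ))).eval (E^2) := by
      rw [Polynomial.eval_eq_sum_range' (n := N+1)]
      · refine sum_congr rfl fun j _ => ?_
        rw [Polynomial.coeff_map, hEd, ← pow_mul, ← Complex.exp_nat_mul]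
        simp only [Polynomial.coe_evalRingHom]
        congr 2
        push_cast; ring
      · exact Nat.lt_succ_of_le ((Polynomial.natDegree_map_le).trans hWd)
    rw [s1, ← Polynomial.coe_mapRingHom, ← Polynomial.coe_evalRingHom, ← RingHom.comp_apply, hW, fev_map]
    simp only [RingHom.comp_apply, Polynomial.coe_mapRingHom, Polynomial.coe_evalRingHom, Polynomial.map_add, Polynomial.map_mul,
      Polynomial.map_C, Polynomial.map_X, Polynomial.eval_add, Polynomial.eval_mul, Polynomial.eval_C, Polynomial.eval_X, Polynomial.eval_pow]
    have hcast : ((fev N (x^2/4) (phi n (x^2/4)) (ev (Ps n) (x^2/4)) p : ℝ) : ℂ) = _ := fev_map Complex.ofRealHom N _ _ _ p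
    rw [hRev, hcast]
    rw [← fev_homog]
    congr 1
    · simp; ring
    · simp only [Complex.ofRealHom_eq_coe]
      linear_combination -E * e1 - B.eval (x:ℂ) * hE
    · simp only [Complex.ofRealHom_eq_coe]
      change _ = E * (x:ℂ)^a * (psi n (x^2/4) : ℝ)
      linear_combination -E * e2 - B2.eval (x:ℂ) * hE
  classical
  set J := (range (N+1)).filter (fun j => W.coeff j ≠ 0) with hJ
  set r := J.card with hr
  have hrN : r ≤ N+1 := (card_filter_le _ _).trans (by simp)
  set e := J.equivFin.symm with he
  set Q : Fin r → Polynomial ℂ := fun j => W.coeff (e j) with hQ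
  set l : Fin r → ℂ := fun j => 2 * Complex.I * ((e j : ℕ) : ℂ) with hl
  set G : ℂ → ℂ := fun z => ∑ j, (Q j).eval z * Complex.exp (l j * z) with hG
  have hGs : ∀ z, G z = ∑ j ∈ range (N+1), (W.coeff j).eval z * Complex.exp (2 * Complex.I * j * z) := by
    intro z
    rw [hG]
    simp only [hQ, hl]
    rw [Equiv.sum_comp e (fun j : J => (W.coeff (j:ℕ)).eval z * Complex.exp (2 * Complex.I * ((j:ℕ):ℂ) * z)),
      Finset.sum_coe_sort J (fun j => (W.coeff j).eval z * Complex.exp (2 * Complex.I * (j:ℂ) * z)), hJ, sum_filter_of_ne]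
    intro j _ hj h0
    rw [h0] at hj; simp at hj
  have hGx : ∀ x : ℝ, x ≠ 0 → ‖G x‖ = |x|^(a*N) * |ev Rr (x^2/4)| := by
    intro x hx
    rw [hGs, key x hx, norm_mul, norm_pow, norm_mul, Complex.norm_exp, norm_pow, Complex.norm_real, Complex.norm_real]
    simp [pow_mul]
  have hR0 : Rr ≠ 0 := Rs_ne_zero N n p hp
  have hr0 : 0 < r := by
    rw [Nat.pos_iff_ne_zero]
    intro h0
    obtain ⟨t, ht, hne⟩ := ent_ne hRE hR0
    have hG0 : ∀ z, G z = 0 := by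
      intro z
      rw [hG]
      refine sum_eq_zero fun j _ => ?_
      exact absurd j.2 (by omega)
    have := hGx (2 * Real.sqrt t) (by positivity)
    rw [hG0, mul_pow, Real.sq_sqrt ht.le] at this
    rw [show (2:ℝ)^2 * t / 4 = t by ring] at this
    simp only [norm_zero] at this
    have h3 : 0 < |2 * Real.sqrt t|^(a*N) * |ev Rr t| := by positivity
    linarith
  have hGa : ∀ z, AnalyticAt ℂ G z := by
    intro z
    rw [hG]
    refine Finset.analyticAt_fun_sum _ fun j _ => ?_
    exact (analyticAt_poly (Q j) z).mul ((analyticAt_const.mul analyticAt_id).cexp)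
  set x0 : ℝ := 2 * Real.sqrt α with hx0
  have hx0p : 0 < x0 := by positivity
  have hx0s : x0^2/4 = α := by
    rw [hx0, mul_pow, Real.sq_sqrt hα.le]; ring
  have hlim : ∀ y : ℝ, Tendsto (fun x : ℝ => x^2/4) (𝓝 y) (𝓝 (y^2/4)) := fun y =>
    (by fun_prop : Continuous (fun x : ℝ => x^2/4)).tendsto y
  have o0 : ((2*N*L : ℕ) : ℕ∞) ≤ analyticOrderAt G ((0:ℝ):ℂ) := by
    obtain ⟨C, hC, hb⟩ := ord_bound (ev_analytic hRE 0) _ (vo_zero hRE (N*L) hco)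
    refine vo_cplx' (hGa _) _ C ?_
    have hb' := (hlim 0).eventually (by simpa using hb)
    have hle : ∀ᶠ x : ℝ in 𝓝 0, |x| < 1 := by
      have := (continuous_abs.tendsto (0:ℝ)).eventually_lt_const (u := 1) (by simp)
      exact this
    filter_upwards [self_mem_nhdsWithin, hb'.filter_mono nhdsWithin_le_nhds, hle.filter_mono nhdsWithin_le_nhds] with x hx hbx hlx
    rw [hGx x hx]
    have t1 : |x|^(a*N) ≤ 1 := pow_le_one₀ (abs_nonneg _) hlx.le
    have t2 : |x^2/4|^(N*L) ≤ |x - 0|^(2*N*L) := by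
      rw [sub_zero, abs_div, abs_pow, mul_assoc 2, pow_mul _ 2]
      gcongr
      rw [abs_of_pos (by norm_num : (0:ℝ) < 4)]
      have : 0 ≤ |x|^2 := by positivity
      linarith
    calc |x|^(a*N) * |ev Rr (x^2/4)| ≤ 1 * (C * |x^2/4|^(N*L)) := by gcongr
      _ ≤ C * |x - 0|^(2*N*L) := by rw [one_mul]; gcongr
  have o1 : ((K+1 : ℕ) : ℕ∞) ≤ analyticOrderAt G (x0:ℂ) := by
    obtain ⟨C, hC, hb⟩ := ord_bound (ev_analytic hRE α) _ (vo_of_eu hRE hα.ne' (K+1) (fun k hk => hcon k (Nat.lt_succ_iff.1 hk)))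
    have hb' := (hlim x0).eventually (by rw [hx0s]; exact hb)
    have c3 : ContinuousAt (fun x : ℝ => |x|^(a*N) * |(x + x0)/4|^(K+1)) x0 := by fun_prop
    have hle := c3.tendsto.eventually_lt_const (u := |x0|^(a*N) * |(x0 + x0)/4|^(K+1) + 1) (by simp)
    refine vo_cplx' (hGa _) _ (C * (|x0|^(a*N) * |(x0 + x0)/4|^(K+1) + 1)) ?_
    refine Filter.Eventually.filter_mono nhdsWithin_le_nhds ?_
    filter_upwards [isOpen_ne.mem_nhds hx0p.ne', hb', hle] with x hx hbx hlx
    rw [hGx x hx]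
    have t2 : |x^2/4 - α|^(K+1) = |(x+x0)/4|^(K+1) * |x-x0|^(K+1) := by
      rw [← mul_pow, ← abs_mul, ← hx0s]; congr 2; ring
    rw [t2] at hbx
    calc |x|^(a*N) * |ev Rr (x^2/4)| ≤ |x|^(a*N) * (C * (|(x+x0)/4|^(K+1) * |x-x0|^(K+1))) := by gcongr
      _ = C * (|x|^(a*N) * |(x+x0)/4|^(K+1)) * |x-x0|^(K+1) := by ring
      _ ≤ _ := by gcongr
  have hinj : Function.Injective l := by
    intro i j hij
    simp only [hl] at hij
    have h3 : ((e i : ℕ) : ℂ) = ((e j : ℕ) : ℂ) := mul_left_cancel₀ (by simp) hij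
    exact e.injective (Subtype.ext (by exact_mod_cast h3))
  have hQ0 : ∀ j, Q j ≠ 0 := fun j => (mem_filter.1 (e j).2).2
  have fin := exp_zero_est Q l hinj hQ0 hr0 (fun j => hWc _) x0 (by exact_mod_cast hx0p.ne') (2*N*L) (K+1) (by simpa using o0) o1
  have f2 : r * (2*L + N*d) ≤ (N+1) * (N*d) + r * (2*L) := by
    have := Nat.mul_le_mul_right (N*d) hrN
    rw [mul_add]; omega
  have f3 : 2 * N * L + (K+1) ≤ 2 * r + r * (2*L + N*d) := by omega
  have f4 : r * (2*L) ≤ (N+1) * (2*L) := by gcongr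
  have f5 : (N+1) * (2*L) = 2*N*L + 2*L := by ring
  omega

theorem ZE_all (n : ℕ) (hn : 1 ≤ n) : ZE n := by
  rcases Nat.even_or_odd' n with ⟨k, rfl | rfl⟩
  · exact ZE_even k (by omega)
  · exact ZE_odd k
end Bg

namespace Bg
open Finset Filter Topology
open scoped Nat

lemma poly_abs_le (p : Polynomial ℤ) (D : ℕ) (H : ℝ) (hD : p.natDegree ≤ D) (hH : ∀ j, |((p.coeff j : ℤ) : ℝ)| ≤ H)
    (z : ℂ) (A : ℝ) (hA : 1 ≤ A) (hz : ‖z‖ ≤ A) : ‖p.eval₂ (Int.castRingHom ℂ) z‖ ≤ (2 * A)^D * H := by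
  have hH0 : 0 ≤ H := (abs_nonneg _).trans (hH 0)
  rw [Polynomial.eval₂_eq_sum_range' (n := D+1) _ (Nat.lt_succ_of_le hD)]
  calc ‖∑ i ∈ range (D+1), (Int.castRingHom ℂ) (p.coeff i) * z^i‖ ≤ ∑ i ∈ range (D+1), H * A^D := by
        refine norm_sum_le_of_le _ fun i hi => ?_
        have hi : i ≤ D := by simpa [Nat.lt_succ_iff] using hi
        rw [norm_mul, norm_pow]
        have h1 : ‖(Int.castRingHom ℂ) (p.coeff i)‖ ≤ H := by
          have := hH i
          simpa using this
        have h2 : ‖z‖^i ≤ A^D := (pow_le_pow_left₀ (norm_nonneg _) hz i).trans (pow_le_pow_right₀ hA hi)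
        exact mul_le_mul h1 h2 (by positivity) hH0
    _ = (D+1) * (H * A^D) := by simp
    _ ≤ 2^D * (H * A^D) := by
        gcongr
        exact_mod_cast succ_le_two_pow D
    _ = _ := by rw [mul_pow]; ring

/-- Liouville type lower bound -/
lemma liouville (α : ℝ) (hα : IsAlgebraic ℚ α) : ∃ d : ℕ, ∃ C : ℝ, 1 ≤ C ∧ ∀ (p : Polynomial ℤ) (D : ℕ) (H : ℝ), 1 ≤ H →
    p.natDegree ≤ D → (∀ j, |((p.coeff j : ℤ) : ℝ)| ≤ H) → p.eval₂ (Int.castRingHom ℝ) α ≠ 0 →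
    1 ≤ |p.eval₂ (Int.castRingHom ℝ) α| * (C^D * H)^d := by
  classical
  let K := IntermediateField.adjoin ℚ {α}
  have hintg : IsIntegral ℚ α := hα.isIntegral
  have : FiniteDimensional ℚ K := IntermediateField.adjoin.finiteDimensional hintg
  let γ : K := IntermediateField.AdjoinSimple.gen ℚ α
  have hγα : algebraMap K ℝ γ = α := IntermediateField.AdjoinSimple.algebraMap_gen ℚ α
  have hγ : IsAlgebraic ℤ γ := by
    have : IsAlgebraic ℚ γ := Algebra.IsAlgebraic.isAlgebraic γ
    exact (IsFractionRing.isAlgebraic_iff ℤ ℚ K).2 this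
  obtain ⟨a, ha, hai⟩ := hγ.exists_integral_multiple
  let σ0 : K →ₐ[ℚ] ℂ := (Complex.ofRealAm.restrictScalars ℚ).comp K.val
  have hσ0 : ∀ x : K, σ0 x = ((algebraMap K ℝ x : ℝ) : ℂ) := fun x => rfl
  obtain ⟨A, hA1, hA⟩ : ∃ A : ℝ, 1 ≤ A ∧ ∀ σ : K →ₐ[ℚ] ℂ, ‖σ γ‖ ≤ A := by
    refine ⟨1 + ∑ σ : K →ₐ[ℚ] ℂ, ‖σ γ‖, ?_, fun σ => ?_⟩
    · have : 0 ≤ ∑ σ : K →ₐ[ℚ] ℂ, ‖σ γ‖ := Finset.sum_nonneg fun _ _ => norm_nonneg _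
      linarith
    · have := Finset.single_le_sum (f := fun σ : K →ₐ[ℚ] ℂ => ‖σ γ‖) (fun _ _ => norm_nonneg _) (mem_univ σ)
      linarith
  have ha1 : (1:ℝ) ≤ |(a:ℝ)| := by exact_mod_cast Int.one_le_abs ha
  refine ⟨Fintype.card (K →ₐ[ℚ] ℂ), |(a:ℝ)| * (2 * A), by nlinarith, fun p D H hH hD hco hne => ?_⟩
  set P : K := (a:K)^D * p.eval₂ (Int.castRingHom K) γ with hP
  have hPint : IsIntegral ℤ P := by
    rw [hP, Polynomial.eval₂_eq_sum_range' (n := D+1) _ (Nat.lt_succ_of_le hD), mul_sum]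
    refine IsIntegral.sum _ fun i hi => ?_
    have hi : i ≤ D := by simpa [Nat.lt_succ_iff] using hi
    obtain ⟨j, rfl⟩ := Nat.exists_eq_add_of_le hi
    have : (a:K)^(i+j) * ((Int.castRingHom K) (p.coeff i) * γ^i) = (algebraMap ℤ K (a^j * p.coeff i)) * (a • γ)^i := by
      rw [zsmul_eq_mul, mul_pow]
      simp
      ring
    rw [this]
    exact isIntegral_algebraMap.mul (hai.pow i)
  have hσP : ∀ σ : K →ₐ[ℚ] ℂ, σ P = (a:ℂ)^D * p.eval₂ (Int.castRingHom ℂ) (σ γ) := by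
    intro σ
    rw [hP, map_mul, map_pow, map_intCast]
    congr 1
    have := Polynomial.hom_eval₂ p (Int.castRingHom K) (σ : K →+* ℂ) γ
    rw [show ((σ : K →+* ℂ).comp (Int.castRingHom K)) = Int.castRingHom ℂ from RingHom.ext_int _ _] at this
    exact this
  have hσ0P : ‖σ0 P‖ = |(a:ℝ)|^D * |p.eval₂ (Int.castRingHom ℝ) α| := by
    rw [hσP, hσ0, hγα]
    have := Polynomial.hom_eval₂ p (Int.castRingHom ℝ) Complex.ofRealHom α
    rw [show (Complex.ofRealHom.comp (Int.castRingHom ℝ)) = Int.castRingHom ℂ from RingHom.ext_int _ _] at this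
    simp only [Complex.ofRealHom_eq_coe] at this
    rw [← this, norm_mul, Complex.norm_real, norm_pow]
    simp
  have hP0 : P ≠ 0 := by
    intro h0
    rw [h0, map_zero, norm_zero] at hσ0P
    have : 0 < |(a:ℝ)|^D * |p.eval₂ (Int.castRingHom ℝ) α| := by
      have := abs_pos.2 hne
      positivity
    linarith
  have hN := Algebra.norm_eq_prod_embeddings ℚ ℂ P
  have hNint : IsIntegral ℤ (Algebra.norm ℚ P) := Algebra.isIntegral_norm ℚ hPint
  obtain ⟨z, hz⟩ := IsIntegrallyClosed.isIntegral_iff.1 hNint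
  have hz0 : z ≠ 0 := by
    rintro rfl
    rw [map_zero] at hz
    exact hP0 (Algebra.norm_eq_zero_iff.1 hz.symm)
  have h1 : 1 ≤ ∏ σ : K →ₐ[ℚ] ℂ, ‖σ P‖ := by
    rw [← norm_prod, ← hN, ← hz]
    simp
    exact_mod_cast Int.one_le_abs hz0
  have hCH : 1 ≤ (|(a:ℝ)| * (2 * A))^D * H := by
    have : 1 ≤ (|(a:ℝ)| * (2 * A))^D := one_le_pow₀ (by nlinarith)
    nlinarith
  have hb : ∀ σ : K →ₐ[ℚ] ℂ, ‖σ P‖ ≤ (|(a:ℝ)| * (2 * A))^D * H := by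
    intro σ
    rw [hσP, norm_mul, norm_pow, mul_pow, mul_assoc]
    have := poly_abs_le p D H hD hco (σ γ) A hA1 (hA σ)
    have e : ‖(a:ℂ)‖ = |(a:ℝ)| := by simp
    rw [e]
    gcongr
  rw [← Finset.mul_prod_erase _ _ (mem_univ σ0)] at h1
  have h2 : ∏ σ ∈ univ.erase σ0, ‖σ P‖ ≤ ((|(a:ℝ)| * (2 * A))^D * H)^(Fintype.card (K →ₐ[ℚ] ℂ) - 1) := by
    have := Finset.prod_le_prod (s := univ.erase σ0) (fun σ _ => norm_nonneg (σ P)) (fun σ _ => hb σ)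
    simpa [Finset.card_erase_of_mem] using this
  have hcard : 0 < Fintype.card (K →ₐ[ℚ] ℂ) := Fintype.card_pos_iff.2 ⟨σ0⟩
  have h3 : |(a:ℝ)|^D ≤ (|(a:ℝ)| * (2 * A))^D * H := by
    rw [mul_pow, mul_assoc]
    have : 1 ≤ (2*A)^D := one_le_pow₀ (by linarith)
    have : 1 ≤ (2*A)^D * H := by nlinarith
    have : 0 ≤ |(a:ℝ)|^D := by positivity
    nlinarith
  calc 1 ≤ _ := h1
    _ ≤ (((|(a:ℝ)| * (2 * A))^D * H) * |p.eval₂ (Int.castRingHom ℝ) α|) * ((|(a:ℝ)| * (2 * A))^D * H)^(Fintype.card (K →ₐ[ℚ] ℂ) - 1) := by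
        rw [hσ0P]
        gcongr
    _ = |p.eval₂ (Int.castRingHom ℝ) α| * (((|(a:ℝ)| * (2 * A))^D * H)^(Fintype.card (K →ₐ[ℚ] ℂ) - 1 + 1)) := by
        rw [pow_succ]; ring
    _ = _ := by rw [Nat.sub_add_cancel hcard]

end Bg

namespace Bg
open Finset Filter Topology
open scoped Nat

lemma abs4 {a b c d A B C D : ℤ} (h1 : |a| ≤ A) (h2 : |b| ≤ B) (h3 : |c| ≤ C) (h4 : |d| ≤ D) :
    |a - b + c - d| ≤ A + B + C + D := by
  rw [abs_le] at *
  constructor <;> linarith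

lemma Dt_bnd (N n D : ℕ) (M : ℤ) (p : ℕ → Polynomial ℤ) (hD : ∀ i, (p i).natDegree ≤ D)
    (hM : ∀ i j, |(p i).coeff j| ≤ M) (i j : ℕ) : |(Dt N n p i).coeff j| ≤ (2 * D + N * n + 4 * N) * M := by
  have hM0 : 0 ≤ M := (abs_nonneg _).trans (hM 0 0)
  have t1 : |(2 * Polynomial.X * Polynomial.derivative (p i)).coeff j| ≤ 2 * D * M := by
    have e : (2 * Polynomial.X * Polynomial.derivative (p i)).coeff j = 2 * (j * (p i).coeff j) := by
      rw [mul_assoc, ← Polynomial.C_ofNat, Polynomial.coeff_C_mul]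
      cases j with
      | zero => simp
      | succ j => rw [Polynomial.coeff_X_mul, Polynomial.coeff_derivative]; push_cast; ring
    rw [e]
    by_cases hj : j ≤ D
    · rw [abs_mul, abs_mul, abs_two, Nat.abs_cast, mul_assoc]
      have := hM i j
      gcongr
    · rw [Polynomial.coeff_eq_zero_of_natDegree_lt (lt_of_le_of_lt (hD i) (by omega))]
      simp; positivity
  have t2 : |((((N - i : ℕ) : Polynomial ℤ) * n) * p i).coeff j| ≤ N * n * M := by
    have e : ((((N - i : ℕ) : Polynomial ℤ) * n) * p i) = Polynomial.C (((N - i : ℕ) : ℤ) * n) * p i := by simp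
    rw [e, Polynomial.coeff_C_mul, abs_mul, abs_mul, Nat.abs_cast, Nat.abs_cast]
    have := hM i j
    have h3 : ((N - i : ℕ) : ℤ) ≤ N := by exact_mod_cast Nat.sub_le N i
    gcongr
  have t3 : |(if i < N then 2 * ((i:Polynomial ℤ) + 1) * p (i+1) else 0).coeff j| ≤ 2 * N * M := by
    split_ifs with h
    · have e : 2 * ((i:Polynomial ℤ) + 1) * p (i+1) = Polynomial.C (2 * ((i:ℤ) + 1)) * p (i+1) := by simp
      rw [e, Polynomial.coeff_C_mul, abs_mul, abs_of_nonneg (by positivity)]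
      have := hM (i+1) j
      have : (i:ℤ) + 1 ≤ N := by exact_mod_cast h
      gcongr
    · simp; positivity
  have t4 : |(2 * Polynomial.X * (match i with | 0 => 0 | j+1 => ((N - j : ℕ) : Polynomial ℤ) * p j)).coeff j| ≤ 2 * N * M := by
    cases i with
    | zero => simp; positivity
    | succ i =>
      simp only
      have e : 2 * Polynomial.X * (((N - i : ℕ) : Polynomial ℤ) * p i) = Polynomial.C (2 * ((N - i : ℕ):ℤ)) * (Polynomial.X * p i) := by
        simp; ring
      rw [e, Polynomial.coeff_C_mul, abs_mul, abs_of_nonneg (by positivity)]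
      have h3 : ((N - i : ℕ) : ℤ) ≤ N := by exact_mod_cast Nat.sub_le N i
      have h4 : |(Polynomial.X * p i).coeff j| ≤ M := by
        cases j with
        | zero => simpa using hM0
        | succ j => rw [Polynomial.coeff_X_mul]; exact hM i j
      gcongr
  unfold Dt
  rw [Polynomial.coeff_sub, Polynomial.coeff_add, Polynomial.coeff_sub]
  refine le_trans (abs4 t1 t2 t3 t4) (le_of_eq (by ring))

lemma Dt_iter_bnd (N n L K : ℕ) (M : ℤ) (p : ℕ → Polynomial ℤ) (hD : ∀ i, (p i).natDegree ≤ L)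
    (hM : ∀ i j, |(p i).coeff j| ≤ M) (k : ℕ) (hk : k ≤ K) (i j : ℕ) :
    |((Dt N n)^[k] p i).coeff j| ≤ (2 * (L + K) + N * n + 4 * N) ^ k * M := by
  have hM0 : 0 ≤ M := (abs_nonneg _).trans (hM 0 0)
  induction k generalizing i j with
  | zero => simpa using hM i j
  | succ k ih =>
    rw [Function.iterate_succ_apply']
    refine (Dt_bnd N n (L+k) _ _ (fun i => Dt_iter_deg N n p L hD k i) (ih (by omega)) i j).trans ?_
    have : (k:ℤ) ≤ K := by exact_mod_cast (by omega : k ≤ K)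
    push_cast
    rw [← mul_assoc, pow_succ']
    gcongr

lemma pow_le_fac (m k : ℕ) : (m:ℝ)^k ≤ k ! * 3^m := by
  have h1 := Real.pow_div_factorial_le_exp (m:ℝ) (by positivity) k
  have h2 : Real.exp m ≤ 3^m := by
    rw [← mul_one (m:ℝ), Real.exp_nat_mul]
    exact pow_le_pow_left₀ (Real.exp_pos _).le Real.exp_one_lt_three.le m
  rw [div_le_iff₀ (by positivity)] at h1
  calc (m:ℝ)^k ≤ Real.exp m * k ! := h1
    _ ≤ 3^m * k ! := by gcongr
    _ = _ := by ring

lemma coeff_eu_iter (f : PowerSeries ℚ) (k m : ℕ) : PowerSeries.coeff m (eu^[k] f) = (m:ℚ)^k * PowerSeries.coeff m f := by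
  induction k with
  | zero => simp
  | succ k ih => rw [Function.iterate_succ_apply', coeff_eu, ih, pow_succ]; ring

lemma rem_bound (f : PowerSeries ℚ) (hf : Ent f) (L N C k : ℕ) (α : ℝ) (hα : 0 < α)
    (h0 : ∀ m < N * L, PowerSeries.coeff m f = 0)
    (hb : ∀ m, |((PowerSeries.coeff m f : ℚ) : ℝ)| ≤ (2*L)! * (C:ℝ)^(L+m) / (2*m)!) :
    |ev (eu^[k] f) α| ≤ k ! * (2*L)! * (C:ℝ)^L * (3*C*α)^(N*L) / (2*(N*L))! * Real.exp (3*C*α) := by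
  have hs : Summable fun m => ((PowerSeries.coeff m (eu^[k] f) : ℚ) : ℝ) * α ^ m := ((ent_eu_iter hf k).norm α).of_norm
  rw [ev, ← hs.sum_add_tsum_nat_add (N*L), sum_eq_zero, zero_add]
  · rw [← Real.norm_eq_abs]
    have hE : HasSum (fun j : ℕ => (3*C*α)^j / (j ! : ℝ)) (Real.exp (3*C*α)) := by
      rw [Real.exp_eq_exp_ℝ]; exact NormedSpace.expSeries_div_hasSum_exp (3*C*α)
    refine tsum_of_norm_bounded (hE.mul_left (k ! * (2*L)! * (C:ℝ)^L * (3*C*α)^(N*L) / (2*(N*L))!)) fun j => ?_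
    set T := N*L with hT
    rw [coeff_eu_iter, norm_mul, norm_pow, Real.norm_eq_abs, Real.norm_eq_abs, abs_of_pos hα]
    push_cast
    rw [abs_mul, abs_of_nonneg (by positivity)]
    have h1 := pow_le_fac (j+T) k
    have h2 := hb (j+T)
    have h3 : ((2*T)! : ℝ) * j ! ≤ (2*(j+T))! := by
      have a1 : (2*T)! * (2*j)! ≤ (2*T+2*j)! := Nat.le_of_dvd (by positivity) (Nat.factorial_mul_factorial_dvd_factorial_add _ _)
      have a2 : j ! ≤ (2*j)! := Nat.factorial_le (by omega)
      have a3 : (2*T)! * j ! ≤ (2*(j+T))! := by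
        rw [show 2*(j+T) = 2*T+2*j by ring]
        exact (Nat.mul_le_mul_left _ a2).trans a1
      exact_mod_cast a3
    push_cast at h1
    calc _ ≤ (k ! * 3^(j+T)) * ((2*L)! * (C:ℝ)^(L+(j+T)) / (2*(j+T))!) * α^(j+T) := by gcongr
      _ ≤ (k ! * 3^(j+T)) * ((2*L)! * (C:ℝ)^(L+(j+T)) / ((2*T)! * j !)) * α^(j+T) := by gcongr
      _ = _ := by
        have : ((2*T)! : ℝ) ≠ 0 := by positivity
        have : (j ! : ℝ) ≠ 0 := by positivity
        field_simp
        rw [pow_add, pow_add, pow_add, pow_add, mul_pow, mul_pow, mul_pow, mul_pow]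
        ring
  · intro m hm
    rw [eu_iter_coeff _ _ _ (h0 m (mem_range.1 hm))]
    simp
end Bg

namespace Bg
open Finset Filter Topology
open scoped Nat

lemma fac_le_pow' (m M : ℕ) (h : m ≤ M) : (m ! : ℝ) ≤ (M:ℝ)^M := by
  exact_mod_cast (Nat.factorial_le h).trans (Nat.factorial_le_pow M)

theorem transc (n : ℕ) (hn : 1 ≤ n) (α : ℝ) (hα : 0 < α) (halg : IsAlgebraic ℚ α) : phi n α ≠ 0 := by
  intro hφ
  obtain ⟨d, C1, hC1, hl⟩ := liouville α halg
  set N := 5*d+5 with hN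
  obtain ⟨C, hC, hs⟩ := siegel N n (by omega)
  obtain ⟨c, hze⟩ := ZE_all n hn N α hα hφ
  have hψ := psi_ne_zero n α hα.ne' hφ
  set b : ℕ := 8 + N * n + 4 * N with hb
  set E := Real.exp (3*C*α) with hE
  set c7 : ℝ := 8*27*4*C*(3*C*α)^N*(4*C*b^3*C1^4)^d with hc7
  have hCr : (1:ℝ) ≤ C := by exact_mod_cast hC
  have hbr : (1:ℝ) ≤ b := by exact_mod_cast (by omega : 1 ≤ b)
  have hc7p : 0 < c7 := by positivity
  have main : ∀ L : ℕ, 1 ≤ L → c ≤ L → |psi n α|^N * (L:ℝ)^L ≤ E * c7^L := by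
    intro L hL hcL
    obtain ⟨p, hp0, hpd, hpN, hpc, hpv, hpr⟩ := hs L hL
    obtain ⟨k, hk, hne⟩ := hze L hL p hp0 hpd hpv
    have hk3 : k ≤ 3*L := by omega
    have hLr : (1:ℝ) ≤ L := by exact_mod_cast hL
    set q := (Dt N n)^[k] p with hq
    have hval : (q 0).eval₂ (Int.castRingHom ℝ) α * psi n α ^ N = 2^k * ev (eu^[k] (Rs N n p)) α := by
      rw [← ev_two_pow (ent_eu_iter (Rs_ent N n p).1 _), ← Rs_iter, (Rs_ent N n _).2, fev, sum_eq_single 0]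
      · simp [psi, hq]
      · intro i _ hi
        rw [hφ, zero_pow hi]; simp
      · simp
    have hq0 : (q 0).eval₂ (Int.castRingHom ℝ) α ≠ 0 := by
      intro h
      rw [h, zero_mul] at hval
      exact mul_ne_zero (by positivity) hne hval.symm
    have hqd : (q 0).natDegree ≤ 4*L := (Dt_iter_deg N n p L hpd k 0).trans (by omega)
    have hBL : (2 * ((L:ℝ) + (3*L:ℕ)) + N * n + 4 * N) ≤ b * L := by
      rw [hb]; push_cast
      have : (0:ℝ) ≤ N * n + 4 * N := by positivity
      nlinarith
    have hfac2 : ((2*L)! : ℝ) ≤ 4^L * (L:ℝ)^(2*L) := by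
      refine (fac_le_pow' _ _ le_rfl).trans (le_of_eq ?_)
      push_cast
      rw [mul_pow, pow_mul 2 2]; norm_num
    set H : ℝ := (4*C*b^3)^L * (L:ℝ)^(5*L) with hH
    have hqc : ∀ j, |(((q 0).coeff j : ℤ) : ℝ)| ≤ H := by
      intro j
      have h1 := Dt_iter_bnd N n L (3*L) _ p hpd hpc k hk3 0 j
      have h2 : |(((q 0).coeff j : ℤ) : ℝ)| ≤ (2 * ((L:ℝ) + (3*L:ℕ)) + N * n + 4 * N)^k * ((2*L)! * (C:ℝ)^L) := by
        rw [hq]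
        exact_mod_cast h1
      refine h2.trans ?_
      have hbL : (1:ℝ) ≤ b * L := by nlinarith
      calc _ ≤ ((b:ℝ) * L)^k * ((4^L * (L:ℝ)^(2*L)) * (C:ℝ)^L) := by gcongr
        _ ≤ ((b:ℝ) * L)^(3*L) * ((4^L * (L:ℝ)^(2*L)) * (C:ℝ)^L) := by gcongr
        _ = H := by
          rw [hH, mul_pow, mul_pow, mul_pow, ← pow_mul (b:ℝ), show 5*L = 3*L+2*L by ring, pow_add]; ring
    have hH1 : 1 ≤ H := by
      rw [hH]
      have : (1:ℝ) ≤ b^3 := one_le_pow₀ hbr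
      have : (1:ℝ) ≤ 4*C*b^3 := by nlinarith
      exact one_le_mul_of_one_le_of_one_le (one_le_pow₀ this) (one_le_pow₀ hLr)
    have low := hl (q 0) (4*L) H hH1 hqd hqc hq0
    have up := rem_bound (Rs N n p) (Rs_ent N n p).1 L N C k α hα hpv hpr
    have hX : (C1^(4*L) * H)^d = ((4*C*b^3*C1^4)^d)^L * (L:ℝ)^(5*d*L) := by
      rw [hH, mul_pow, mul_pow, ← pow_mul, ← pow_mul, ← pow_mul, ← pow_mul, mul_pow (4*C*b^3:ℝ), ← pow_mul C1]
      rw [show L * d = d * L by ring, show 4 * (d*L) = 4*L*d by ring, show 5*L*d = 5*d*L by ring]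
      ring
    have hfacN : (L:ℝ)^((10*d+9)*L) ≤ (2*(N*L))! := by
      have h1 : L ! * (L+1)^((10*d+9)*L) ≤ (L + (10*d+9)*L)! := Nat.factorial_mul_pow_le_factorial
      have h2 : L + (10*d+9)*L = 2*(N*L) := by rw [hN]; ring
      rw [h2] at h1
      have h3 : L^((10*d+9)*L) ≤ L ! * (L+1)^((10*d+9)*L) := by
        have := Nat.factorial_pos L
        calc L^((10*d+9)*L) ≤ (L+1)^((10*d+9)*L) := Nat.pow_le_pow_left (by omega) _
          _ ≤ _ := Nat.le_mul_of_pos_left _ this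
      exact_mod_cast h3.trans h1
    have hfk : (k ! : ℝ) ≤ 27^L * (L:ℝ)^(3*L) := by
      refine (fac_le_pow' _ _ hk3).trans (le_of_eq ?_)
      push_cast
      rw [mul_pow, pow_mul 3 3]; norm_num
    have h2k : (2:ℝ)^k ≤ 8^L := by
      calc (2:ℝ)^k ≤ 2^(3*L) := pow_le_pow_right₀ (by norm_num) hk3
        _ = 8^L := by rw [pow_mul]; norm_num
    have hval2 : |(q 0).eval₂ (Int.castRingHom ℝ) α| * |psi n α|^N = 2^k * |ev (eu^[k] (Rs N n p)) α| := by
      rw [← abs_pow, ← abs_mul, hval, abs_mul, abs_of_pos (by positivity)]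
    have step : |psi n α|^N ≤ (8^L * (27^L * (L:ℝ)^(3*L) * (4^L * (L:ℝ)^(2*L)) * (C:ℝ)^L * (3*C*α)^(N*L) / (L:ℝ)^((10*d+9)*L) * E))
        * (((4*C*b^3*C1^4)^d)^L * (L:ℝ)^(5*d*L)) := by
      calc |psi n α|^N ≤ |psi n α|^N * (|(q 0).eval₂ (Int.castRingHom ℝ) α| * (C1^(4*L) * H)^d) :=
            le_mul_of_one_le_right (by positivity) low
        _ = (2^k * |ev (eu^[k] (Rs N n p)) α|) * (((4*C*b^3*C1^4)^d)^L * (L:ℝ)^(5*d*L)) := by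
            rw [← hval2, hX]; ring
        _ ≤ (8^L * (k ! * (2*L)! * (C:ℝ)^L * (3*C*α)^(N*L) / (2*(N*L))! * E)) * (((4*C*b^3*C1^4)^d)^L * (L:ℝ)^(5*d*L)) := by
            gcongr
        _ ≤ _ := by gcongr
    have e1 : (8^L * (27^L * (L:ℝ)^(3*L) * (4^L * (L:ℝ)^(2*L)) * (C:ℝ)^L * (3*C*α)^(N*L) / (L:ℝ)^((10*d+9)*L) * E))
        * (((4*C*b^3*C1^4)^d)^L * (L:ℝ)^(5*d*L)) = E * c7^L / (L:ℝ)^((5*d+4)*L) := by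
      have hL0 : (L:ℝ) ≠ 0 := by positivity
      rw [hc7, mul_pow _ ((4*C*b^3*C1^4)^d) L, mul_pow _ ((3*C*α)^N) L, mul_pow _ (C:ℝ) L, mul_pow _ (4:ℝ) L, mul_pow (8:ℝ),
        ← pow_mul (3*C*α) N L]
      generalize ((4*C*b^3*C1^4)^d : ℝ)^L = Y
      generalize (3*C*α)^(N*L) = Z
      rw [show (10*d+9)*L = (5*d+4)*L + 5*d*L + 3*L + 2*L by ring, pow_add, pow_add, pow_add]
      field_simp
    rw [e1, le_div_iff₀ (by positivity)] at step
    refine le_trans ?_ step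
    gcongr
    nlinarith
  obtain ⟨L, hL⟩ := exists_nat_gt (max (max (1:ℝ) c) (max (2*c7) (E / |psi n α|^N)))
  have hL1 : (1:ℝ) < L := lt_of_le_of_lt (by simp) hL
  have hL2 : (c:ℝ) < L := lt_of_le_of_lt (by simp) hL
  have hL3 : 2*c7 < L := lt_of_le_of_lt (by simp) hL
  have hL4 : E / |psi n α|^N < L := lt_of_le_of_lt (by simp) hL
  have hm := main L (by exact_mod_cast hL1.le) (by exact_mod_cast hL2.le)
  have hψp : 0 < |psi n α|^N := by positivity
  have h5 : (2*c7)^L ≤ (L:ℝ)^L := by gcongr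
  rw [mul_pow] at h5
  have h6 : |psi n α|^N * 2^L * c7^L ≤ E * c7^L := by
    refine le_trans ?_ hm
    rw [mul_assoc]; gcongr
  have h7 : |psi n α|^N * 2^L ≤ E := le_of_mul_le_mul_right h6 (by positivity)
  rw [div_lt_iff₀ hψp] at hL4
  have h8 : (L:ℝ) < 2^L := by exact_mod_cast Nat.lt_two_pow_self
  nlinarith
end Bg

namespace Bg
open Finset Filter Topology
open scoped Nat

lemma phi_three (m : ℕ) (t : ℝ) : t * phi (m+4) t = ((m:ℝ)/2+1) * ((m:ℝ)/2+2) * (phi (m+2) t - phi m t) := by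
  have e1 := psi_next (m+2) t
  have hca : ∀ k, 2 * ca (m+2) k * k = (m+2) * (ca m k - ca (m+2) k) := by
    intro k
    induction k with
    | zero => simp [ca]
    | succ k ih =>
      rw [ca.eq_2 m k, ca.eq_2 (m+2) k]
      have h1 : (k:ℚ) + 1 ≠ 0 := by positivity
      have h2 : (m:ℚ) + 2 * k + 2 ≠ 0 := by positivity
      have h3 : ((m+2:ℕ):ℚ) + 2 * k + 2 ≠ 0 := by positivity
      have hrel : ca m k = ca (m+2) k * (m + 2 + 2*k) / (m+2) := by
        have : (m:ℚ) + 2 ≠ 0 := by positivity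
        field_simp
        linear_combination -ih
      rw [hrel]
      push_cast at *
      field_simp
      ring
  have hs : ∀ n, Summable fun k => ((PowerSeries.coeff k (Ph n) : ℚ) : ℝ) * t ^ k := fun n => (Ph_ent n).norm t |>.of_norm
  have e2 : 2 * psi (m+2) t = (m+2) * (phi m t - phi (m+2) t) := by
    rw [psi, phi, phi, ev, ev, ev, ← (hs m).tsum_sub (hs (m+2)), ← tsum_mul_left, ← tsum_mul_left]
    congr 1; ext k
    have := congrArg (fun q : ℚ => (q : ℝ)) (hca k)
    simp only [Ps, coeff_eu, Ph, PowerSeries.coeff_mk] at this ⊢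
    push_cast at this ⊢
    linear_combination t^k * this
  rw [show m + 4 = m+2+2 by ring, e1]
  push_cast
  linear_combination (-((m:ℝ)/2+1+1)/2) * e2

lemma bourget_aux (n : ℕ) (t : ℝ) (h0 : phi n t = 0) (j : ℕ) : ∃ s s' : Polynomial ℚ, s.coeff 0 ≠ 0 ∧ s'.coeff 0 ≠ 0 ∧
    t^j * phi (n+2*j+2) t = Polynomial.aeval t s * phi (n+2) t ∧
    t^(j+1) * phi (n+2*j+4) t = Polynomial.aeval t s' * phi (n+2) t := by
  induction j with
  | zero =>
    refine ⟨1, Polynomial.C (((n:ℚ)/2+1) * ((n:ℚ)/2+2)), by simp, ?_, by simp, ?_⟩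
    · rw [Polynomial.coeff_C_zero]; positivity
    · have := phi_three n t
      rw [h0] at this
      simp only [Polynomial.aeval_C, eq_ratCast]
      push_cast
      simp only [zero_add, pow_one, mul_zero, add_zero]
      linear_combination this
  | succ j ih =>
    obtain ⟨s, s', hs, hs', e, e'⟩ := ih
    refine ⟨s', Polynomial.C ((((n+2*j+2:ℕ):ℚ)/2+1) * (((n+2*j+2:ℕ):ℚ)/2+2)) * (s' - Polynomial.X * s), hs', ?_, ?_, ?_⟩
    · rw [Polynomial.coeff_C_mul, Polynomial.coeff_sub, Polynomial.mul_coeff_zero, Polynomial.coeff_X_zero, zero_mul, sub_zero]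
      have : (((n+2*j+2:ℕ):ℚ)/2+1) * (((n+2*j+2:ℕ):ℚ)/2+2) ≠ 0 := by positivity
      exact mul_ne_zero this hs'
    · rw [← e']; congr 2
    · have := phi_three (n+2*j+2) t
      rw [show n + 2*(j+1) + 4 = n+2*j+2+4 by ring]
      rw [show n+2*j+2+2 = n+2*j+4 by ring] at this
      simp only [map_mul, map_sub, Polynomial.aeval_C, Polynomial.aeval_X, eq_ratCast]
      push_cast at this ⊢
      set c := (((n:ℝ) + 2*j+2)/2+1) * (((n:ℝ) + 2*j+2)/2+2)
      rw [pow_succ]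
      linear_combination t^(j+1) * this + c * e' - c * t * e

theorem bourget_up (n : ℕ) (hn : 1 ≤ n) (t : ℝ) (ht : 0 < t) (h0 : phi n t = 0) (j : ℕ) : phi (n+2*j+2) t ≠ 0 := by
  intro hj
  obtain ⟨s, -, hs, -, e, -⟩ := bourget_aux n t h0 j
  rw [hj, mul_zero] at e
  have h2 : phi (n+2) t ≠ 0 := by
    intro h
    have := psi_next n t
    rw [h, mul_zero] at this
    have hp := psi_ne_zero n t ht.ne' h0
    have hpos : (0:ℝ) < (n:ℝ)/2+1 := by positivity
    exact mul_ne_zero (by linarith : (-((n:ℝ)/2+1)) ≠ 0) hp this.symm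
  have h3 : Polynomial.aeval t s = 0 := by
    rcases mul_eq_zero.1 e.symm with h | h
    · exact h
    · exact absurd h h2
  exact transc n hn t ht ⟨s, fun h => hs (by rw [h]; simp), h3⟩ h0

theorem bourget_down (m : ℕ) (t : ℝ) (ht : 0 < t) (h0 : phi (m+2) t = 0) : phi m t ≠ 0 := by
  intro h
  have := psi_next m t
  rw [h0, mul_zero] at this
  have hp := psi_ne_zero m t ht.ne' h
  have hpos : (0:ℝ) < (m:ℝ)/2+1 := by positivity
  exact mul_ne_zero (by linarith : (-((m:ℝ)/2+1)) ≠ 0) hp this.symm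

/-- all the other Bessel functions appearing do not vanish. -/
theorem bourget (n : ℕ) (hn : 2 ≤ n) (t : ℝ) (ht : 0 < t) (h0 : phi n t = 0) (l : ℕ) (hl : l ≠ 1) : phi (n-2+2*l) t ≠ 0 := by
  obtain ⟨m, rfl⟩ := Nat.exists_eq_add_of_le' hn
  rw [Nat.add_sub_cancel]
  rcases l with _ | _ | l
  · exact bourget_down m t ht h0
  · exact absurd rfl hl
  · have := bourget_up (m+2) (by omega) t ht h0 l
    rwa [show m + 2*(l+1+1) = m+2+2*l+2 by ring]
end Bg

namespace Bg
open MeasureTheory Metric Set Filter Topology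
open scoped RealInnerProductSpace NNReal ENNReal

/-- surface measure on the sphere -/
noncomputable def sph (n : ℕ) (R : ℝ) : Measure (EuclideanSpace ℝ (Fin n)) :=
  (μH[(n : ℝ) - 1]).restrict (sphere (0 : EuclideanSpace ℝ (Fin n)) R)

lemma radial_lip {V : Type*} [NormedAddCommGroup V] [NormedSpace ℝ V] (R : ℝ) (hR : 0 < R) :
    LipschitzOnWith 2 (fun x : V => (R / ‖x‖) • x) {x | R ≤ ‖x‖} := by
  apply LipschitzOnWith.of_dist_le_mul
  intro x hx y hy
  change R ≤ ‖x‖ at hx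
  change R ≤ ‖y‖ at hy
  have hx0 : 0 < ‖x‖ := lt_of_lt_of_le hR hx
  have hy0 : 0 < ‖y‖ := lt_of_lt_of_le hR hy
  rw [dist_eq_norm, dist_eq_norm]
  have e : (R / ‖x‖) • x - (R / ‖y‖) • y = (R / ‖x‖) • (x - y) + (R / ‖x‖ - R / ‖y‖) • y := by
    rw [smul_sub, sub_smul]; abel
  have h1 : ‖(R / ‖x‖) • (x - y)‖ ≤ ‖x - y‖ := by
    rw [norm_smul, Real.norm_of_nonneg (by positivity)]
    have : R / ‖x‖ ≤ 1 := by rw [div_le_one hx0]; exact hx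
    nlinarith [norm_nonneg (x - y)]
  have h2 : ‖(R / ‖x‖ - R / ‖y‖) • y‖ ≤ ‖x - y‖ := by
    rw [norm_smul, Real.norm_eq_abs]
    have e2 : R / ‖x‖ - R / ‖y‖ = (R / ‖x‖) * (‖y‖ - ‖x‖) / ‖y‖ := by field_simp
    rw [e2, abs_div, abs_of_pos hy0, div_mul_cancel₀ _ hy0.ne', abs_mul, abs_of_pos (by positivity)]
    have : R / ‖x‖ ≤ 1 := by rw [div_le_one hx0]; exact hx
    have h3 : |‖y‖ - ‖x‖| ≤ ‖x - y‖ := by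
      rw [abs_sub_comm]; exact abs_norm_sub_norm_le x y
    nlinarith [abs_nonneg (‖y‖ - ‖x‖)]
  rw [e]
  refine (norm_add_le _ _).trans ?_
  simp only [NNReal.coe_ofNat]
  linarith

lemma sph_fin_succ (m : ℕ) (R : ℝ) (hR : 0 < R) :
    μH[(m : ℝ)] (sphere (0 : EuclideanSpace ℝ (Fin (m+1))) R) < ⊤ := by
  let F : Fin (m+1) × Bool → (Fin m → ℝ) → EuclideanSpace ℝ (Fin (m+1)) := fun p y =>
    WithLp.toLp 2 (Fin.insertNth (α := fun _ => ℝ) p.1 (if p.2 then R else -R) y)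
  let f : EuclideanSpace ℝ (Fin (m+1)) → EuclideanSpace ℝ (Fin (m+1)) := fun x => (R / ‖x‖) • x
  have hFlip : ∀ p, ∃ K : ℝ≥0, LipschitzWith K (F p) := by
    intro p
    have h1 := PiLp.lipschitzWith_toLp (p := 2) (fun _ : Fin (m+1) => ℝ)
    have h2 : LipschitzWith 1 (fun y : Fin m → ℝ =>
        (Fin.insertNth (α := fun _ => ℝ) p.1 (if p.2 then R else -R) y : Fin (m+1) → ℝ)) := by
      apply LipschitzWith.of_dist_le_mul
      intro x y
      simp only [NNReal.coe_one, one_mul]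
      rw [dist_pi_le_iff dist_nonneg]
      intro j
      refine Fin.succAboveCases p.1 ?_ ?_ j
      · simp
      · intro i; simp only [Fin.insertNth_apply_succAbove]; exact dist_le_pi_dist x y i
    exact ⟨_, h1.comp h2⟩
  have hnorm : ∀ p y, R ≤ ‖F p y‖ := by
    intro p y
    have h := PiLp.norm_apply_le (F p y) p.1
    have : ‖(F p y) p.1‖ = R := by
      simp only [F, Fin.insertNth_apply_same]
      split_ifs <;> simp [abs_of_pos hR]
    linarith
  have hcov : sphere (0 : EuclideanSpace ℝ (Fin (m+1))) R ⊆
      ⋃ p, (fun y => f (F p y)) '' (Set.pi univ fun _ : Fin m => Icc (-R) R) := by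
    intro w hw
    rw [mem_sphere_zero_iff_norm] at hw
    obtain ⟨i, -, hi⟩ := Finset.exists_max_image (Finset.univ : Finset (Fin (m+1)))
      (fun i => |w i|) ⟨0, Finset.mem_univ _⟩
    have hpos : 0 < |w i| := by
      rcases (abs_nonneg (w i)).lt_or_eq with h | h
      · exact h
      · exfalso
        have : w = 0 := by
          ext j
          have := hi j (Finset.mem_univ _)
          rw [← h] at this
          simpa using this
        rw [this] at hw; simp at hw; exact hR.ne hw
    rw [mem_iUnion]
    refine ⟨(i, decide (0 < w i)), fun j => (R / |w i|) * w (i.succAbove j), ?_, ?_⟩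
    · intro j _
      change _ ∈ Icc (-R) R
      rw [mem_Icc, ← abs_le]
      rw [abs_mul, abs_div, abs_of_pos hR, abs_abs, div_mul_eq_mul_div, div_le_iff₀ hpos]
      exact mul_le_mul_of_nonneg_left (hi _ (Finset.mem_univ _)) hR.le
    · have e : F (i, decide (0 < w i)) (fun j => (R / |w i|) * w (i.succAbove j)) = (R / |w i|) • w := by
        ext j
        simp only [F, PiLp.smul_apply, smul_eq_mul]
        refine Fin.succAboveCases i ?_ ?_ j
        · simp only [Fin.insertNth_apply_same, decide_eq_true_eq]
          split_ifs with h
          · rw [abs_of_pos h]; field_simp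
          · have : w i < 0 := lt_of_le_of_ne (not_lt.mp h) (abs_pos.mp hpos)
            rw [abs_of_neg this, div_neg, neg_mul, div_mul_cancel₀ _ this.ne]
        · intro j; simp only [Fin.insertNth_apply_succAbove]
      simp only [e, f]
      rw [norm_smul, hw, Real.norm_of_nonneg (by positivity), smul_smul]
      have : R / (R / |w i| * R) * (R / |w i|) = 1 := by field_simp
      rw [this, one_smul]
  refine lt_of_le_of_lt (measure_mono hcov) (lt_of_le_of_lt (measure_iUnion_fintype_le _ _) ?_)
  rw [ENNReal.sum_lt_top]
  intro p _
  obtain ⟨K, hK⟩ := hFlip p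
  have hl : LipschitzOnWith (2 * K) (fun y => f (F p y)) (Set.pi univ fun _ : Fin m => Icc (-R) R) :=
    (radial_lip R hR).comp (hK.lipschitzOnWith) (fun y _ => hnorm p y)
  refine lt_of_le_of_lt (hl.hausdorffMeasure_image_le (d := m) (by positivity)) ?_
  have hv : (μH[(m:ℝ)] : Measure (Fin m → ℝ)) = volume := by
    have := hausdorffMeasure_pi_real (ι := Fin m)
    simpa using this
  rw [hv]
  apply ENNReal.mul_lt_top
  · exact ENNReal.rpow_lt_top_of_nonneg (by positivity) ENNReal.coe_ne_top
  · exact (isCompact_univ_pi fun _ => isCompact_Icc).measure_lt_top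

lemma sph_pos_succ (m : ℕ) (R : ℝ) (hR : 0 < R) :
    0 < μH[(m : ℝ)] (sphere (0 : EuclideanSpace ℝ (Fin (m+1))) R) := by
  let P : EuclideanSpace ℝ (Fin (m+1)) → (Fin m → ℝ) := fun x j => x j.succ
  have hP : LipschitzWith 1 P := by
    apply LipschitzWith.of_dist_le_mul
    intro x y
    simp only [NNReal.coe_one, one_mul]
    rw [dist_pi_le_iff dist_nonneg]
    intro j
    rw [dist_eq_norm x y]
    have := PiLp.norm_apply_le (x - y) j.succ
    simpa [P, dist_eq_norm] using this
  have hv : (μH[(m:ℝ)] : Measure (Fin m → ℝ)) = volume := by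
    have := hausdorffMeasure_pi_real (ι := Fin m)
    simpa using this
  have h1 := hP.hausdorffMeasure_image_le (d := m) (by positivity)
    (sphere (0 : EuclideanSpace ℝ (Fin (m+1))) R)
  simp only [ENNReal.coe_one, ENNReal.one_rpow, one_mul] at h1
  refine lt_of_lt_of_le ?_ h1
  rw [hv]
  have hsub : ball (0 : Fin m → ℝ) (R / (m+1)) ⊆ P '' (sphere (0 : EuclideanSpace ℝ (Fin (m+1))) R) := by
    intro y hy
    rw [mem_ball_zero_iff] at hy
    have hs : ∑ j, (y j)^2 ≤ R^2 := by
      have h3 : ∀ j, (y j)^2 ≤ (R/(m+1))^2 := by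
        intro j
        have := (norm_le_pi_norm y j).trans hy.le
        rw [Real.norm_eq_abs] at this
        exact sq_le_sq' (by linarith [neg_abs_le (y j)]) (by linarith [le_abs_self (y j)])
      calc ∑ j, (y j)^2 ≤ ∑ j : Fin m, (R/(m+1))^2 := Finset.sum_le_sum fun j _ => h3 j
        _ = m * (R/(m+1))^2 := by simp
        _ ≤ R^2 := by
          rw [div_pow, ← mul_div_assoc, div_le_iff₀ (by positivity)]
          have : (m:ℝ) ≤ (m+1)^2 := by nlinarith [(Nat.cast_nonneg m : (0:ℝ) ≤ m)]
          nlinarith [sq_nonneg R]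
    refine ⟨WithLp.toLp 2 (Fin.cons (Real.sqrt (R^2 - ∑ j, (y j)^2)) y), ?_, ?_⟩
    · rw [mem_sphere_zero_iff_norm, EuclideanSpace.norm_eq, Fin.sum_univ_succ]
      simp only [Fin.cons_zero, Fin.cons_succ, Real.norm_eq_abs, sq_abs]
      rw [Real.sq_sqrt (by linarith), sub_add_cancel, Real.sqrt_sq hR.le]
    · ext j; simp [P]
  exact lt_of_lt_of_le (measure_ball_pos _ _ (by positivity)) (measure_mono hsub)

variable {n : ℕ}

/-- continuous functions are integrable for finite measures with bounded support -/
lemma cint {V F : Type*} [NormedAddCommGroup V] [ProperSpace V] [MeasurableSpace V] [BorelSpace V]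
    [SecondCountableTopology V]
    [NormedAddCommGroup F] {τ : Measure V} [IsFiniteMeasure τ] {R : ℝ}
    (hτ : ∀ᵐ x ∂τ, ‖x‖ ≤ R) {f : V → F} (hf : Continuous f) : Integrable f τ := by
  obtain ⟨C, hC⟩ := (isCompact_closedBall (0 : V) R).exists_bound_of_continuousOn hf.continuousOn
  refine Integrable.of_bound hf.aestronglyMeasurable C ?_
  filter_upwards [hτ] with x hx
  exact hC x (by simpa using hx)

lemma sph_finite (hn : 2 ≤ n) {R : ℝ} (hR : 0 < R) : IsFiniteMeasure (sph n R) := by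
  obtain ⟨m, rfl⟩ : ∃ m, n = m + 1 := ⟨n - 1, by omega⟩
  refine ⟨?_⟩
  have := sph_fin_succ m R hR
  simpa [sph] using this

lemma sph_ne_zero (hn : 2 ≤ n) {R : ℝ} (hR : 0 < R) : sph n R ≠ 0 := by
  obtain ⟨m, rfl⟩ : ∃ m, n = m + 1 := ⟨n - 1, by omega⟩
  have := sph_pos_succ m R hR
  intro h
  rw [sph, Measure.restrict_eq_zero] at h
  simp at h
  exact this.ne' h

lemma sph_inv (R : ℝ) (e : EuclideanSpace ℝ (Fin n) ≃ₗᵢ[ℝ] EuclideanSpace ℝ (Fin n)) :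
    MeasurePreserving e (sph n R) (sph n R) := by
  have h := (e.toIsometryEquiv.measurePreserving_hausdorffMeasure ((n:ℝ)-1)).restrict_preimage
    (s := sphere (0 : EuclideanSpace ℝ (Fin n)) R) isClosed_sphere.measurableSet
  have e2 : (e.toIsometryEquiv ⁻¹' sphere (0 : EuclideanSpace ℝ (Fin n)) R) = sphere 0 R := by
    ext x; simp
  rw [e2] at h
  exact h

lemma sph_ae (R : ℝ) : ∀ᵐ x ∂(sph n R), ‖x‖ = R := by
  have := ae_restrict_mem (μ := (μH[(n : ℝ) - 1])) (isClosed_sphere (x := (0 : EuclideanSpace ℝ (Fin n))) (ε := R)).measurableSet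
  filter_upwards [this] with x hx
  simpa using hx

/-- transitivity of the orthogonal group on spheres -/
lemma exists_isom {x y : EuclideanSpace ℝ (Fin n)} (h : ‖x‖ = ‖y‖) :
    ∃ e : EuclideanSpace ℝ (Fin n) ≃ₗᵢ[ℝ] EuclideanSpace ℝ (Fin n), e x = y :=
  ⟨_, Submodule.reflection_sub h⟩

lemma sph_full (hn : 2 ≤ n) {R : ℝ} (hR : 0 < R) {f : EuclideanSpace ℝ (Fin n) → ℝ} (hf : Continuous f)
    (h0 : ∫ x, (f x)^2 ∂(sph n R) = 0) : ∀ x, ‖x‖ = R → f x = 0 := by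
  have := sph_finite hn hR
  have hintg : Integrable (fun x => (f x)^2) (sph n R) :=
    cint ((sph_ae R).mono fun x hx => hx.le) (hf.pow 2)
  rw [integral_eq_zero_iff_of_nonneg (fun x => sq_nonneg _) hintg] at h0
  by_contra hcon
  push Not at hcon
  obtain ⟨x0, hx0, hfx⟩ := hcon
  apply sph_ne_zero hn hR
  have hU : sph n R {x | f x ≠ 0} = 0 := by
    have : ∀ᵐ x ∂(sph n R), f x = 0 := by
      filter_upwards [h0] with x hx
      simpa using hx
    exact this
  have hUo : IsOpen {x | f x ≠ 0} := isOpen_ne_fun hf continuous_const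
  have : sph n R (sphere 0 R) = 0 := by
    apply measure_null_of_locally_null
    intro x hx
    obtain ⟨e, he⟩ := exists_isom (x := x) (y := x0) (by rw [hx0]; simpa using hx)
    refine ⟨e ⁻¹' {x | f x ≠ 0}, ?_, ?_⟩
    · apply mem_nhdsWithin_of_mem_nhds
      apply (hUo.preimage e.continuous).mem_nhds
      simp [he, hfx]
    · rw [(sph_inv R e).measure_preimage hUo.measurableSet.nullMeasurableSet, hU]
  rw [sph, Measure.restrict_apply_self] at this
  rw [sph, Measure.restrict_eq_zero, this]

end Bg

namespace Bg
open MeasureTheory Metric Set Filter Topology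
open scoped RealInnerProductSpace NNReal ENNReal ComplexConjugate ContDiff

variable {n : ℕ}

/-- copy of the kernel hypothesis -/
def PDK (g : EuclideanSpace ℝ (Fin n) → ℝ) : Prop :=
  Continuous g ∧
  (∀ x y, ‖x‖ = ‖y‖ → g x = g y) ∧
  ∀ μ : EuclideanSpace ℝ (Fin n) → ℂ, ContDiff ℝ (⊤ : ℕ∞) μ → HasCompactSupport μ →
    (∫ x, ∫ y, (g (x - y) : ℂ) * μ x * (starRingEnd ℂ) (μ y)).im = 0 ∧
    0 ≤ (∫ x, ∫ y, (g (x - y) : ℂ) * μ x * (starRingEnd ℂ) (μ y)).re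

lemma avg {V : Type*} [NormedAddCommGroup V] [MeasurableSpace V] [BorelSpace V] {τ : Measure V}
    [IsFiniteMeasureOnCompacts τ]
    {k G : V → ℝ} (hk : Continuous k) (hG : Continuous G) (hc : HasCompactSupport G)
    (hpos : ∀ y, 0 ≤ G y) (h1 : ∫ y, G y ∂τ = 1) {c δ : ℝ}
    (h : ∀ y, G y ≠ 0 → |k y - c| ≤ δ) : |(∫ y, k y * G y ∂τ) - c| ≤ δ := by
  have i1 : Integrable G τ := hG.integrable_of_hasCompactSupport hc
  have i2 : Integrable (fun y => k y * G y) τ :=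
    (hk.mul hG).integrable_of_hasCompactSupport (hc.mul_left)
  have e : ∫ y, k y * G y ∂τ - c = ∫ y, (k y - c) * G y ∂τ := by
    have : c = ∫ y, c * G y ∂τ := by rw [integral_const_mul, h1, mul_one]
    conv_lhs => rw [this]
    rw [← integral_sub i2 (i1.const_mul c)]
    congr 1; ext y; ring
  rw [e, ← Real.norm_eq_abs]
  have : δ = ∫ y, δ * G y ∂τ := by rw [integral_const_mul, h1, mul_one]
  rw [this]
  apply norm_integral_le_of_norm_le (i1.const_mul δ)
  filter_upwards with y
  rw [norm_mul, Real.norm_eq_abs, Real.norm_of_nonneg (hpos y)]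
  by_cases hy : G y = 0
  · simp [hy]
  · exact mul_le_mul_of_nonneg_right (h y hy) (hpos y)

lemma conv_cont {g G : EuclideanSpace ℝ (Fin n) → ℝ} (hg : Continuous g) (hG : Continuous G)
    (hc : HasCompactSupport G) : Continuous fun x => ∫ y, g (x - y) * G y := by
  have := hc.continuous_convolution_left (ContinuousLinearMap.mul ℝ ℝ) hG
    (hg.locallyIntegrable (μ := volume))
  convert this using 2 with x
  simp [convolution_def, mul_comm]

lemma avg2 {g F G : EuclideanSpace ℝ (Fin n) → ℝ} (hg : Continuous g)
    (hF : Continuous F) (hFc : HasCompactSupport F) (hF0 : ∀ y, 0 ≤ F y) (hF1 : ∫ y, F y = 1)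
    (hG : Continuous G) (hGc : HasCompactSupport G) (hG0 : ∀ y, 0 ≤ G y) (hG1 : ∫ y, G y = 1)
    {c δ : ℝ} (h : ∀ x y, F x ≠ 0 → G y ≠ 0 → |g (x - y) - c| ≤ δ) :
    |(∫ x, (∫ y, g (x - y) * G y) * F x) - c| ≤ δ := by
  apply avg (conv_cont hg hG hGc) hF hFc hF0 hF1
  intro x hx
  apply avg (by fun_prop) hG hGc hG0 hG1
  intro y hy
  exact h x y hx hy

lemma pd_bound {g : EuclideanSpace ℝ (Fin n) → ℝ} (hg : PDK g) (z : EuclideanSpace ℝ (Fin n)) :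
    |g z| ≤ g 0 := by
  obtain ⟨hc, hr, hp⟩ := hg
  suffices H : ∀ s : ℝ, s^2 = 1 → ∀ δ > 0, 0 ≤ 2 * (g 0 + δ) + 2 * (s * g z + δ) by
    have h1 : 0 ≤ g 0 + g z := by
      apply le_of_forall_pos_le_add; intro δ hδ
      have := H 1 (by norm_num) (δ/4) (by positivity); linarith
    have h2 : 0 ≤ g 0 - g z := by
      apply le_of_forall_pos_le_add; intro δ hδ
      have := H (-1) (by norm_num) (δ/4) (by positivity); linarith
    rw [abs_le]; constructor <;> linarith
  intro s hs δ hδ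
  have hcont : ∀ w, ∃ ε > 0, ∀ u, ‖u - w‖ < ε → |g u - g w| < δ := by
    intro w
    obtain ⟨ε, hε, h⟩ := Metric.continuous_iff.mp hc w δ hδ
    exact ⟨ε, hε, fun u hu => by simpa [Real.dist_eq] using h u (by rwa [dist_eq_norm])⟩
  obtain ⟨ε1, hε1, H1⟩ := hcont 0
  obtain ⟨ε2, hε2, H2⟩ := hcont z
  obtain ⟨ε3, hε3, H3⟩ := hcont (-z)
  set ε := min ε1 (min ε2 ε3) / 4 with hε
  have hm : 0 < min ε1 (min ε2 ε3) := lt_min hε1 (lt_min hε2 hε3)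
  have hε0 : 0 < ε := by positivity
  have l1 : 2 * ε < ε1 := by have := min_le_left ε1 (min ε2 ε3); linarith
  have l2 : 2 * ε < ε2 := by
    have := (min_le_right ε1 (min ε2 ε3)).trans (min_le_left ε2 ε3); linarith
  have l3 : 2 * ε < ε3 := by
    have := (min_le_right ε1 (min ε2 ε3)).trans (min_le_right ε2 ε3); linarith
  let b : ContDiffBump (0 : EuclideanSpace ℝ (Fin n)) := ⟨ε/2, ε, by positivity, by linarith⟩
  let b' : ContDiffBump (z : EuclideanSpace ℝ (Fin n)) := ⟨ε/2, ε, by positivity, by linarith⟩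
  set F : EuclideanSpace ℝ (Fin n) → ℝ := b.normed volume with hFdef
  set G : EuclideanSpace ℝ (Fin n) → ℝ := b'.normed volume with hGdef
  have Fsm : ContDiff ℝ (⊤:ℕ∞) F := b.contDiff_normed
  have Gsm : ContDiff ℝ (⊤:ℕ∞) G := b'.contDiff_normed
  have Fc : HasCompactSupport F := b.hasCompactSupport_normed
  have Gc : HasCompactSupport G := b'.hasCompactSupport_normed
  have F0 : ∀ y, 0 ≤ F y := fun y => b.nonneg_normed y
  have G0 : ∀ y, 0 ≤ G y := fun y => b'.nonneg_normed y
  have F1 : ∫ y, F y = 1 := b.integral_normed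
  have G1 : ∫ y, G y = 1 := b'.integral_normed
  have Fs : ∀ y, F y ≠ 0 → ‖y‖ < ε := fun y hy => by
    have : y ∈ Function.support F := hy
    rw [hFdef, b.support_normed_eq] at this
    simpa [b] using this
  have Gs : ∀ y, G y ≠ 0 → ‖y - z‖ < ε := fun y hy => by
    have : y ∈ Function.support G := hy
    rw [hGdef, b'.support_normed_eq] at this
    simpa [b', dist_eq_norm] using this
  have key : ∀ (F G : EuclideanSpace ℝ (Fin n) → ℝ), Continuous F → Continuous G →
      HasCompactSupport F → HasCompactSupport G →
      Integrable (fun x => (∫ y, g (x - y) * G y) * F x) := fun F G hF hG hFc hGc =>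
    ((conv_cont hc hG hGc).mul hF).integrable_of_hasCompactSupport hFc.mul_left
  have FF := avg2 hc Fsm.continuous Fc F0 F1 Fsm.continuous Fc F0 F1 (c := g 0) (δ := δ) (by
    intro x y hx hy
    apply (H1 _ _).le
    have := norm_sub_le x y
    rw [sub_zero]; linarith [Fs x hx, Fs y hy])
  have GG := avg2 hc Gsm.continuous Gc G0 G1 Gsm.continuous Gc G0 G1 (c := g 0) (δ := δ) (by
    intro x y hx hy
    apply (H1 _ _).le
    have := norm_sub_le (x - z) (y - z)
    rw [sub_sub_sub_cancel_right] at this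
    rw [sub_zero]; linarith [Gs x hx, Gs y hy])
  have GF := avg2 hc Gsm.continuous Gc G0 G1 Fsm.continuous Fc F0 F1 (c := g z) (δ := δ) (by
    intro x y hx hy
    apply (H2 _ _).le
    have := norm_sub_le (x - z) y
    rw [sub_right_comm] at this
    linarith [Gs x hx, Fs y hy])
  have FG := avg2 hc Fsm.continuous Fc F0 F1 Gsm.continuous Gc G0 G1 (c := g z) (δ := δ) (by
    intro x y hx hy
    have hz : g z = g (-z) := hr _ _ (by simp)
    rw [hz]
    apply (H3 _ _).le
    have := norm_sub_le x (y - z)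
    have e : x - y - -z = x - (y - z) := by abel
    rw [e]
    linarith [Fs x hx, Gs y hy])
  set u : EuclideanSpace ℝ (Fin n) → ℝ := fun x => F x + s * G x with hu
  have usm : ContDiff ℝ (⊤:ℕ∞) u := Fsm.add (contDiff_const.mul Gsm)
  have uc : HasCompactSupport u := Fc.add (Gc.mul_left (f := fun _ => s))
  have hQ := (hp (fun x => (u x : ℂ)) (Complex.ofRealCLM.contDiff.comp usm)
    (uc.comp_left (g := fun r : ℝ => (r:ℂ)) (by simp))).2
  have e0 : (∫ x, ∫ y, (g (x - y) : ℂ) * (u x : ℂ) * (starRingEnd ℂ) (u y : ℂ)).re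
      = ∫ x, (∫ y, g (x - y) * u y) * u x := by
    have : ∀ x, ∫ y, (g (x - y) : ℂ) * (u x : ℂ) * (starRingEnd ℂ) (u y : ℂ)
        = (((∫ y, g (x - y) * u y) * u x : ℝ) : ℂ) := by
      intro x
      rw [← integral_mul_const, ← integral_complex_ofReal]
      congr 1; ext y; simp only [Complex.conj_ofReal]; push_cast; ring
    simp only [this]
    rw [integral_complex_ofReal, Complex.ofReal_re]
  rw [e0] at hQ
  have e1 : ∀ x, ∫ y, g (x - y) * u y = (∫ y, g (x - y) * F y) + s * ∫ y, g (x - y) * G y := by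
    intro x
    rw [← integral_const_mul, ← integral_add]
    · congr 1; ext y; simp only [hu]; ring
    · exact ((hc.comp (by fun_prop)).mul Fsm.continuous).integrable_of_hasCompactSupport Fc.mul_left
    · exact (((hc.comp (by fun_prop)).mul Gsm.continuous).integrable_of_hasCompactSupport Gc.mul_left).const_mul s
  have e2 : ∫ x, (∫ y, g (x - y) * u y) * u x =
      (∫ x, (∫ y, g (x - y) * F y) * F x) + s * (∫ x, (∫ y, g (x - y) * F y) * G x)
      + (s * (∫ x, (∫ y, g (x - y) * G y) * F x) + s^2 * (∫ x, (∫ y, g (x - y) * G y) * G x)) := by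
    rw [← integral_const_mul, ← integral_const_mul, ← integral_const_mul, ← integral_add, ← integral_add,
      ← integral_add]
    · congr 1; ext x; rw [e1]; simp only [hu]; ring
    · exact (key F F Fsm.continuous Fsm.continuous Fc Fc).add ((key G F Gsm.continuous Fsm.continuous Gc Fc).const_mul s)
    · exact ((key F G Fsm.continuous Gsm.continuous Fc Gc).const_mul s).add ((key G G Gsm.continuous Gsm.continuous Gc Gc).const_mul _)
    · exact (key F G Fsm.continuous Gsm.continuous Fc Gc).const_mul s
    · exact (key G G Gsm.continuous Gsm.continuous Gc Gc).const_mul _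
    · exact key F F Fsm.continuous Fsm.continuous Fc Fc
    · exact (key G F Gsm.continuous Fsm.continuous Gc Fc).const_mul s
  rw [e2, hs] at hQ
  rw [abs_le] at FF GG FG GF
  have h01 : (s - 1) * (s + 1) = 0 := by linear_combination hs
  rcases mul_eq_zero.mp h01 with h | h
  · obtain rfl : s = 1 := by linarith
    linarith [FF.1, FF.2, GG.1, GG.2, FG.1, FG.2, GF.1, GF.2]
  · obtain rfl : s = -1 := by linarith
    linarith [FF.1, FF.2, GG.1, GG.2, FG.1, FG.2, GF.1, GF.2]

end Bg

namespace Bg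
open MeasureTheory Metric Set Filter Topology
open scoped RealInnerProductSpace NNReal ENNReal ComplexConjugate ContDiff FourierTransform

variable {n : ℕ}

lemma gint {a : ℝ} (ha : 0 < a) : Integrable fun x : EuclideanSpace ℝ (Fin n) => Real.exp (-a * ‖x‖^2) := by
  have := (GaussianFourier.integrable_cexp_neg_mul_sq_norm_add (V := EuclideanSpace ℝ (Fin n))
    (b := (a:ℂ)) (by simpa using ha) 0 0).norm
  refine this.congr ?_
  filter_upwards with x
  rw [Complex.norm_exp]
  congr 1
  have : (-(a:ℂ) * (‖x‖:ℂ)^2 + 0 * ((⟪(0:EuclideanSpace ℝ (Fin n)), x⟫ : ℝ):ℂ)) = ((-a * ‖x‖^2 : ℝ):ℂ) := by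
    push_cast; ring
  rw [this, Complex.ofReal_re]

lemma pd_fourier {g : EuclideanSpace ℝ (Fin n) → ℝ} (hg : PDK g) {a : ℝ} (ha : 0 < a)
    (ξ : EuclideanSpace ℝ (Fin n)) :
    (𝓕 (fun x => (((g x) * Real.exp (-a * ‖x‖^2) : ℝ) : ℂ)) ξ).im = 0 ∧
    0 ≤ (𝓕 (fun x => (((g x) * Real.exp (-a * ‖x‖^2) : ℝ) : ℂ)) ξ).re := by
  have hbd := pd_bound hg
  obtain ⟨hc, hr, hp⟩ := hg
  set ex : EuclideanSpace ℝ (Fin n) → ℂ := fun x => Complex.exp (((-2 * Real.pi * ⟪x, ξ⟫ : ℝ) : ℂ) * Complex.I) with hex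
  have ex_norm : ∀ x, ‖ex x‖ = 1 := fun x => Complex.norm_exp_ofReal_mul_I _
  have ex_sub : ∀ x y, ex x * conj (ex y) = ex (x - y) := by
    intro x y
    simp only [hex]
    rw [← Complex.exp_conj, ← Complex.exp_add]
    congr 1
    rw [inner_sub_left, map_mul, Complex.conj_I, Complex.conj_ofReal]
    push_cast; ring
  have ex_smooth : ContDiff ℝ (⊤:ℕ∞) ex := by
    simp only [hex]
    have h1 : ContDiff ℝ (⊤:ℕ∞) (fun x : EuclideanSpace ℝ (Fin n) => (-2 * Real.pi * ⟪x, ξ⟫ : ℝ)) :=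
      contDiff_const.mul (contDiff_id.inner ℝ contDiff_const)
    exact ((Complex.ofRealCLM.contDiff.comp h1).mul contDiff_const).cexp
  set w : EuclideanSpace ℝ (Fin n) → ℝ := fun x => Real.exp (-(2*a) * ‖x‖^2) with hw
  have w_pos : ∀ x, 0 < w x := fun x => Real.exp_pos _
  have w_smooth : ContDiff ℝ (⊤:ℕ∞) w := (contDiff_const.mul (contDiff_norm_sq ℝ)).exp
  have w_int : Integrable w := gint (by positivity)
  set K : EuclideanSpace ℝ (Fin n) → ℂ := fun u => (g u : ℂ) * ex u with hK
  have K_cont : Continuous K := (Complex.continuous_ofReal.comp hc).mul ex_smooth.continuous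
  have K_bd : ∀ u, ‖K u‖ ≤ g 0 := fun u => by
    simp only [hK]; rw [norm_mul, ex_norm, mul_one, Complex.norm_real]; exact hbd u
  have hg0 : 0 ≤ g 0 := (norm_nonneg _).trans (K_bd 0)
  let b : ℕ → ContDiffBump (0 : EuclideanSpace ℝ (Fin n)) := fun j => ⟨j + 1, j + 2, by positivity, by linarith⟩
  let Hj : ℕ → (EuclideanSpace ℝ (Fin n)) × (EuclideanSpace ℝ (Fin n)) → ℂ := fun j p =>
    K (p.1 - p.2) * ((b j p.1 * w p.1 : ℝ) : ℂ) * ((b j p.2 * w p.2 : ℝ) : ℂ)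
  let H : (EuclideanSpace ℝ (Fin n)) × (EuclideanSpace ℝ (Fin n)) → ℂ := fun p =>
    K (p.1 - p.2) * ((w p.1 : ℝ) : ℂ) * ((w p.2 : ℝ) : ℂ)
  let bd : (EuclideanSpace ℝ (Fin n)) × (EuclideanSpace ℝ (Fin n)) → ℝ := fun p =>
    g 0 * (w p.1 * w p.2)
  have bd_int : Integrable bd (volume.prod volume) := (w_int.mul_prod w_int).const_mul _
  have Hj_cont : ∀ j, Continuous (Hj j) := by
    intro j
    have h1 := (b j).continuous
    have h2 := w_smooth.continuous
    fun_prop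
  have H_cont : Continuous H := by
    have h2 := w_smooth.continuous
    fun_prop
  have Hj_bd : ∀ j p, ‖Hj j p‖ ≤ bd p := by
    intro j p
    simp only [Hj, bd]
    rw [norm_mul, norm_mul, Complex.norm_real, Complex.norm_real, mul_assoc]
    have k1 : ∀ x, ‖b j x * w x‖ ≤ w x := by
      intro x
      rw [norm_mul, Real.norm_of_nonneg (b j).nonneg, Real.norm_of_nonneg (w_pos x).le]
      nlinarith [(b j).le_one (x := x), w_pos x]
    exact mul_le_mul (K_bd _) (mul_le_mul (k1 _) (k1 _) (norm_nonneg _) (w_pos _).le) (by positivity) hg0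
  have H_bd : ∀ p, ‖H p‖ ≤ bd p := by
    intro p
    simp only [H, bd]
    rw [norm_mul, norm_mul, Complex.norm_real, Complex.norm_real, mul_assoc,
      Real.norm_of_nonneg (w_pos _).le, Real.norm_of_nonneg (w_pos _).le]
    exact mul_le_mul_of_nonneg_right (K_bd _) (mul_pos (w_pos _) (w_pos _)).le
  have H_int : Integrable H (volume.prod volume) := bd_int.mono' H_cont.aestronglyMeasurable (ae_of_all _ H_bd)
  have Hj_int : ∀ j, Integrable (Hj j) (volume.prod volume) := fun j =>
    bd_int.mono' (Hj_cont j).aestronglyMeasurable (ae_of_all _ (Hj_bd j))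
  have hlim : Tendsto (fun j => ∫ p, Hj j p ∂(volume.prod volume)) atTop (𝓝 (∫ p, H p ∂(volume.prod volume))) := by
    apply tendsto_integral_of_dominated_convergence bd (fun j => (Hj_cont j).aestronglyMeasurable) bd_int
      (fun j => ae_of_all _ (Hj_bd j))
    filter_upwards with p
    apply tendsto_const_nhds.congr'
    obtain ⟨N, hN⟩ := exists_nat_ge (max ‖p.1‖ ‖p.2‖)
    filter_upwards [eventually_ge_atTop N] with j hj
    have hj' : (N:ℝ) ≤ j := by exact_mod_cast hj
    have o : ∀ x : EuclideanSpace ℝ (Fin n), ‖x‖ ≤ N → b j x = 1 := by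
      intro x hx
      apply (b j).one_of_mem_closedBall
      simp only [b, mem_closedBall, dist_zero_right]
      linarith
    simp only [H, Hj]
    rw [o _ ((le_max_left _ _).trans hN), o _ ((le_max_right _ _).trans hN), one_mul, one_mul]
  have hpos : ∀ j, (∫ p, Hj j p ∂(volume.prod volume)).im = 0 ∧ 0 ≤ (∫ p, Hj j p ∂(volume.prod volume)).re := by
    intro j
    set u : EuclideanSpace ℝ (Fin n) → ℂ := fun x => ((b j x * w x : ℝ) : ℂ) * ex x with hu
    have usm : ContDiff ℝ (⊤:ℕ∞) u :=
      (Complex.ofRealCLM.contDiff.comp ((b j).contDiff.mul w_smooth)).mul ex_smooth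
    have uc : HasCompactSupport u := by
      have := ((b j).hasCompactSupport.mul_right (f' := w)).comp_left (g := fun r : ℝ => (r:ℂ)) (by simp)
      exact this.mul_right
    have := hp u usm uc
    have e : ∫ p, Hj j p ∂(volume.prod volume) = ∫ x, ∫ y, (g (x - y) : ℂ) * u x * (starRingEnd ℂ) (u y) := by
      rw [integral_prod _ (Hj_int j)]
      congr 1; ext x; congr 1; ext y
      simp only [Hj, hK, hu]
      rw [← ex_sub, map_mul, Complex.conj_ofReal]; ring
    rw [e]; exact this
  have hpos' : (∫ p, H p ∂(volume.prod volume)).im = 0 ∧ 0 ≤ (∫ p, H p ∂(volume.prod volume)).re := by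
    constructor
    · have h1 := (Complex.continuous_im.tendsto _).comp hlim
      refine tendsto_nhds_unique h1 (tendsto_const_nhds.congr fun j => ((hpos j).1).symm)
    · have h1 := (Complex.continuous_re.tendsto _).comp hlim
      exact ge_of_tendsto' h1 fun j => (hpos j).2
  set C : ℝ := ∫ y : EuclideanSpace ℝ (Fin n), Real.exp (-(4*a) * ‖y‖^2) with hC
  have C_pos : 0 < C := by
    rw [hC, GaussianFourier.integral_rexp_neg_mul_sq_norm (by positivity)]
    positivity
  have final : ∫ p, H p ∂(volume.prod volume) =
      (C:ℂ) * 𝓕 (fun x => (((g x) * Real.exp (-a * ‖x‖^2) : ℝ) : ℂ)) ξ := by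
    rw [integral_prod_symm _ H_int]
    have s1 : ∀ y, ∫ x, H (x, y) = ∫ u, K u * ((w (u + y) * w y : ℝ) : ℂ) := by
      intro y
      have := integral_sub_right_eq_self (μ := volume) (fun u => K u * ((w (u + y) * w y : ℝ) : ℂ)) y
      rw [← this]
      congr 1; ext x
      simp only [H, sub_add_cancel]; push_cast; ring
    simp only [s1]
    rw [integral_integral_swap]
    · rw [Real.fourier_eq', ← integral_const_mul]
      congr 1; ext u
      rw [integral_const_mul, integral_complex_ofReal]
      have s2 : ∫ y, w (u + y) * w y = Real.exp (-a * ‖u‖^2) * C := by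
        rw [hC, ← integral_const_mul, ← integral_add_right_eq_self (μ := volume) (fun y => Real.exp (-a * ‖u‖^2) * Real.exp (-(4*a) * ‖y‖^2)) ((2:ℝ)⁻¹ • u)]
        congr 1; ext y
        simp only [hw]
        rw [← Real.exp_add, ← Real.exp_add]
        congr 1
        rw [norm_add_sq_real, norm_add_sq_real, norm_smul, inner_smul_right, real_inner_comm]
        simp only [norm_inv, Real.norm_ofNat]; ring
      rw [s2]
      simp only [hK, hex, smul_eq_mul]; push_cast; ring
    · have i1 : Integrable (fun p : (EuclideanSpace ℝ (Fin n)) × (EuclideanSpace ℝ (Fin n)) =>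
          Real.exp (-(2*a) * ‖p.1‖^2 * (1/2)) * (g 0 * Real.exp (-(a/2) * ‖p.2‖^2))) (volume.prod volume) := by
        have j1 : Integrable fun y : EuclideanSpace ℝ (Fin n) => Real.exp (-(2*a) * ‖y‖^2 * (1/2)) := by
          convert gint (n := n) ha using 3; ring
        have j2 : Integrable fun y : EuclideanSpace ℝ (Fin n) => g 0 * Real.exp (-(a/2) * ‖y‖^2) :=
          (gint (by positivity)).const_mul _
        exact j1.mul_prod j2
      apply i1.mono'
      · apply Continuous.aestronglyMeasurable
        have h2 := w_smooth.continuous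
        simp only [Function.uncurry_def]
        fun_prop
      · filter_upwards with p
        obtain ⟨y, u⟩ := p
        simp only [Function.uncurry_apply_pair]
        rw [norm_mul, Complex.norm_real, Real.norm_of_nonneg (mul_pos (w_pos _) (w_pos _)).le]
        have : w (u + y) * w y ≤ Real.exp (-(2*a) * ‖y‖^2 * (1/2)) * Real.exp (-(a/2) * ‖u‖^2) := by
          simp only [hw]
          rw [← Real.exp_add, ← Real.exp_add, Real.exp_le_exp]
          have h4 : ‖u‖^2 ≤ 2 * ‖u + y‖^2 + 2 * ‖y‖^2 := by
            have h5 : ‖u‖ ≤ ‖u + y‖ + ‖y‖ := by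
              have := norm_sub_le (u + y) y; rwa [add_sub_cancel_right] at this
            nlinarith [norm_nonneg u, sq_nonneg (‖u + y‖ - ‖y‖)]
          nlinarith [sq_nonneg ‖u+y‖]
        calc ‖K u‖ * (w (u + y) * w y) ≤ g 0 * (Real.exp (-(2*a) * ‖y‖^2 * (1/2)) * Real.exp (-(a/2) * ‖u‖^2)) :=
              mul_le_mul (K_bd _) this (mul_pos (w_pos _) (w_pos _)).le hg0
          _ = _ := by ring
  rw [final, Complex.im_ofReal_mul, Complex.re_ofReal_mul] at hpos'
  refine ⟨?_, ?_⟩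
  · rcases mul_eq_zero.mp hpos'.1 with h | h
    · exact absurd h C_pos.ne'
    · exact h
  · exact nonneg_of_mul_nonneg_right hpos'.2 C_pos

end Bg

namespace Bg
open MeasureTheory Metric Set Filter Topology
open scoped RealInnerProductSpace NNReal ENNReal ComplexConjugate ContDiff FourierTransform

variable {n : ℕ}

lemma fourier_pos_int {f : EuclideanSpace ℝ (Fin n) → ℂ} (hf : Continuous f) (hi : Integrable f)
    (hpos : ∀ ξ, (𝓕 f ξ).im = 0 ∧ 0 ≤ (𝓕 f ξ).re) : Integrable (𝓕 f) := by
  have hcont : Continuous (𝓕 f) :=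
    VectorFourier.fourierIntegral_continuous Real.continuous_fourierChar continuous_inner hi
  have hreal : ∀ ξ, 𝓕 f ξ = (((𝓕 f ξ).re : ℝ) : ℂ) := fun ξ => by
    apply Complex.ext <;> simp [(hpos ξ).1]
  have hlim := Real.tendsto_integral_gaussian_smul' hi (v := 0) hf.continuousAt
  have hlim2 : Tendsto (fun c : ℝ => ∫ w, Real.exp (-c⁻¹ * ‖w‖^2) * (𝓕 f w).re) atTop (𝓝 (f 0).re) := by
    refine ((Complex.continuous_re.tendsto _).comp hlim).congr' ?_
    filter_upwards [Ioi_mem_atTop 0] with c (hc : 0 < c)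
    have J : Integrable (fun w : EuclideanSpace ℝ (Fin n) => Complex.exp (- (c:ℂ)⁻¹ * ‖w‖ ^ 2)) := by
      simpa using (GaussianFourier.integrable_cexp_neg_mul_sq_norm_add (V := EuclideanSpace ℝ (Fin n))
        (b := (c:ℂ)⁻¹) (by rw [← Complex.ofReal_inv, Complex.ofReal_re]; positivity) 0 0)
    have k := (VectorFourier.integral_fourierIntegral_smul_eq_flip (L := innerₗ (EuclideanSpace ℝ (Fin n)))
      (μ := volume) (ν := volume) Real.continuous_fourierChar continuous_inner J hi)
    have e1 : (fun w : EuclideanSpace ℝ (Fin n) => ((Real.pi * c : ℂ) ^ (Module.finrank ℝ (EuclideanSpace ℝ (Fin n)) / 2 : ℂ) * Complex.exp (-Real.pi ^ 2 * c * ‖(0:EuclideanSpace ℝ (Fin n)) - w‖ ^ 2)) • f w)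
      = fun w => (𝓕 (fun w : EuclideanSpace ℝ (Fin n) => Complex.exp (- (c:ℂ)⁻¹ * ‖w‖ ^ 2)) w) • f w := by
      ext w
      rw [fourier_gaussian_innerProductSpace (by rw [← Complex.ofReal_inv, Complex.ofReal_re]; positivity)]
      congr 2
      · simp
      · simp; ring_nf
    have e2 : (∫ w, (𝓕 (fun w : EuclideanSpace ℝ (Fin n) => Complex.exp (- (c:ℂ)⁻¹ * ‖w‖ ^ 2)) w) • f w) =
        ∫ w, Complex.exp (- (c:ℂ)⁻¹ * ‖w‖ ^ 2) • 𝓕 f w := by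
      simpa using! k
    simp only [Function.comp]
    rw [e1, e2]
    have e3 : ∀ w, Complex.exp (- (c:ℂ)⁻¹ * ‖w‖ ^ 2) • 𝓕 f w = ((Real.exp (-c⁻¹ * ‖w‖^2) * (𝓕 f w).re : ℝ) : ℂ) := by
      intro w
      conv_lhs => rw [hreal w]
      push_cast; simp
    simp only [e3]
    rw [integral_complex_ofReal, Complex.ofReal_re]
  have hre : Integrable fun ξ => (𝓕 f ξ).re := by
    refine ⟨(Complex.continuous_re.comp hcont).aestronglyMeasurable, ?_⟩
    rw [hasFiniteIntegral_iff_ofReal (ae_of_all _ fun ξ => (hpos ξ).2)]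
    have hseq : Tendsto (fun j : ℕ => ∫ w, Real.exp (-((j:ℝ)+1)⁻¹ * ‖w‖^2) * (𝓕 f w).re) atTop (𝓝 (f 0).re) :=
      hlim2.comp (tendsto_atTop_add_const_right _ _ tendsto_natCast_atTop_atTop)
    have hbdd : ∀ w, (𝓕 f w).re ≤ ∫ v, ‖f v‖ := fun w =>
      (Complex.re_le_norm _).trans (VectorFourier.norm_fourierIntegral_le_integral_norm _ _ _ _ _)
    have hintg : ∀ j : ℕ, Integrable fun w => Real.exp (-((j:ℝ)+1)⁻¹ * ‖w‖^2) * (𝓕 f w).re := by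
      intro j
      refine ((gint (n := n) (a := ((j:ℝ)+1)⁻¹) (by positivity)).mul_const (∫ v, ‖f v‖)).mono' ?_ ?_
      · apply Continuous.aestronglyMeasurable
        have := Complex.continuous_re.comp hcont
        exact (by fun_prop : Continuous fun w : EuclideanSpace ℝ (Fin n) => Real.exp (-((j:ℝ)+1)⁻¹ * ‖w‖^2)).mul this
      · filter_upwards with w
        rw [Real.norm_of_nonneg (mul_nonneg (Real.exp_pos _).le (hpos w).2)]
        exact mul_le_mul_of_nonneg_left (hbdd w) (Real.exp_pos _).le
    have hF : ∫⁻ w, ENNReal.ofReal (𝓕 f w).re ≤ liminf (fun j : ℕ => ∫⁻ w, ENNReal.ofReal (Real.exp (-((j:ℝ)+1)⁻¹ * ‖w‖^2) * (𝓕 f w).re)) atTop := by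
      have : ∀ w, ENNReal.ofReal (𝓕 f w).re = liminf (fun j : ℕ => ENNReal.ofReal (Real.exp (-((j:ℝ)+1)⁻¹ * ‖w‖^2) * (𝓕 f w).re)) atTop := by
        intro w
        symm
        apply Tendsto.liminf_eq
        apply (ENNReal.continuous_ofReal.tendsto _).comp
        have h1 : Tendsto (fun j : ℕ => ((j:ℝ)+1)⁻¹) atTop (𝓝 0) :=
          tendsto_inv_atTop_zero.comp (tendsto_atTop_add_const_right _ _ tendsto_natCast_atTop_atTop)
        have h2 : Tendsto (fun j : ℕ => Real.exp (-((j:ℝ)+1)⁻¹ * ‖w‖^2) * (𝓕 f w).re) atTop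
            (𝓝 (Real.exp (-0 * ‖w‖^2) * (𝓕 f w).re)) :=
          (((Real.continuous_exp.tendsto _).comp ((h1.neg).mul_const _))).mul_const _
        simpa using h2
      simp only [this]
      apply lintegral_liminf_le
      intro j
      exact (ENNReal.continuous_ofReal.comp ((by fun_prop : Continuous fun w : EuclideanSpace ℝ (Fin n) => Real.exp (-((j:ℝ)+1)⁻¹ * ‖w‖^2)).mul (Complex.continuous_re.comp hcont))).measurable
    refine lt_of_le_of_lt hF ?_
    have : Tendsto (fun j : ℕ => ∫⁻ w, ENNReal.ofReal (Real.exp (-((j:ℝ)+1)⁻¹ * ‖w‖^2) * (𝓕 f w).re)) atTop (𝓝 (ENNReal.ofReal (f 0).re)) := by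
      refine ((ENNReal.continuous_ofReal.tendsto _).comp hseq).congr fun j => ?_
      exact ofReal_integral_eq_lintegral_ofReal (hintg j) (ae_of_all _ fun w => mul_nonneg (Real.exp_pos _).le (hpos w).2)
    rw [this.liminf_eq]
    exact ENNReal.ofReal_lt_top
  have : 𝓕 f = fun ξ => (((𝓕 f ξ).re : ℝ) : ℂ) := funext hreal
  rw [this]
  exact hre.ofReal

lemma fourier_pos_meas {f : EuclideanSpace ℝ (Fin n) → ℂ} (hf : Continuous f) (hi : Integrable f)
    (hpos : ∀ ξ, (𝓕 f ξ).im = 0 ∧ 0 ≤ (𝓕 f ξ).re) (h1 : f 0 = 1) :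
    ∃ μ : ProbabilityMeasure (EuclideanSpace ℝ (Fin n)), ∀ t, charFun (μ : Measure _) t = f ((2 * Real.pi)⁻¹ • t) := by
  have hfi := fourier_pos_int hf hi hpos
  have hcont : Continuous (𝓕 f) :=
    VectorFourier.fourierIntegral_continuous Real.continuous_fourierChar continuous_inner hi
  have hreal : ∀ ξ, 𝓕 f ξ = (((𝓕 f ξ).re : ℝ) : ℂ) := fun ξ => by
    apply Complex.ext <;> simp [(hpos ξ).1]
  have hinv := hf.fourierInv_fourier_eq hi hfi
  have key : ∀ t, ∫ v, Complex.exp (((⟪v, t⟫ : ℝ) : ℂ) * Complex.I) * (((𝓕 f v).re : ℝ) : ℂ) = f ((2 * Real.pi)⁻¹ • t) := by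
    intro t
    rw [← hinv, Real.fourierInv_eq']
    congr 1; ext v
    rw [hinv, ← hreal v, inner_smul_right, smul_eq_mul]
    congr 4
    have : Real.pi ≠ 0 := Real.pi_ne_zero
    field_simp
  have hden : Measurable fun v => ENNReal.ofReal (𝓕 f v).re := (ENNReal.continuous_ofReal.comp (Complex.continuous_re.comp hcont)).measurable
  have hprob : IsProbabilityMeasure (volume.withDensity fun v => ENNReal.ofReal (𝓕 f v).re) := by
    refine ⟨?_⟩
    have hre : Integrable (fun v => (𝓕 f v).re) := hfi.re
    rw [withDensity_apply _ MeasurableSet.univ, setLIntegral_univ,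
      ← ofReal_integral_eq_lintegral_ofReal hre (ae_of_all _ fun w => (hpos w).2)]
    have := key 0
    simp only [inner_zero_right, Complex.ofReal_zero, zero_mul, Complex.exp_zero, one_mul, smul_zero, h1] at this
    rw [integral_complex_ofReal] at this
    have h2 : ∫ v, (𝓕 f v).re = 1 := by exact_mod_cast this
    rw [h2, ENNReal.ofReal_one]
  refine ⟨⟨_, hprob⟩, fun t => ?_⟩
  rw [← key t]
  simp only [ProbabilityMeasure.coe_mk, charFun_apply]
  rw [integral_withDensity_eq_integral_toReal_smul hden (ae_of_all _ fun _ => ENNReal.ofReal_lt_top)]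
  congr 1; ext v
  rw [ENNReal.toReal_ofReal (hpos v).2, Complex.real_smul, mul_comm]

lemma bochner1 {g : EuclideanSpace ℝ (Fin n) → ℝ} (hg : PDK g) (h1 : g 0 = 1) :
    ∃ M : ProbabilityMeasure (EuclideanSpace ℝ (Fin n)), ∀ t, charFun (M : Measure _) t = (g ((2 * Real.pi)⁻¹ • t) : ℂ) := by
  have hbd := pd_bound hg
  have hc := hg.1
  have hex : ∀ j : ℕ, ∃ μ : ProbabilityMeasure (EuclideanSpace ℝ (Fin n)), ∀ t, charFun (μ : Measure _) t =
      ((g ((2 * Real.pi)⁻¹ • t) * Real.exp (-((j:ℝ)+1)⁻¹ * ‖(2 * Real.pi)⁻¹ • t‖^2) : ℝ) : ℂ) := by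
    intro j
    have hcj : Continuous fun x : EuclideanSpace ℝ (Fin n) => ((g x * Real.exp (-((j:ℝ)+1)⁻¹ * ‖x‖^2) : ℝ) : ℂ) := by fun_prop
    have := fourier_pos_meas (f := fun x => ((g x * Real.exp (-((j:ℝ)+1)⁻¹ * ‖x‖^2) : ℝ) : ℂ)) hcj ?_
      (fun ξ => pd_fourier hg (by positivity) ξ) (by simp [h1])
    · exact this
    · refine (gint (n := n) (a := ((j:ℝ)+1)⁻¹) (by positivity)).mono' hcj.aestronglyMeasurable ?_
      filter_upwards with x
      rw [Complex.norm_real, norm_mul, Real.norm_of_nonneg (Real.exp_pos _).le]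
      have := hbd x
      rw [h1] at this
      exact mul_le_of_le_one_left (Real.exp_pos _).le this
  choose μ hμ using hex
  have hlim : ∀ t, Tendsto (fun j => charFun (μ j : Measure (EuclideanSpace ℝ (Fin n))) t) atTop (𝓝 (g ((2 * Real.pi)⁻¹ • t) : ℂ)) := by
    intro t
    simp only [hμ]
    apply (Complex.continuous_ofReal.tendsto _).comp
    have h1 : Tendsto (fun j : ℕ => ((j:ℝ)+1)⁻¹) atTop (𝓝 0) :=
      tendsto_inv_atTop_zero.comp (tendsto_atTop_add_const_right _ _ tendsto_natCast_atTop_atTop)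
    have h2 : Tendsto (fun j : ℕ => g ((2 * Real.pi)⁻¹ • t) * Real.exp (-((j:ℝ)+1)⁻¹ * ‖(2 * Real.pi)⁻¹ • t‖^2)) atTop
        (𝓝 (g ((2 * Real.pi)⁻¹ • t) * Real.exp (-0 * ‖(2 * Real.pi)⁻¹ • t‖^2))) :=
      ((Real.continuous_exp.tendsto _).comp ((h1.neg).mul_const _)).const_mul _
    simpa using h2
  have htight := isTightMeasureSet_of_tendsto_charFun (μ := fun j => (μ j : Measure (EuclideanSpace ℝ (Fin n))))
    (f := fun t => (g ((2 * Real.pi)⁻¹ • t) : ℂ)) (by fun_prop) hlim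
  have hcomp : IsCompact (closure (Set.range μ)) := by
    apply isCompact_closure_of_isTightMeasureSet
    have hs : {x : Measure (EuclideanSpace ℝ (Fin n)) | ∃ ν ∈ Set.range μ, (ν : Measure (EuclideanSpace ℝ (Fin n))) = x} =
        Set.range fun j => (μ j : Measure (EuclideanSpace ℝ (Fin n))) := by
      ext ν
      constructor
      · rintro ⟨_, ⟨j, rfl⟩, rfl⟩
        exact ⟨j, rfl⟩
      · rintro ⟨j, rfl⟩
        exact ⟨μ j, ⟨j, rfl⟩, rfl⟩
    rw [← hs] at htight
    exact htight
  have hU : ∃ M ∈ closure (Set.range μ), Tendsto μ (hyperfilter ℕ : Filter ℕ) (𝓝 M) := by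
    have := isCompact_iff_ultrafilter_le_nhds.mp hcomp (Ultrafilter.map μ (hyperfilter ℕ)) (by
      rw [le_principal_iff]
      exact Filter.mem_of_superset (Ultrafilter.mem_map.mpr (by rw [preimage_range]; exact Filter.univ_mem)) subset_closure)
    exact this
  obtain ⟨M, -, hM⟩ := hU
  refine ⟨M, fun t => ?_⟩
  have l1 : Tendsto (fun j => charFun (μ j : Measure (EuclideanSpace ℝ (Fin n))) t) (hyperfilter ℕ : Filter ℕ) (𝓝 (g ((2 * Real.pi)⁻¹ • t) : ℂ)) :=
    (hlim t).mono_left Nat.hyperfilter_le_atTop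
  have l2 : Tendsto (fun j => charFun (μ j : Measure (EuclideanSpace ℝ (Fin n))) t) (hyperfilter ℕ : Filter ℕ) (𝓝 (charFun (M : Measure _) t)) := by
    rw [ProbabilityMeasure.tendsto_iff_forall_integral_rclike_tendsto ℂ] at hM
    simp only [charFun_eq_integral_innerProbChar]
    exact hM _
  exact tendsto_nhds_unique l2 l1

theorem bochner {g : EuclideanSpace ℝ (Fin n) → ℝ} (hg : PDK g) (h0 : ∃ x, g x ≠ 0) :
    ∃ M : Measure (EuclideanSpace ℝ (Fin n)), IsFiniteMeasure M ∧ M ≠ 0 ∧ ∀ x, (g x : ℂ) = charFun M x := by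
  have hbd := pd_bound hg
  have hpos : 0 < g 0 := by
    obtain ⟨x, hx⟩ := h0
    exact lt_of_lt_of_le (abs_pos.mpr hx) (hbd x)
  have hg' : PDK (fun x => (g 0)⁻¹ * g x) := by
    obtain ⟨hc, hr, hp⟩ := hg
    refine ⟨by fun_prop, fun x y h => by simp only [hr x y h], fun u hu hu' => ?_⟩
    have e : (∫ x, ∫ y, (((g 0)⁻¹ * g (x - y) : ℝ) : ℂ) * u x * (starRingEnd ℂ) (u y)) =
        (((g 0)⁻¹ : ℝ) : ℂ) * ∫ x, ∫ y, (g (x - y) : ℂ) * u x * (starRingEnd ℂ) (u y) := by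
      rw [← integral_const_mul]
      congr 1; ext x
      rw [← integral_const_mul]
      congr 1; ext y
      push_cast; ring
    rw [e, Complex.im_ofReal_mul, Complex.re_ofReal_mul]
    have := hp u hu hu'
    exact ⟨by rw [this.1, mul_zero], mul_nonneg (by positivity) this.2⟩
  obtain ⟨M, hM⟩ := bochner1 hg' (by field_simp)
  let N : Measure (EuclideanSpace ℝ (Fin n)) := (M : Measure _).map (fun x => (2 * Real.pi) • x)
  have hN : IsProbabilityMeasure N := Measure.isProbabilityMeasure_map (by fun_prop)
  have hNc : ∀ x, charFun N x = (((g 0)⁻¹ * g x : ℝ) : ℂ) := by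
    intro x
    rw [charFun_map_smul, hM, smul_smul, inv_mul_cancel₀ (by positivity), one_smul]
  refine ⟨(g 0).toNNReal • N, inferInstance, ?_, fun x => ?_⟩
  · intro h
    have := congrArg (fun m => m univ) h
    simp at this
    linarith
  · rw [charFun_apply, integral_smul_nnreal_measure, ← charFun_apply, hNc, NNReal.smul_def, Real.coe_toNNReal _ hpos.le, Complex.real_smul]
    rw [← Complex.ofReal_mul]
    congr 1; field_simp

end Bg

namespace Bg
open MeasureTheory Metric Set Filter Topology
open scoped RealInnerProductSpace NNReal ENNReal ComplexConjugate

variable {n : ℕ}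

/-- Fourier transform of `f dτ` -/
noncomputable def ft (τ : Measure (EuclideanSpace ℝ (Fin n))) (f : EuclideanSpace ℝ (Fin n) → ℝ)
    (ξ : EuclideanSpace ℝ (Fin n)) : ℂ :=
  ∫ y, (f y : ℂ) * Complex.exp (((⟪ξ, y⟫ : ℝ) : ℂ) * Complex.I) ∂τ

lemma norm_e (ξ y : EuclideanSpace ℝ (Fin n)) : ‖Complex.exp (((⟪ξ, y⟫ : ℝ) : ℂ) * Complex.I)‖ = 1 :=
  Complex.norm_exp_ofReal_mul_I _

lemma ft_cont {τ : Measure (EuclideanSpace ℝ (Fin n))} {f : EuclideanSpace ℝ (Fin n) → ℝ}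
    (hf : Continuous f) (hi : Integrable f τ) : Continuous (ft τ f) := by
  unfold ft
  refine continuous_of_dominated (bound := fun y => ‖f y‖) (fun ξ => ?_) (fun ξ => ?_) hi.norm ?_
  · exact (by fun_prop : Continuous fun y : EuclideanSpace ℝ (Fin n) =>
      (f y : ℂ) * Complex.exp (((⟪ξ, y⟫ : ℝ) : ℂ) * Complex.I)).aestronglyMeasurable
  · filter_upwards with y
    rw [norm_mul, norm_e, mul_one, Complex.norm_real]
  · filter_upwards with y
    fun_prop

lemma ft_bound {τ : Measure (EuclideanSpace ℝ (Fin n))} (f : EuclideanSpace ℝ (Fin n) → ℝ)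
    (ξ : EuclideanSpace ℝ (Fin n)) : ‖ft τ f ξ‖ ≤ ∫ y, ‖f y‖ ∂τ := by
  unfold ft
  refine (norm_integral_le_integral_norm _).trans (le_of_eq ?_)
  congr 1; ext y
  rw [norm_mul, norm_e, mul_one, Complex.norm_real]

lemma energy {τ M : Measure (EuclideanSpace ℝ (Fin n))} [IsFiniteMeasure τ] [IsFiniteMeasure M]
    {g f : EuclideanSpace ℝ (Fin n) → ℝ} (hM : ∀ x, (g x : ℂ) = charFun M x)
    (hf : Continuous f) (hi : Integrable f τ) :
    ((∫ x, ∫ y, g (x - y) * f x * f y ∂τ ∂τ : ℝ) : ℂ) = ∫ ξ, ft τ f ξ * conj (ft τ f ξ) ∂M := by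
  let e : EuclideanSpace ℝ (Fin n) → EuclideanSpace ℝ (Fin n) → ℂ :=
    fun ξ y => Complex.exp (((⟪ξ, y⟫ : ℝ) : ℂ) * Complex.I)
  have he : ∀ ξ y, ‖e ξ y‖ = 1 := norm_e
  have hec : Continuous (fun p : EuclideanSpace ℝ (Fin n) × EuclideanSpace ℝ (Fin n) => e p.2 p.1) := by
    fun_prop
  have hsplit : ∀ ξ x y, Complex.exp (((⟪ξ, x - y⟫ : ℝ) : ℂ) * Complex.I) = e ξ x * conj (e ξ y) := by
    intro ξ x y
    simp only [e]
    rw [← Complex.exp_conj, ← Complex.exp_add, inner_sub_right]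
    congr 1
    simp; ring
  have hft : ∀ ξ, conj (ft τ f ξ) = ∫ y, (f y : ℂ) * conj (e ξ y) ∂τ := by
    intro ξ
    unfold ft
    rw [← integral_conj]
    congr 1; ext y; simp [e]
  have hin : ∀ x, ((∫ y, g (x - y) * f x * f y ∂τ : ℝ) : ℂ) =
      ∫ ξ, ((f x : ℂ) * e ξ x) * conj (ft τ f ξ) ∂M := by
    intro x
    rw [← integral_complex_ofReal]
    have h1 : ∀ y, ((g (x - y) * f x * f y : ℝ) : ℂ) =
        ∫ ξ, ((f x : ℂ) * e ξ x) * ((f y : ℂ) * conj (e ξ y)) ∂M := by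
      intro y
      push_cast
      rw [hM, charFun_apply, mul_assoc, ← integral_mul_const]
      congr 1; ext ξ
      rw [hsplit]; ring
    simp only [h1]
    rw [integral_integral_swap]
    · congr 1; ext ξ
      rw [integral_const_mul, hft]
    · refine ((hi.norm.comp_fst M).const_mul ‖f x‖).mono' ?_ ?_
      · apply Continuous.aestronglyMeasurable
        simp only [e, Function.uncurry_def]
        fun_prop
      · filter_upwards with p
        simp [Function.uncurry_def, he]
  rw [← integral_complex_ofReal]
  simp only [hin]
  have hc := ft_cont hf hi
  rw [integral_integral_swap]
  · congr 1; ext ξ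
    rw [integral_mul_const]
    rfl
  · refine ((hi.norm.comp_fst M).mul_const (∫ y, ‖f y‖ ∂τ)).mono' ?_ ?_
    · apply Continuous.aestronglyMeasurable
      simp only [e, Function.uncurry_def]
      fun_prop
    · filter_upwards with p
      simp only [Function.uncurry_def, norm_mul, he, Complex.norm_real, mul_one, RCLike.norm_conj]
      exact mul_le_mul_of_nonneg_left (ft_bound f _) (norm_nonneg _)

lemma energy_zero {τ M : Measure (EuclideanSpace ℝ (Fin n))} [IsFiniteMeasure τ] [IsFiniteMeasure M]
    {g f : EuclideanSpace ℝ (Fin n) → ℝ} (hM : ∀ x, (g x : ℂ) = charFun M x)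
    (hf : Continuous f) (hi : Integrable f τ) :
    (∫ x, ∫ y, g (x - y) * f x * f y ∂τ ∂τ) = 0 ↔ ∀ᵐ ξ ∂M, ft τ f ξ = 0 := by
  have h := energy hM hf hi
  have h2 : ∀ ξ, ft τ f ξ * conj (ft τ f ξ) = ((‖ft τ f ξ‖^2 : ℝ) : ℂ) := by
    intro ξ; rw [Complex.mul_conj, Complex.normSq_eq_norm_sq]
  simp only [h2] at h
  rw [integral_complex_ofReal] at h
  have h3 : (∫ x, ∫ y, g (x - y) * f x * f y ∂τ ∂τ) = ∫ ξ, ‖ft τ f ξ‖^2 ∂M := by exact_mod_cast h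
  have hc := ft_cont hf hi
  have hintg : Integrable (fun ξ => ‖ft τ f ξ‖^2) M := by
    refine Integrable.mono' (integrable_const ((∫ y, ‖f y‖ ∂τ)^2)) (by fun_prop) ?_
    filter_upwards with ξ
    rw [norm_pow, norm_norm]
    exact pow_le_pow_left₀ (norm_nonneg _) (ft_bound f ξ) 2
  rw [h3, integral_eq_zero_iff_of_nonneg (fun ξ => by positivity) hintg]
  constructor
  · intro h
    filter_upwards [h] with ξ hξ
    simpa using hξ
  · intro h
    filter_upwards [h] with ξ hξ
    simp [hξ]

lemma spectral {M : Measure (EuclideanSpace ℝ (Fin n))} [IsFiniteMeasure M] (h0 : M ≠ 0)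
    {g : EuclideanSpace ℝ (Fin n) → ℝ} (hr : ∀ x y, ‖x‖ = ‖y‖ → g x = g y)
    (hM : ∀ x, (g x : ℂ) = charFun M x) :
    ∃ ξ0 : EuclideanSpace ℝ (Fin n), ∀ F : EuclideanSpace ℝ (Fin n) → ℂ, Continuous F →
      (∀ᵐ ξ ∂M, F ξ = 0) → ∀ ξ, ‖ξ‖ = ‖ξ0‖ → F ξ = 0 := by
  have hinv : ∀ e : EuclideanSpace ℝ (Fin n) ≃ₗᵢ[ℝ] EuclideanSpace ℝ (Fin n), M.map e = M := by
    intro e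
    have : IsFiniteMeasure (M.map e) := inferInstance
    apply Measure.ext_of_charFun
    ext x
    rw [charFun_apply, integral_map e.continuous.aemeasurable (by fun_prop)]
    have : ∀ y, ⟪e y, x⟫ = ⟪y, e.symm x⟫ := by
      intro y
      rw [← e.inner_map_map y, e.apply_symm_apply]
    simp only [this]
    rw [← charFun_apply, ← hM, ← hM, hr _ _ (e.symm.norm_map x)]
  have hs : ∃ ξ0 : EuclideanSpace ℝ (Fin n), ∀ U, IsOpen U → ξ0 ∈ U → M U ≠ 0 := by
    by_contra hcon
    push Not at hcon
    apply h0
    have : M univ = 0 := by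
      apply measure_null_of_locally_null
      intro x _
      obtain ⟨U, hU, hx, hz⟩ := hcon x
      exact ⟨U, mem_nhdsWithin_of_mem_nhds (hU.mem_nhds hx), hz⟩
    exact Measure.measure_univ_eq_zero.mp this
  obtain ⟨ξ0, hξ0⟩ := hs
  refine ⟨ξ0, fun F hF hae ξ hξ => ?_⟩
  by_contra hne
  obtain ⟨e, he⟩ := exists_isom (x := ξ0) (y := ξ) hξ.symm
  have hU : IsOpen {x | F x ≠ 0} := isOpen_ne_fun hF continuous_const
  apply hξ0 (e ⁻¹' {x | F x ≠ 0}) (hU.preimage e.continuous)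
  · simp [he, hne]
  · rw [← Measure.map_apply e.continuous.measurable hU.measurableSet, hinv e]
    exact hae

end Bg

namespace Bg
open MeasureTheory Metric Set Filter Topology
open scoped RealInnerProductSpace NNReal ENNReal ComplexConjugate

variable {n : ℕ}

section mom
set_option linter.unusedSectionVars false
variable {τ : Measure (EuclideanSpace ℝ (Fin n))} [IsFiniteMeasure τ] {R : ℝ}

lemma inv_int {F : Type*} [NormedAddCommGroup F] [NormedSpace ℝ F]
    (hinv : ∀ e : EuclideanSpace ℝ (Fin n) ≃ₗᵢ[ℝ] EuclideanSpace ℝ (Fin n), MeasurePreserving e τ τ)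
    (e : EuclideanSpace ℝ (Fin n) ≃ₗᵢ[ℝ] EuclideanSpace ℝ (Fin n)) (f : EuclideanSpace ℝ (Fin n) → F) :
    ∫ y, f (e y) ∂τ = ∫ y, f y ∂τ :=
  (hinv e).integral_comp e.toHomeomorph.measurableEmbedding f

lemma mom_rad (hinv : ∀ e : EuclideanSpace ℝ (Fin n) ≃ₗᵢ[ℝ] EuclideanSpace ℝ (Fin n), MeasurePreserving e τ τ)
    (i0 : Fin n) (x : EuclideanSpace ℝ (Fin n)) (m : ℕ) :
    ∫ y, ⟪x, y⟫ ^ m ∂τ = ‖x‖ ^ m * ∫ y, (y i0) ^ m ∂τ := by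
  obtain ⟨e, he⟩ := exists_isom (x := EuclideanSpace.single i0 ‖x‖) (y := x) (by simp)
  rw [← inv_int hinv e, ← integral_const_mul]
  congr 1; ext y
  conv_lhs => rw [← he]
  rw [e.inner_map_map, EuclideanSpace.inner_single_left]
  simp [mul_pow]

lemma mom_odd (hinv : ∀ e : EuclideanSpace ℝ (Fin n) ≃ₗᵢ[ℝ] EuclideanSpace ℝ (Fin n), MeasurePreserving e τ τ)
    (x : EuclideanSpace ℝ (Fin n)) (k : ℕ) :
    ∫ y, ⟪x, y⟫ ^ (2 * k + 1) ∂τ = 0 := by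
  have h := inv_int hinv (LinearIsometryEquiv.neg ℝ) (fun y => ⟪x, y⟫ ^ (2 * k + 1))
  have h2 : ∀ y : EuclideanSpace ℝ (Fin n), ⟪x, LinearIsometryEquiv.neg ℝ y⟫ ^ (2*k+1) = - ⟪x, y⟫ ^ (2*k+1) := by
    intro y
    simp only [LinearIsometryEquiv.coe_neg, inner_neg_right]
    exact Odd.neg_pow ⟨k, rfl⟩ _
  simp only [h2] at h
  rw [integral_neg] at h
  linarith

lemma mom_two (hτ : ∀ᵐ x ∂τ, ‖x‖ ≤ R)
    (hinv : ∀ e : EuclideanSpace ℝ (Fin n) ≃ₗᵢ[ℝ] EuclideanSpace ℝ (Fin n), MeasurePreserving e τ τ)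
    {i0 j : Fin n} (hij : i0 ≠ j) (k : ℕ) :
    (2 * (k:ℝ) + 1) * ∫ y, (y i0) ^ (2 * k) * (y j) ^ 2 ∂τ = ∫ y, (y i0) ^ (2 * k + 2) ∂τ := by
  have hpol : (∑ m ∈ Finset.range (2*k+2+1), Polynomial.C (∫ y, (y j)^m * (y i0)^(2*k+2-m) * ((2*k+2).choose m : ℝ) ∂τ) * Polynomial.X ^ m)
      = Polynomial.C (∫ y, (y i0) ^ (2 * k + 2) ∂τ) * (Polynomial.X^2 + 1)^(k+1) := by
    apply Polynomial.funext
    intro r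
    simp only [Polynomial.eval_finsetSum, Polynomial.eval_mul, Polynomial.eval_C, Polynomial.eval_pow, Polynomial.eval_X,
      Polynomial.eval_add, Polynomial.eval_one]
    have h1 := mom_rad hinv i0 (EuclideanSpace.single i0 (1:ℝ) + EuclideanSpace.single j r) (2*k+2)
    have h2 : ‖EuclideanSpace.single i0 (1:ℝ) + EuclideanSpace.single j r‖ ^ (2*k+2) = (r^2+1)^(k+1) := by
      rw [show 2*k+2 = 2*(k+1) by ring, pow_mul, ← real_inner_self_eq_norm_sq, inner_add_left, inner_add_right, inner_add_right]
      congr 1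
      simp [EuclideanSpace.inner_single_left, hij, hij.symm]
      ring
    rw [h2] at h1
    rw [mul_comm (∫ y, (y i0) ^ (2 * k + 2) ∂τ), ← h1]
    have h3 : ∀ y : EuclideanSpace ℝ (Fin n), ⟪EuclideanSpace.single i0 (1:ℝ) + EuclideanSpace.single j r, y⟫ ^ (2*k+2) =
      ∑ m ∈ Finset.range (2*k+2+1), ((y j)^m * (y i0)^(2*k+2-m) * ((2*k+2).choose m : ℝ)) * r^m := by
      intro y
      rw [inner_add_left, EuclideanSpace.inner_single_left, EuclideanSpace.inner_single_left, add_comm, add_pow]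
      apply Finset.sum_congr rfl
      intro m _
      simp [mul_pow]; ring
    simp only [h3]
    rw [integral_finsetSum]
    · apply Finset.sum_congr rfl
      intro m _
      exact (integral_mul_const _ _).symm
    · intro m _
      exact cint hτ (by fun_prop)
  have hc := congrArg (fun p => Polynomial.coeff p 2) hpol
  simp only [Polynomial.finsetSum_coeff, Polynomial.coeff_C_mul, Polynomial.coeff_X_pow] at hc
  rw [Finset.sum_eq_single 2 (fun m _ hm => by simp [hm.symm]) (fun h => by simp at h)] at hc
  have h5 : ((Polynomial.X^2 + 1 : Polynomial ℝ)^(k+1)).coeff 2 = k + 1 := by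
    have : (Polynomial.X^2 + 1 : Polynomial ℝ)^(k+1) = Polynomial.expand ℝ 2 ((1 + Polynomial.X)^(k+1)) := by
      simp [add_comm]
    rw [this, show 2 = 1 * 2 by norm_num, Polynomial.coeff_expand_mul (by norm_num), Polynomial.coeff_one_add_X_pow]
    simp
  rw [h5, integral_mul_const] at hc
  have h6 : (((2*k+2).choose 2 : ℕ) : ℝ) = (k+1) * (2*k+1) := by
    rw [Nat.cast_choose_two]; push_cast; ring
  rw [h6] at hc
  simp only [Nat.add_sub_cancel] at hc
  have h7 : ∫ y, (y i0) ^ (2 * k) * (y j) ^ 2 ∂τ = ∫ y, (y j) ^ 2 * (y i0) ^ (2 * k) ∂τ := by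
    congr 1; ext y; ring
  rw [h7]
  have h8 : (k:ℝ) + 1 ≠ 0 := by positivity
  apply mul_left_cancel₀ h8
  simp only [if_true] at hc
  linarith

lemma mom_rec (hτ : ∀ᵐ x ∂τ, ‖x‖ ≤ R)
    (hinv : ∀ e : EuclideanSpace ℝ (Fin n) ≃ₗᵢ[ℝ] EuclideanSpace ℝ (Fin n), MeasurePreserving e τ τ)
    (i0 : Fin n) (k : ℕ) :
    (2 * (k:ℝ) + 1) * ∫ y, (y i0) ^ (2 * k) * ‖y‖ ^ 2 ∂τ = (n + 2 * k) * ∫ y, (y i0) ^ (2 * k + 2) ∂τ := by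
  have h1 : ∀ y : EuclideanSpace ℝ (Fin n), (y i0) ^ (2 * k) * ‖y‖ ^ 2 = ∑ j, (y i0)^(2*k) * (y j)^2 := by
    intro y
    rw [EuclideanSpace.real_norm_sq_eq, Finset.mul_sum]
  simp only [h1]
  rw [integral_finsetSum _ (fun j _ => cint hτ (by fun_prop)), ← Finset.add_sum_erase _ _ (Finset.mem_univ i0),
    mul_add, Finset.mul_sum]
  rw [Finset.sum_congr rfl (fun j hj => mom_two hτ hinv (Finset.ne_of_mem_erase hj).symm k)]
  simp only [← pow_add]
  rw [Finset.sum_const, Finset.card_erase_of_mem (Finset.mem_univ i0), Finset.card_univ, Fintype.card_fin, nsmul_eq_mul]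
  have : 1 ≤ n := by have := i0.2; omega
  push_cast [Nat.cast_sub this]
  ring

lemma mom_ca (hτ : ∀ᵐ x ∂τ, ‖x‖ ≤ R)
    (hinv : ∀ e : EuclideanSpace ℝ (Fin n) ≃ₗᵢ[ℝ] EuclideanSpace ℝ (Fin n), MeasurePreserving e τ τ)
    (i0 : Fin n) (N : ℕ)
    (hrec : ∀ k : ℕ, ((N:ℝ) + 2 * k + 2) * ∫ y, (y i0) ^ (2 * k) * ‖y‖ ^ 2 ∂τ = (n + 2 * k) * R ^ 2 * ∫ y, (y i0) ^ (2 * k) ∂τ)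
    (k : ℕ) : (-1) ^ k / ((2 * k).factorial : ℝ) * ∫ y, (y i0) ^ (2 * k) ∂τ = τ.real univ * ((ca N k : ℚ) : ℝ) * (R ^ 2 / 4) ^ k := by
  have hn : (0:ℝ) < n := by
    have := i0.2
    exact_mod_cast (by omega : 0 < n)
  induction k with
  | zero => simp [ca]
  | succ k ih =>
    have h1 := mom_rec hτ hinv i0 k
    have h2 := hrec k
    have h3 : ((N:ℝ) + 2 * k + 2) * ∫ y, (y i0) ^ (2 * k + 2) ∂τ = (2 * k + 1) * R ^ 2 * ∫ y, (y i0) ^ (2 * k) ∂τ := by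
      have : (n + 2 * k : ℝ) ≠ 0 := by positivity
      apply mul_left_cancel₀ this
      linear_combination (-(N + 2 * k + 2 : ℝ)) * h1 + (2 * k + 1) * h2
    have h4 : ∫ y, (y i0) ^ (2 * k + 2) ∂τ = (2 * k + 1) * R ^ 2 * (∫ y, (y i0) ^ (2 * k) ∂τ) / ((N:ℝ) + 2 * k + 2) := by
      rw [← h3]; field_simp
    rw [ca.eq_2, show 2 * (k + 1) = 2 * k + 1 + 1 by ring, Nat.factorial_succ, Nat.factorial_succ]
    rw [show 2 * k + 1 + 1 = 2 * k + 2 by ring, h4]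
    push_cast
    have h5 : τ.real univ * (-2 * ((ca N k : ℚ) : ℝ) / (((k:ℝ)+1) * (N + 2 * k + 2))) * (R ^ 2 / 4) ^ (k + 1)
       = (τ.real univ * ((ca N k : ℚ) : ℝ) * (R ^ 2 / 4) ^ k) * (-2 / (((k:ℝ)+1) * (N + 2 * k + 2)) * (R^2/4)) := by
      rw [pow_succ]; ring
    rw [h5, ← ih]
    have : ((2 * k).factorial : ℝ) ≠ 0 := by positivity
    have h6 : (2 * (k:ℝ) + 1) ≠ 0 := by positivity
    field_simp
    ring

lemma ft_phi (hτ : ∀ᵐ x ∂τ, ‖x‖ ≤ R)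
    (hinv : ∀ e : EuclideanSpace ℝ (Fin n) ≃ₗᵢ[ℝ] EuclideanSpace ℝ (Fin n), MeasurePreserving e τ τ)
    (i0 : Fin n) (N : ℕ)
    (hrec : ∀ k : ℕ, ((N:ℝ) + 2 * k + 2) * ∫ y, (y i0) ^ (2 * k) * ‖y‖ ^ 2 ∂τ = (n + 2 * k) * R ^ 2 * ∫ y, (y i0) ^ (2 * k) ∂τ)
    (x : EuclideanSpace ℝ (Fin n)) :
    ∫ y, Complex.exp (((⟪x, y⟫ : ℝ) : ℂ) * Complex.I) ∂τ = ((τ.real univ * phi N (R ^ 2 * ‖x‖ ^ 2 / 4) : ℝ) : ℂ) := by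
  have hs : HasSum (fun m : ℕ => ∫ y, (((⟪x, y⟫ : ℝ) : ℂ) * Complex.I) ^ m / (m.factorial : ℂ) ∂τ)
      (∫ y, Complex.exp (((⟪x, y⟫ : ℝ) : ℂ) * Complex.I) ∂τ) := by
    refine hasSum_integral_of_dominated_convergence (fun m _ => (‖x‖ * R) ^ m / m.factorial) (fun m => ?_) (fun m => ?_) ?_ ?_ ?_
    · apply Continuous.aestronglyMeasurable
      fun_prop
    · filter_upwards [hτ] with y hy
      rw [norm_div, norm_pow, norm_mul, Complex.norm_I, mul_one, Complex.norm_real, Complex.norm_natCast]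
      gcongr
      exact (norm_inner_le_norm x y).trans (by gcongr)
    · filter_upwards with y
      exact Real.summable_pow_div_factorial _
    · exact integrable_const _
    · filter_upwards with y
      rw [Complex.exp_eq_exp_ℂ]
      exact NormedSpace.expSeries_div_hasSum_exp _
  have hterm : ∀ m : ℕ, ∫ y, (((⟪x, y⟫ : ℝ) : ℂ) * Complex.I) ^ m / (m.factorial : ℂ) ∂τ =
      Complex.I ^ m / (m.factorial : ℂ) * ((∫ y, ⟪x, y⟫ ^ m ∂τ : ℝ) : ℂ) := by
    intro m
    rw [← integral_complex_ofReal, ← integral_const_mul]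
    congr 1; ext y
    push_cast
    rw [mul_pow]; ring
  simp only [hterm] at hs
  have hinj : Function.Injective (fun k : ℕ => 2 * k) := fun a b h => by simpa using h
  rw [← hinj.hasSum_iff] at hs
  · have hev : ∀ k : ℕ, Complex.I ^ (2 * k) / ((2 * k).factorial : ℂ) * ((∫ y, ⟪x, y⟫ ^ (2 * k) ∂τ : ℝ) : ℂ) =
        ((τ.real univ * (((ca N k : ℚ) : ℝ) * (R ^ 2 * ‖x‖ ^ 2 / 4) ^ k) : ℝ) : ℂ) := by
      intro k
      have h := mom_ca hτ hinv i0 N hrec k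
      have h2 : τ.real univ * (((ca N k : ℚ) : ℝ) * (R ^ 2 * ‖x‖ ^ 2 / 4) ^ k) =
          (-1) ^ k / ((2 * k).factorial : ℝ) * (‖x‖ ^ (2 * k) * ∫ y, (y i0) ^ (2 * k) ∂τ) := by
        have : (R ^ 2 * ‖x‖ ^ 2 / 4) ^ k = (R ^ 2 / 4) ^ k * ‖x‖ ^ (2 * k) := by
          rw [pow_mul, ← mul_pow]; congr 1; ring
        rw [this]
        linear_combination (-‖x‖ ^ (2 * k)) * h
      rw [h2, mom_rad hinv i0, pow_mul, Complex.I_sq]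
      push_cast
      ring
    have hs2 : HasSum (fun k : ℕ => ((τ.real univ * (((ca N k : ℚ) : ℝ) * (R ^ 2 * ‖x‖ ^ 2 / 4) ^ k) : ℝ) : ℂ))
        (∫ y, Complex.exp (((⟪x, y⟫ : ℝ) : ℂ) * Complex.I) ∂τ) := by
      refine hs.congr_fun fun k => ?_
      exact (hev k).symm
    refine hs2.unique ?_
    rw [Complex.hasSum_ofReal]
    apply HasSum.mul_left
    have h3 := ((Ph_ent N).norm (R ^ 2 * ‖x‖ ^ 2 / 4)).of_norm.hasSum
    simpa [phi, ev, Ph] using h3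
  · intro m hm
    rcases Nat.even_or_odd' m with ⟨k, rfl | rfl⟩
    · exact absurd ⟨k, rfl⟩ hm
    · rw [mom_odd hinv]; simp

end mom

end Bg

namespace Bg
open MeasureTheory Metric Set Filter Topology
open scoped RealInnerProductSpace NNReal ENNReal ComplexConjugate

variable {n : ℕ}

lemma sph_phi (hn : 2 ≤ n) {R : ℝ} (hR : 0 < R) (x : EuclideanSpace ℝ (Fin n)) :
    ∫ y, Complex.exp (((⟪x, y⟫ : ℝ) : ℂ) * Complex.I) ∂(sph n R) =
      (((sph n R).real univ * phi (n - 2) (R ^ 2 * ‖x‖ ^ 2 / 4) : ℝ) : ℂ) := by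
  have := sph_finite hn hR
  refine ft_phi ((sph_ae R).mono fun x hx => hx.le) (fun e => sph_inv R e) ⟨0, by omega⟩ (n - 2) (fun k => ?_) x
  have h : ∫ y, (y ⟨0, by omega⟩) ^ (2 * k) * ‖y‖ ^ 2 ∂(sph n R) = ∫ y, (y ⟨0, by omega⟩) ^ (2 * k) * R ^ 2 ∂(sph n R) := by
    apply integral_congr_ae
    filter_upwards [sph_ae R] with y hy
    rw [hy]
  rw [h, integral_mul_const, Nat.cast_sub hn]
  push_cast
  ring

lemma ball_inv (R : ℝ) (e : EuclideanSpace ℝ (Fin n) ≃ₗᵢ[ℝ] EuclideanSpace ℝ (Fin n)) :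
    MeasurePreserving e (volume.restrict (ball 0 R)) (volume.restrict (ball 0 R)) := by
  have h := e.measurePreserving.restrict_preimage (s := ball (0 : EuclideanSpace ℝ (Fin n)) R) measurableSet_ball
  have : e ⁻¹' (ball 0 R) = ball 0 R := by ext x; simp
  rwa [this] at h

lemma ball_mom {R : ℝ} (hR : 0 < R) (i0 : Fin n) (k : ℕ) :
    ((n:ℝ) + 2 * k + 2) * ∫ y in ball (0 : EuclideanSpace ℝ (Fin n)) R, (y i0) ^ (2 * k) * ‖y‖ ^ 2 =
      (n + 2 * k) * R ^ 2 * ∫ y in ball (0 : EuclideanSpace ℝ (Fin n)) R, (y i0) ^ (2 * k) := by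
  have hfin : ∀ r : ℝ, IsFiniteMeasure (volume.restrict (ball (0 : EuclideanSpace ℝ (Fin n)) r)) := fun r =>
    ⟨by rw [Measure.restrict_apply_univ]; exact measure_ball_lt_top⟩
  have hae : ∀ r : ℝ, ∀ᵐ y ∂(volume.restrict (ball (0 : EuclideanSpace ℝ (Fin n)) r)), ‖y‖ ≤ r := fun r => by
    filter_upwards [ae_restrict_mem measurableSet_ball] with y hy
    exact (mem_ball_zero_iff.mp hy).le
  set I := ∫ y in ball (0 : EuclideanSpace ℝ (Fin n)) 1, (y i0) ^ (2 * k) with hI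
  have hscale : ∀ r : ℝ, 0 < r → ∫ y in ball (0 : EuclideanSpace ℝ (Fin n)) r, (y i0) ^ (2 * k) = r ^ (n + 2 * k) * I := by
    intro r hr
    have h := Measure.setIntegral_comp_smul_of_pos (volume : Measure (EuclideanSpace ℝ (Fin n)))
      (fun y => (y i0) ^ (2 * k)) (ball 0 1) hr
    rw [_root_.smul_ball hr.ne', smul_zero, Real.norm_of_nonneg hr.le, mul_one] at h
    simp only [PiLp.smul_apply, smul_eq_mul, mul_pow, finrank_euclideanSpace, Fintype.card_fin] at h
    rw [integral_const_mul, ← hI] at h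
    have hr' : r ^ n ≠ 0 := by positivity
    field_simp at h
    rw [← h]; ring
  have hfub : ∫ r in Ioo 0 R, ∫ y in ball (0 : EuclideanSpace ℝ (Fin n)) R, (if ‖y‖ < r then 2 * r * (y i0) ^ (2 * k) else 0) =
      ∫ y in ball (0 : EuclideanSpace ℝ (Fin n)) R, ∫ r in Ioo 0 R, (if ‖y‖ < r then 2 * r * (y i0) ^ (2 * k) else 0) := by
    have := hfin R
    apply integral_integral_swap
    have hd : Integrable (fun p : ℝ × EuclideanSpace ℝ (Fin n) => 2 * p.1 * (p.2 i0) ^ (2 * k))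
        ((volume.restrict (Ioo 0 R)).prod (volume.restrict (ball 0 R))) := by
      apply Integrable.mul_prod (f := fun r : ℝ => 2 * r) (g := fun y : EuclideanSpace ℝ (Fin n) => (y i0) ^ (2 * k))
      · exact ((by fun_prop : Continuous fun r : ℝ => 2 * r).integrableOn_Icc (a := 0) (b := R)).mono_set Ioo_subset_Icc_self
      · exact cint (hae R) (by fun_prop)
    have hm : MeasurableSet {p : ℝ × EuclideanSpace ℝ (Fin n) | ‖p.2‖ < p.1} :=
      (isOpen_lt (by fun_prop) (by fun_prop)).measurableSet
    exact hd.indicator hm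
  have hL : ∫ r in Ioo 0 R, ∫ y in ball (0 : EuclideanSpace ℝ (Fin n)) R, (if ‖y‖ < r then 2 * r * (y i0) ^ (2 * k) else 0) =
      2 * I * (R ^ (n + 2 * k + 2) / (n + 2 * k + 2)) := by
    have : ∀ r ∈ Ioo 0 R, ∫ y in ball (0 : EuclideanSpace ℝ (Fin n)) R, (if ‖y‖ < r then 2 * r * (y i0) ^ (2 * k) else 0) =
        2 * I * r ^ (n + 2 * k + 1) := by
      intro r hr
      have e1 : (fun y : EuclideanSpace ℝ (Fin n) => (if ‖y‖ < r then 2 * r * (y i0) ^ (2 * k) else 0)) =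
          (ball (0 : EuclideanSpace ℝ (Fin n)) r).indicator fun y => 2 * r * (y i0) ^ (2 * k) := by
        ext y
        simp [indicator]
      rw [e1, setIntegral_indicator measurableSet_ball, inter_eq_self_of_subset_right (ball_subset_ball hr.2.le),
        integral_const_mul, hscale r hr.1]
      ring
    rw [setIntegral_congr_fun measurableSet_Ioo this, ← integral_Ioc_eq_integral_Ioo,
      ← intervalIntegral.integral_of_le hR.le, intervalIntegral.integral_const_mul, integral_pow]
    rw [zero_pow (by omega), sub_zero]
    push_cast
    ring
  have hRr : ∫ y in ball (0 : EuclideanSpace ℝ (Fin n)) R, ∫ r in Ioo 0 R, (if ‖y‖ < r then 2 * r * (y i0) ^ (2 * k) else 0) =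
      ∫ y in ball (0 : EuclideanSpace ℝ (Fin n)) R, ((y i0) ^ (2 * k) * R ^ 2 - (y i0) ^ (2 * k) * ‖y‖ ^ 2) := by
    apply setIntegral_congr_fun measurableSet_ball
    intro y hy
    have hy' : ‖y‖ < R := by simpa using hy
    have e1 : (fun r : ℝ => (if ‖y‖ < r then 2 * r * (y i0) ^ (2 * k) else 0)) =
        (Ioi ‖y‖).indicator fun r => 2 * r * (y i0) ^ (2 * k) := by
      ext r; simp [indicator]
    have e2 : Ioo 0 R ∩ Ioi ‖y‖ = Ioo ‖y‖ R := by
      ext r; constructor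
      · rintro ⟨⟨_, h⟩, h2⟩; exact ⟨h2, h⟩
      · rintro ⟨h2, h⟩; exact ⟨⟨(norm_nonneg y).trans_lt h2, h⟩, h2⟩
    simp only
    rw [e1, setIntegral_indicator measurableSet_Ioi, e2, ← integral_Ioc_eq_integral_Ioo,
      ← intervalIntegral.integral_of_le hy'.le, intervalIntegral.integral_mul_const, intervalIntegral.integral_const_mul, integral_id]
    ring
  have := hfin R
  rw [hL, hRr, integral_sub (cint (hae R) (by fun_prop)) (cint (hae R) (by fun_prop)), integral_mul_const, hscale R hR] at hfub
  rw [hscale R hR]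
  have hne : (n:ℝ) + 2 * k + 2 ≠ 0 := by positivity
  have : ∫ y in ball (0 : EuclideanSpace ℝ (Fin n)) R, (y i0) ^ (2 * k) * ‖y‖ ^ 2 =
     R ^ (n + 2 * k) * I * R ^ 2 - 2 * I * (R ^ (n + 2 * k + 2) / (n + 2 * k + 2)) := by linarith
  rw [this]
  field_simp
  ring

lemma ball_phi (hn : 2 ≤ n) {R : ℝ} (hR : 0 < R) (x : EuclideanSpace ℝ (Fin n)) :
    ∫ y in ball (0 : EuclideanSpace ℝ (Fin n)) R, Complex.exp (((⟪x, y⟫ : ℝ) : ℂ) * Complex.I) =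
      ((volume.real (ball (0 : EuclideanSpace ℝ (Fin n)) R) * phi n (R ^ 2 * ‖x‖ ^ 2 / 4) : ℝ) : ℂ) := by
  have : IsFiniteMeasure (volume.restrict (ball (0 : EuclideanSpace ℝ (Fin n)) R)) :=
    ⟨by rw [Measure.restrict_apply_univ]; exact measure_ball_lt_top⟩
  have h := ft_phi (τ := volume.restrict (ball (0 : EuclideanSpace ℝ (Fin n)) R)) (R := R) (by
    filter_upwards [ae_restrict_mem measurableSet_ball] with y hy
    exact (mem_ball_zero_iff.mp hy).le) (fun e => ball_inv R e) ⟨0, by omega⟩ n (fun k => ball_mom hR _ k) x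
  rw [h]
  simp [Measure.real]

lemma ball_vol_pos {R : ℝ} (hR : 0 < R) : 0 < volume.real (ball (0 : EuclideanSpace ℝ (Fin n)) R) :=
  ENNReal.toReal_pos (measure_ball_pos volume _ hR).ne' measure_ball_lt_top.ne

end Bg

namespace Bg
open MeasureTheory Metric Set Filter Topology
open scoped RealInnerProductSpace NNReal ENNReal ComplexConjugate

variable {n : ℕ}

/-- evaluation of a polynomial at a point of Euclidean space -/
noncomputable def pe (P : MvPolynomial (Fin n) ℝ) (y : EuclideanSpace ℝ (Fin n)) : ℝ :=
  MvPolynomial.eval (fun i => y i) P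

lemma pe_cont (P : MvPolynomial (Fin n) ℝ) : Continuous (pe P) :=
  (MvPolynomial.continuous_eval P).comp (by fun_prop)

/-- Laplacian -/
noncomputable def lap (P : MvPolynomial (Fin n) ℝ) : MvPolynomial (Fin n) ℝ :=
  ∑ i, MvPolynomial.pderiv i (MvPolynomial.pderiv i P)

/-- homogeneous harmonic polynomials -/
def Harm (l : ℕ) (P : MvPolynomial (Fin n) ℝ) : Prop := P.IsHomogeneous l ∧ lap P = 0

lemma pderiv_swap (i j : Fin n) (P : MvPolynomial (Fin n) ℝ) :
    MvPolynomial.pderiv i (MvPolynomial.pderiv j P) = MvPolynomial.pderiv j (MvPolynomial.pderiv i P) := by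
  have : ⁅(MvPolynomial.pderiv i : Derivation ℝ (MvPolynomial (Fin n) ℝ) (MvPolynomial (Fin n) ℝ)), (MvPolynomial.pderiv j : Derivation ℝ (MvPolynomial (Fin n) ℝ) (MvPolynomial (Fin n) ℝ))⁆ = 0 := by
    apply MvPolynomial.derivation_ext
    intro k
    rw [Derivation.commutator_apply]
    simp only [MvPolynomial.pderiv_X, Pi.single_apply]
    split_ifs <;> simp
  have h := congrArg (fun D => D P) this
  simp only [Derivation.commutator_apply, Derivation.zero_apply] at h
  exact sub_eq_zero.mp h

lemma lap_pderiv (j : Fin n) (P : MvPolynomial (Fin n) ℝ) : lap (MvPolynomial.pderiv j P) = MvPolynomial.pderiv j (lap P) := by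
  unfold lap
  rw [map_sum]
  apply Finset.sum_congr rfl
  intro i _
  rw [pderiv_swap i j P, pderiv_swap i j]

lemma lap_mul (P Q : MvPolynomial (Fin n) ℝ) : lap (P * Q) = lap P * Q + P * lap Q +
    2 * ∑ i, MvPolynomial.pderiv i P * MvPolynomial.pderiv i Q := by
  unfold lap
  rw [Finset.sum_mul, Finset.mul_sum, Finset.mul_sum, ← Finset.sum_add_distrib, ← Finset.sum_add_distrib]
  apply Finset.sum_congr rfl
  intro i _
  simp only [MvPolynomial.pderiv_mul, map_add]
  ring

lemma lap_add (P Q : MvPolynomial (Fin n) ℝ) : lap (P + Q) = lap P + lap Q := by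
  simp [lap, Finset.sum_add_distrib]

lemma lap_C (a : ℝ) : lap (MvPolynomial.C a : MvPolynomial (Fin n) ℝ) = 0 := by
  simp [lap]

lemma lap_C_mul (a : ℝ) (P : MvPolynomial (Fin n) ℝ) : lap (MvPolynomial.C a * P) = MvPolynomial.C a * lap P := by
  rw [lap_mul, lap_C]; simp

lemma lap_X (j : Fin n) : lap (MvPolynomial.X j : MvPolynomial (Fin n) ℝ) = 0 := by
  unfold lap
  apply Finset.sum_eq_zero
  intro i _
  rw [MvPolynomial.pderiv_X, Pi.single_apply]
  split_ifs <;> simp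

lemma Harm_pderiv {l : ℕ} {H : MvPolynomial (Fin n) ℝ} (h : Harm (l + 1) H) (j : Fin n) : Harm l (MvPolynomial.pderiv j H) :=
  ⟨h.1.pderiv, by rw [lap_pderiv, h.2, map_zero]⟩

lemma Harm_C_mul {l : ℕ} {H : MvPolynomial (Fin n) ℝ} (h : Harm l H) (a : ℝ) : Harm l (MvPolynomial.C a * H) :=
  ⟨h.1.C_mul a, by rw [lap_C_mul, h.2, mul_zero]⟩

lemma lap_X_mul (j : Fin n) (H : MvPolynomial (Fin n) ℝ) :
    lap (MvPolynomial.X j * H) = MvPolynomial.X j * lap H + 2 * MvPolynomial.pderiv j H := by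
  rw [lap_mul, lap_X, Finset.sum_eq_single j]
  · simp
  · intro i _ hi
    rw [MvPolynomial.pderiv_X_of_ne hi.symm]; simp
  · simp

/-- squared norm polynomial -/
noncomputable def rho (n : ℕ) : MvPolynomial (Fin n) ℝ := ∑ i, MvPolynomial.X i ^ 2

lemma pderiv_rho (i : Fin n) : MvPolynomial.pderiv i (rho n) = 2 * MvPolynomial.X i := by
  unfold rho
  rw [map_sum, Finset.sum_eq_single i]
  · rw [MvPolynomial.pderiv_pow, MvPolynomial.pderiv_X_self]; simp
  · intro j _ hj
    rw [MvPolynomial.pderiv_pow, MvPolynomial.pderiv_X_of_ne hj]; simp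
  · simp

lemma lap_rho : lap (rho n) = MvPolynomial.C (2 * (n:ℝ)) := by
  unfold lap
  have : ∀ i : Fin n, MvPolynomial.pderiv i (MvPolynomial.pderiv i (rho n)) = MvPolynomial.C 2 := by
    intro i
    rw [pderiv_rho, show (2 : MvPolynomial (Fin n) ℝ) = MvPolynomial.C 2 from rfl, MvPolynomial.pderiv_C_mul, MvPolynomial.pderiv_X_self]
    simp
  simp only [this]
  rw [Finset.sum_const, Finset.card_univ, Fintype.card_fin, nsmul_eq_mul, map_mul, map_natCast]
  ring

lemma lap_rho_mul {l : ℕ} {G : MvPolynomial (Fin n) ℝ} (h : Harm l G) :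
    lap (rho n * G) = MvPolynomial.C (2 * ((n:ℝ) + 2 * l)) * G := by
  rw [lap_mul, lap_rho, h.2]
  have e : ∑ i, MvPolynomial.pderiv i (rho n) * MvPolynomial.pderiv i G = 2 * ∑ i, MvPolynomial.X i * MvPolynomial.pderiv i G := by
    rw [Finset.mul_sum]
    apply Finset.sum_congr rfl
    intro i _
    rw [pderiv_rho]; ring
  rw [e, h.1.sum_X_mul_pderiv]
  simp only [nsmul_eq_mul, map_mul, map_add, map_natCast, show (MvPolynomial.C 2 : MvPolynomial (Fin n) ℝ) = 2 from rfl]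
  ring

lemma rho_hom : (rho n).IsHomogeneous 2 :=
  MvPolynomial.IsHomogeneous.sum _ _ _ fun i _ => MvPolynomial.isHomogeneous_X_pow i 2

lemma Harm_step {l : ℕ} {H : MvPolynomial (Fin n) ℝ} (h : Harm (l + 1) H) (hn : 0 < n) (j : Fin n) :
    Harm (l + 2) (MvPolynomial.X j * H - MvPolynomial.C (1 / ((n:ℝ) + 2 * l)) * (rho n * MvPolynomial.pderiv j H)) := by
  have hG := Harm_pderiv h j
  constructor
  · apply MvPolynomial.IsHomogeneous.sub
    · have := (MvPolynomial.isHomogeneous_X ℝ j).mul h.1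
      rwa [show 1 + (l + 1) = l + 2 by omega] at this
    · apply MvPolynomial.IsHomogeneous.C_mul
      have := (rho_hom (n := n)).mul hG.1
      rwa [show 2 + l = l + 2 by omega] at this
  · have hsub : ∀ P Q : MvPolynomial (Fin n) ℝ, lap (P - Q) = lap P - lap Q := by
      intro P Q; simp [lap, Finset.sum_sub_distrib]
    rw [hsub, lap_C_mul, lap_rho_mul hG, lap_X_mul, h.2, ← mul_assoc, ← map_mul]
    have : 1 / ((n:ℝ) + 2 * l) * (2 * ((n:ℝ) + 2 * l)) = 2 := by
      have : (0:ℝ) < n := by exact_mod_cast hn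
      field_simp
    rw [this, show (MvPolynomial.C 2 : MvPolynomial (Fin n) ℝ) = 2 from rfl]
    ring

lemma Harm_zero {H : MvPolynomial (Fin n) ℝ} (h : Harm 0 H) : ∃ a, H = MvPolynomial.C a := by
  have := (MvPolynomial.totalDegree_zero_iff_isHomogeneous (Fin n) (p := H)).mpr h.1
  exact ⟨_, MvPolynomial.totalDegree_eq_zero_iff_eq_C.mp this⟩

lemma Harm_C (a : ℝ) : Harm 0 (MvPolynomial.C a : MvPolynomial (Fin n) ℝ) :=
  ⟨MvPolynomial.isHomogeneous_C _ _, lap_C a⟩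

lemma Harm_X (j : Fin n) : Harm 1 (MvPolynomial.X j : MvPolynomial (Fin n) ℝ) :=
  ⟨MvPolynomial.isHomogeneous_X _ _, lap_X j⟩

lemma pe_rho (y : EuclideanSpace ℝ (Fin n)) : pe (rho n) y = ‖y‖ ^ 2 := by
  simp [pe, rho, EuclideanSpace.real_norm_sq_eq]

/-- On the sphere every polynomial is a combination of harmonic ones. -/
lemma harm_decomp (hn : 0 < n) (R : ℝ) (P : MvPolynomial (Fin n) ℝ) :
    ∃ Q ∈ Submodule.span ℝ {H : MvPolynomial (Fin n) ℝ | ∃ l, Harm l H}, ∀ y, ‖y‖ = R → pe P y = pe Q y := by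
  induction P using MvPolynomial.induction_on with
  | C a => exact ⟨_, Submodule.subset_span ⟨0, Harm_C a⟩, fun _ _ => rfl⟩
  | add P Q hP hQ =>
    obtain ⟨P', hP', h1⟩ := hP
    obtain ⟨Q', hQ', h2⟩ := hQ
    refine ⟨P' + Q', Submodule.add_mem _ hP' hQ', fun y hy => ?_⟩
    have := h1 y hy
    have := h2 y hy
    simp only [pe, map_add] at *
    linarith
  | mul_X P j hP =>
    obtain ⟨P', hP', h1⟩ := hP
    have key : ∀ H ∈ Submodule.span ℝ {H : MvPolynomial (Fin n) ℝ | ∃ l, Harm l H},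
        ∃ Q ∈ Submodule.span ℝ {H : MvPolynomial (Fin n) ℝ | ∃ l, Harm l H}, ∀ y, ‖y‖ = R → pe (MvPolynomial.X j * H) y = pe Q y := by
      intro H hH
      induction hH using Submodule.span_induction with
      | mem H h =>
        obtain ⟨l, hl⟩ := h
        rcases l with _ | l
        · obtain ⟨a, rfl⟩ := Harm_zero hl
          refine ⟨_, Submodule.subset_span ⟨1, Harm_C_mul (Harm_X j) a⟩, fun y _ => by rw [mul_comm]⟩
        · refine ⟨_, Submodule.add_mem _ (Submodule.subset_span ⟨_, Harm_step hl hn j⟩)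
            (Submodule.subset_span ⟨_, Harm_C_mul (Harm_pderiv hl j) (1 / ((n:ℝ) + 2 * l) * R ^ 2)⟩), fun y hy => ?_⟩
          have hr := pe_rho y
          rw [hy] at hr
          simp only [pe, map_add, map_sub, map_mul, MvPolynomial.eval_C] at hr ⊢
          rw [hr]; ring
      | zero => exact ⟨0, Submodule.zero_mem _, fun y _ => by simp⟩
      | add P Q _ _ hP hQ =>
        obtain ⟨P', hP', h1⟩ := hP
        obtain ⟨Q', hQ', h2⟩ := hQ
        refine ⟨P' + Q', Submodule.add_mem _ hP' hQ', fun y hy => ?_⟩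
        have := h1 y hy
        have := h2 y hy
        simp only [pe, map_add, map_mul] at *
        linarith
      | smul a P _ hP =>
        obtain ⟨P', hP', h1⟩ := hP
        refine ⟨a • P', Submodule.smul_mem _ a hP', fun y hy => ?_⟩
        have := h1 y hy
        simp only [pe, map_mul, MvPolynomial.smul_eval] at *
        linear_combination a * this
    obtain ⟨Q, hQ, h2⟩ := key P' hP'
    refine ⟨Q, hQ, fun y hy => ?_⟩
    rw [← h2 y hy]
    have := h1 y hy
    simp only [pe, map_mul] at *
    rw [this]; ring

lemma pe_smul {l : ℕ} {H : MvPolynomial (Fin n) ℝ} (h : H.IsHomogeneous l) (c : ℝ) (y : EuclideanSpace ℝ (Fin n)) :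
    pe H (c • y) = c ^ l * pe H y := by
  unfold pe
  rw [MvPolynomial.eval_eq, MvPolynomial.eval_eq, Finset.mul_sum]
  apply Finset.sum_congr rfl
  intro d hd
  have e : ∏ i ∈ d.support, ((c • y) i) ^ d i = c ^ l * ∏ i ∈ d.support, (y i) ^ d i := by
    have : ∑ i ∈ d.support, d i = l := by
      have := h.degree_eq_sum_deg_support hd
      exact this.symm
    rw [← this, ← Finset.prod_pow_eq_pow_sum, ← Finset.prod_mul_distrib]
    apply Finset.prod_congr rfl
    intro i _
    simp [mul_pow]
  rw [e]; ring

lemma pe_deriv (P : MvPolynomial (Fin n) ℝ) (x : EuclideanSpace ℝ (Fin n)) (j : Fin n) :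
    HasDerivAt (fun s : ℝ => pe P (x + s • EuclideanSpace.single j (1:ℝ))) (pe (MvPolynomial.pderiv j P) x) 0 := by
  induction P using MvPolynomial.induction_on with
  | C a => simpa [pe] using hasDerivAt_const (0:ℝ) a
  | add P Q hP hQ => simpa [pe] using! hP.add hQ
  | mul_X P i hP =>
    have h1 : HasDerivAt (fun s : ℝ => (x + s • EuclideanSpace.single j (1:ℝ)) i) (pe (MvPolynomial.pderiv j (MvPolynomial.X i)) x) 0 := by
      have : HasDerivAt (fun s : ℝ => x i + s * (EuclideanSpace.single j (1:ℝ) : EuclideanSpace ℝ (Fin n)) i) ((EuclideanSpace.single j (1:ℝ) : EuclideanSpace ℝ (Fin n)) i) 0 := by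
        simpa using ((hasDerivAt_id (0:ℝ)).mul_const ((EuclideanSpace.single j (1:ℝ) : EuclideanSpace ℝ (Fin n)) i)).const_add (x i)
      have h3 : pe (MvPolynomial.pderiv j (MvPolynomial.X i)) x = (EuclideanSpace.single j (1:ℝ) : EuclideanSpace ℝ (Fin n)) i := by
        rw [MvPolynomial.pderiv_X]
        by_cases hij : i = j
        · subst hij; simp [pe]
        · simp [pe, hij]
      rw [h3]
      exact this
    have h2 := hP.mul h1
    have h3 : (fun s : ℝ => pe (P * MvPolynomial.X i) (x + s • EuclideanSpace.single j (1:ℝ))) =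
        (fun s : ℝ => pe P (x + s • EuclideanSpace.single j (1:ℝ))) * (fun s : ℝ => (x + s • EuclideanSpace.single j (1:ℝ)) i) := by
      ext s; simp [pe]
    rw [h3]
    refine h2.congr_deriv ?_
    simp [pe]
    ring

end Bg

namespace Bg
open MeasureTheory Metric Set Filter Topology
open scoped RealInnerProductSpace NNReal ENNReal ComplexConjugate

variable {n : ℕ}

lemma ft_deriv {τ : Measure (EuclideanSpace ℝ (Fin n))} [IsFiniteMeasure τ] {R : ℝ} (hτ : ∀ᵐ x ∂τ, ‖x‖ ≤ R)
    {f : EuclideanSpace ℝ (Fin n) → ℝ} (hf : Continuous f) (x : EuclideanSpace ℝ (Fin n)) (j : Fin n) :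
    HasDerivAt (fun s : ℝ => ft τ f (x + s • EuclideanSpace.single j (1:ℝ)))
      (Complex.I * ft τ (fun y => y j * f y) x) 0 := by
  have hin : ∀ (s : ℝ) (y : EuclideanSpace ℝ (Fin n)), ⟪x + s • EuclideanSpace.single j (1:ℝ), y⟫ = ⟪x, y⟫ + s * y j := by
    intro s y
    rw [inner_add_left, inner_smul_left, EuclideanSpace.inner_single_left]; simp
  have h := (hasDerivAt_integral_of_dominated_loc_of_deriv_le (μ := τ) (𝕜 := ℝ) (x₀ := (0:ℝ)) (s := univ)
    (F := fun (s : ℝ) (y : EuclideanSpace ℝ (Fin n)) => (f y : ℂ) * Complex.exp (((⟪x, y⟫ + s * y j : ℝ) : ℂ) * Complex.I))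
    (F' := fun (s : ℝ) (y : EuclideanSpace ℝ (Fin n)) => (f y : ℂ) * (Complex.exp (((⟪x, y⟫ + s * y j : ℝ) : ℂ) * Complex.I) * (((y j : ℝ) : ℂ) * Complex.I)))
    (bound := fun y => ‖f y‖ * ‖y j‖) univ_mem ?_ ?_ ?_ ?_ ?_ ?_).2
  · have e1 : (fun s : ℝ => ft τ f (x + s • EuclideanSpace.single j (1:ℝ))) =
        fun s : ℝ => ∫ y, (f y : ℂ) * Complex.exp (((⟪x, y⟫ + s * y j : ℝ) : ℂ) * Complex.I) ∂τ := by
      ext s; unfold ft; simp only [hin]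
    rw [e1]
    refine h.congr_deriv ?_
    unfold ft
    rw [← integral_const_mul]
    congr 1; ext y
    simp only [zero_mul, add_zero]
    push_cast; ring
  · filter_upwards with s
    apply Continuous.aestronglyMeasurable; fun_prop
  · exact cint hτ (by fun_prop)
  · apply Continuous.aestronglyMeasurable; fun_prop
  · filter_upwards with y s _
    rw [norm_mul, norm_mul, norm_mul, Complex.norm_exp_ofReal_mul_I, Complex.norm_I, Complex.norm_real, Complex.norm_real]
    simp
  · exact cint hτ (by fun_prop)
  · filter_upwards with y s _
    apply HasDerivAt.const_mul
    apply HasDerivAt.cexp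
    have : HasDerivAt (fun s : ℝ => ⟪x, y⟫ + s * y j) (y j) s := by
      simpa using ((hasDerivAt_id s).mul_const (y j)).const_add ⟪x, y⟫
    exact this.ofReal_comp.mul_const _

lemma pe_lin (H : MvPolynomial (Fin n) ℝ) {l : ℕ} (h : H.IsHomogeneous l) (y : EuclideanSpace ℝ (Fin n)) :
    ∑ j, y j * pe (MvPolynomial.pderiv j H) y = l * pe H y := by
  have := congrArg (fun P => pe P y) h.sum_X_mul_pderiv
  simpa [pe] using this

theorem funk_hecke (hn : 2 ≤ n) {R : ℝ} (hR : 0 < R) (l : ℕ) :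
    ∃ c : ℂ, c ≠ 0 ∧ ∀ H : MvPolynomial (Fin n) ℝ, Harm l H → ∀ x, x ≠ 0 →
      ft (sph n R) (pe H) x = c * ((pe H x * phi (n - 2 + 2 * l) (R ^ 2 * ‖x‖ ^ 2 / 4) : ℝ) : ℂ) := by
  have hfin := sph_finite hn hR
  have hae : ∀ᵐ x ∂(sph n R), ‖x‖ ≤ R := (sph_ae R).mono fun x hx => hx.le
  induction l with
  | zero =>
    refine ⟨((sph n R).real univ : ℂ), ?_, ?_⟩
    · have := sph_ne_zero hn hR
      simp [Measure.real, ENNReal.toReal_eq_zero_iff, this]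
    · intro H hH x _
      obtain ⟨a, rfl⟩ := Harm_zero hH
      unfold ft
      simp only [pe, MvPolynomial.eval_C]
      rw [integral_const_mul, sph_phi hn hR]
      push_cast
      simp; ring
  | succ l ih =>
    obtain ⟨c, hc, ih⟩ := ih
    have hnl : (0:ℝ) < n + 2 * l := by
      have : (2:ℝ) ≤ n := by exact_mod_cast hn
      positivity
    refine ⟨c * Complex.I * ((R ^ 2 / (n + 2 * l) : ℝ) : ℂ), ?_, ?_⟩
    · refine mul_ne_zero (mul_ne_zero hc Complex.I_ne_zero) ?_
      exact_mod_cast (by positivity : (R ^ 2 / (n + 2 * l) : ℝ) ≠ 0)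
    intro H hH x hx
    set t := R ^ 2 * ‖x‖ ^ 2 / 4 with ht
    have ht0 : t ≠ 0 := by
      have : 0 < ‖x‖ := norm_pos_iff.mpr hx
      positivity
    set m := n - 2 + 2 * l with hm
    have hmr : (m:ℝ) = n + 2 * l - 2 := by
      rw [hm]; push_cast [Nat.cast_sub hn]; ring
    have hpsi : psi m t / t = - (2 / (n + 2 * l)) * phi (m + 2) t := by
      have h := psi_next m t
      rw [hmr] at h
      field_simp
      linear_combination 2 * h
    have hj : ∀ j : Fin n, Complex.I * ft (sph n R) (fun y => y j * pe (MvPolynomial.pderiv j H) y) x =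
        c * ((pe (MvPolynomial.pderiv j (MvPolynomial.pderiv j H)) x * phi m t +
          (x j * pe (MvPolynomial.pderiv j H) x) * (R ^ 2 / 2 * (- (2 / (n + 2 * l)) * phi (m + 2) t)) : ℝ) : ℂ) := by
      intro j
      have d1 := ft_deriv hae (pe_cont (MvPolynomial.pderiv j H)) x j
      have dn : HasDerivAt (fun s : ℝ => R ^ 2 * ‖x + s • EuclideanSpace.single j (1:ℝ)‖ ^ 2 / 4) (R ^ 2 / 2 * x j) 0 := by
        have e : (fun s : ℝ => R ^ 2 * ‖x + s • EuclideanSpace.single j (1:ℝ)‖ ^ 2 / 4) =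
            fun s : ℝ => R ^ 2 * (‖x‖ ^ 2 + 2 * (s * x j) + s ^ 2) / 4 := by
          ext s
          rw [norm_add_sq_real, inner_smul_right, norm_smul, EuclideanSpace.inner_single_right]
          simp [mul_pow]
        rw [e]
        have := (((((hasDerivAt_id (0:ℝ)).mul_const (x j)).const_mul 2).const_add (‖x‖ ^ 2)).add (hasDerivAt_pow 2 (0:ℝ))).const_mul (R ^ 2)
        have := this.div_const 4
        refine this.congr_deriv ?_
        simp; ring
      have dp : HasDerivAt (fun s : ℝ => phi m (R ^ 2 * ‖x + s • EuclideanSpace.single j (1:ℝ)‖ ^ 2 / 4)) (psi m t / t * (R ^ 2 / 2 * x j)) 0 := by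
        have h := phi_diff m t ht0
        apply HasDerivAt.comp (h₂ := phi m) 0 _ dn
        simpa [ht] using h
      have d2 := ((pe_deriv (MvPolynomial.pderiv j H) x j).mul dp).ofReal_comp.const_mul c
      have hev : (fun s : ℝ => ft (sph n R) (pe (MvPolynomial.pderiv j H)) (x + s • EuclideanSpace.single j (1:ℝ))) =ᶠ[𝓝 0]
          fun s : ℝ => c * (((((fun s : ℝ => pe (MvPolynomial.pderiv j H) (x + s • EuclideanSpace.single j (1:ℝ))) *
            fun s : ℝ => phi m (R ^ 2 * ‖x + s • EuclideanSpace.single j (1:ℝ)‖ ^ 2 / 4)) s : ℝ)) : ℂ) := by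
        have hcont : Continuous fun s : ℝ => x + s • EuclideanSpace.single j (1:ℝ) := by fun_prop
        have : ∀ᶠ s : ℝ in 𝓝 0, x + s • EuclideanSpace.single j (1:ℝ) ≠ 0 :=
          hcont.continuousAt.eventually_ne (by simpa using hx)
        filter_upwards [this] with s hs
        rw [ih _ (Harm_pderiv hH j) _ hs]
        rfl
      have d3 := d1.unique (d2.congr_of_eventuallyEq hev)
      rw [d3, hpsi]
      simp only [zero_smul, add_zero]
      rw [← ht]
      congr 2
      ring
    have hsum : ((l:ℂ) + 1) * ft (sph n R) (pe H) x = ∑ j, ft (sph n R) (fun y => y j * pe (MvPolynomial.pderiv j H) y) x := by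
      unfold ft
      rw [← integral_finsetSum]
      · rw [← integral_const_mul]
        congr 1; ext y
        rw [← Finset.sum_mul, ← mul_assoc]
        congr 1
        have := pe_lin H hH.1 y
        rw [← Complex.ofReal_sum, this]
        push_cast; ring
      · intro j _
        have := pe_cont (MvPolynomial.pderiv j H)
        exact cint hae (by fun_prop)
    have hl : ∑ j, pe (MvPolynomial.pderiv j (MvPolynomial.pderiv j H)) x = 0 := by
      have := congrArg (fun P => pe P x) hH.2
      simpa [pe, lap] using this
    have hfinal : Complex.I * (((l:ℂ) + 1) * ft (sph n R) (pe H) x) =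
        c * ((((l + 1 : ℕ) : ℝ) * pe H x * (R ^ 2 / 2 * (- (2 / (n + 2 * l)) * phi (m + 2) t)) : ℝ) : ℂ) := by
      rw [hsum, Finset.mul_sum, Finset.sum_congr rfl (fun j _ => hj j), ← Finset.mul_sum, ← Complex.ofReal_sum,
        Finset.sum_add_distrib, ← Finset.sum_mul, ← Finset.sum_mul, hl, pe_lin H hH.1 x]
      simp
    have hl1 : ((l:ℂ) + 1) ≠ 0 := by exact_mod_cast Nat.succ_ne_zero l
    have hnlc : ((n:ℂ) + 2 * l) ≠ 0 := by exact_mod_cast hnl.ne'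
    apply mul_left_cancel₀ (mul_ne_zero Complex.I_ne_zero hl1)
    rw [mul_assoc, hfinal, show n - 2 + 2 * (l + 1) = m + 2 by omega]
    push_cast
    field_simp
    rw [Complex.I_sq]
    ring

end Bg

namespace Bg
open MeasureTheory Metric Set Filter Topology
open scoped RealInnerProductSpace NNReal ENNReal ComplexConjugate

variable {n : ℕ}

lemma lin_harm (b : EuclideanSpace ℝ (Fin n)) : ∃ H : MvPolynomial (Fin n) ℝ, Harm 1 H ∧ ∀ y, pe H y = ⟪b, y⟫ := by
  refine ⟨∑ j, MvPolynomial.C (b j) * MvPolynomial.X j, ⟨?_, ?_⟩, ?_⟩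
  · exact MvPolynomial.IsHomogeneous.sum _ _ _ fun j _ => (Harm_C_mul (Harm_X j) (b j)).1
  · have : ∀ s : Finset (Fin n), lap (∑ j ∈ s, MvPolynomial.C (b j) * MvPolynomial.X j) = 0 := by
      intro s
      induction s using Finset.induction_on with
      | empty => simp [lap]
      | insert a s ha ih => rw [Finset.sum_insert ha, lap_add, ih, (Harm_C_mul (Harm_X a) (b a)).2, add_zero]
    exact this _
  · intro y
    simp [pe, PiLp.inner_apply, mul_comm]

lemma harm_lin {H : MvPolynomial (Fin n) ℝ} (h : Harm 1 H) : ∃ c : EuclideanSpace ℝ (Fin n), ∀ y, pe H y = ⟪c, y⟫ := by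
  choose a ha using fun j => Harm_zero (Harm_pderiv (l := 0) h j)
  refine ⟨WithLp.toLp 2 a, fun y => ?_⟩
  have := pe_lin H h.1 y
  simp only [ha] at this
  simp only [pe, MvPolynomial.eval_C] at this
  simp only [pe]
  simp [PiLp.inner_apply]
  simp at this
  rw [← this]

lemma ft_lin_zero (hn : 2 ≤ n) {R : ℝ} (hR : 0 < R) (b x : EuclideanSpace ℝ (Fin n)) (hx : x ≠ 0)
    (h0 : phi n (R ^ 2 * ‖x‖ ^ 2 / 4) = 0) : ft (sph n R) (fun y => ⟪b, y⟫) x = 0 := by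
  obtain ⟨H, hH, hp⟩ := lin_harm b
  obtain ⟨c, -, h⟩ := funk_hecke hn hR 1
  have := h H hH x hx
  rw [show n - 2 + 2 * 1 = n by omega, h0] at this
  rw [show (fun y => ⟪b, y⟫) = pe H from (funext hp).symm, this]
  simp

lemma orth (hn : 2 ≤ n) {R k : ℝ} (hR : 0 < R) (hk : 0 < k) (h0 : phi n (R ^ 2 * k ^ 2 / 4) = 0)
    {V : EuclideanSpace ℝ (Fin n) → ℝ} (hV : Continuous V) (hft : ∀ ξ, ‖ξ‖ = k → ft (sph n R) V ξ = 0)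
    {l : ℕ} (hl : l ≠ 1) {H : MvPolynomial (Fin n) ℝ} (hH : Harm l H) : ∫ y, V y * pe H y ∂(sph n R) = 0 := by
  have hfin := sph_finite hn hR
  have hae : ∀ᵐ x ∂(sph n R), ‖x‖ ≤ R := (sph_ae R).mono fun x hx => hx.le
  obtain ⟨c, hc, hfh⟩ := funk_hecke hn hR l
  have hb := bourget n hn (R ^ 2 * k ^ 2 / 4) (by positivity) h0 l hl
  have hHc := pe_cont H
  have hnorm : ∀ w : EuclideanSpace ℝ (Fin n), ‖w‖ = R → ‖(k / R) • w‖ = k := by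
    intro w hw
    rw [norm_smul, hw, Real.norm_eq_abs, abs_of_pos (by positivity)]
    field_simp
  have h1 : ∫ w, (pe H w : ℂ) * ft (sph n R) V ((k / R) • w) ∂(sph n R) = 0 := by
    rw [← integral_zero (EuclideanSpace ℝ (Fin n)) ℂ (μ := sph n R)]
    apply integral_congr_ae
    filter_upwards [sph_ae R] with w hw
    rw [hft _ (hnorm w hw), mul_zero]
  have h2 : ∫ w, (pe H w : ℂ) * ft (sph n R) V ((k / R) • w) ∂(sph n R) =
      ∫ y, (V y : ℂ) * ft (sph n R) (pe H) ((k / R) • y) ∂(sph n R) := by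
    unfold ft
    simp only [← integral_const_mul]
    rw [integral_integral_swap]
    · congr 1; ext y; congr 1; ext w
      rw [inner_smul_left, inner_smul_left, real_inner_comm]
      ring
    · apply cint (R := R)
      · filter_upwards [Measure.quasiMeasurePreserving_fst.ae hae, Measure.quasiMeasurePreserving_snd.ae hae] with p h1 h2
        exact max_le h1 h2
      · simp only [Function.uncurry_def]
        fun_prop
  have h3 : ∫ y, (V y : ℂ) * ft (sph n R) (pe H) ((k / R) • y) ∂(sph n R) =
      (c * (((k / R) ^ l * phi (n - 2 + 2 * l) (R ^ 2 * k ^ 2 / 4) : ℝ) : ℂ)) * ((∫ y, V y * pe H y ∂(sph n R) : ℝ) : ℂ) := by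
    rw [← integral_complex_ofReal, ← integral_const_mul]
    apply integral_congr_ae
    filter_upwards [sph_ae R] with y hy
    have hy0 : (k / R) • y ≠ 0 := by
      rw [← norm_pos_iff, hnorm y hy]; exact hk
    rw [hfh H hH _ hy0, hnorm y hy, pe_smul hH.1]
    push_cast; ring
  rw [h2, h3] at h1
  have hne : (c * (((k / R) ^ l * phi (n - 2 + 2 * l) (R ^ 2 * k ^ 2 / 4) : ℝ) : ℂ)) ≠ 0 := by
    refine mul_ne_zero hc ?_
    have : (k / R) ^ l * phi (n - 2 + 2 * l) (R ^ 2 * k ^ 2 / 4) ≠ 0 := mul_ne_zero (by positivity) hb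
    exact_mod_cast this
  have := (mul_eq_zero.mp h1).resolve_left hne
  exact_mod_cast this

lemma sph_second (hn : 2 ≤ n) {R : ℝ} (hR : 0 < R) : ∃ a : ℝ, a ≠ 0 ∧ ∀ b c : EuclideanSpace ℝ (Fin n),
    ∫ y, ⟪b, y⟫ * ⟪c, y⟫ ∂(sph n R) = a * ⟪b, c⟫ := by
  have hfin := sph_finite hn hR
  have hae : ∀ᵐ x ∂(sph n R), ‖x‖ ≤ R := (sph_ae R).mono fun x hx => hx.le
  let i0 : Fin n := ⟨0, by omega⟩
  refine ⟨∫ y, (y i0) ^ 2 ∂(sph n R), ?_, ?_⟩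
  · intro h
    have := sph_full hn hR (f := fun y => y i0) (by fun_prop) h (EuclideanSpace.single i0 R) (by simp [abs_of_pos hR])
    simp at this
    exact hR.ne' this
  · intro b c
    have e1 := mom_rad (fun e => sph_inv R e) i0 (b + c) 2
    have e2 := mom_rad (fun e => sph_inv R e) i0 b 2
    have e3 := mom_rad (fun e => sph_inv R e) i0 c 2
    have e4 : ∫ y, ⟪b + c, y⟫ ^ 2 ∂(sph n R) = ((∫ y, ⟪b, y⟫ ^ 2 ∂(sph n R)) + (∫ y, ⟪c, y⟫ ^ 2 ∂(sph n R))) +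
        2 * ∫ y, ⟪b, y⟫ * ⟪c, y⟫ ∂(sph n R) := by
      rw [← integral_const_mul, ← integral_add, ← integral_add]
      · congr 1; ext y; rw [inner_add_left]; ring
      all_goals exact cint hae (by fun_prop)
    rw [e1, e2, e3, norm_add_sq_real] at e4
    linarith

lemma dense_zero (hn : 2 ≤ n) {R : ℝ} (hR : 0 < R) {W : EuclideanSpace ℝ (Fin n) → ℝ} (hW : Continuous W)
    (h : ∀ P, ∫ y, W y * pe P y ∂(sph n R) = 0) : ∀ x, ‖x‖ = R → W x = 0 := by
  have hfin := sph_finite hn hR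
  have hae : ∀ᵐ x ∂(sph n R), ‖x‖ ≤ R := (sph_ae R).mono fun x hx => hx.le
  apply sph_full hn hR hW
  let co : Fin n → C(EuclideanSpace ℝ (Fin n), ℝ) := fun i => ⟨fun y => y i, by fun_prop⟩
  have hpe : ∀ P y, (MvPolynomial.aeval (R := ℝ) co P) y = pe P y := by
    intro P y
    induction P using MvPolynomial.induction_on with
    | C a => simp [pe]
    | add P Q hP hQ => simp [pe] at hP hQ ⊢; rw [hP, hQ]
    | mul_X P i hP => simp [pe] at hP ⊢; rw [hP]; rfl
  have hsep : (MvPolynomial.aeval (R := ℝ) co).range.SeparatesPoints := by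
    intro x y hxy
    have : ∃ i, x i ≠ y i := by
      by_contra hcon; push Not at hcon; exact hxy (by ext i; exact hcon i)
    obtain ⟨i, hi⟩ := this
    exact ⟨fun y => y i, ⟨co i, ⟨MvPolynomial.X i, by simp⟩, rfl⟩, hi⟩
  have hbound : ∀ ε > 0, ∫ x, (W x) ^ 2 ∂(sph n R) ≤ ε * ∫ x, |W x| ∂(sph n R) := by
    intro ε hε
    obtain ⟨G, ⟨P, hP⟩, hG⟩ := ContinuousMap.exists_mem_subalgebra_near_continuous_of_isCompact_of_separatesPoints hsep
      ⟨W, hW⟩ (isCompact_sphere (0 : EuclideanSpace ℝ (Fin n)) R) hε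
    have hPc := pe_cont P
    have i1 : Integrable (fun x => (W x) ^ 2) (sph n R) := cint hae (by fun_prop)
    have i2 : Integrable (fun x => W x * pe P x) (sph n R) := cint hae (by fun_prop)
    have i3 : Integrable (fun x => ε * |W x|) (sph n R) := cint hae (by fun_prop)
    have e : ∫ x, (W x) ^ 2 ∂(sph n R) = ∫ x, ((W x) ^ 2 - W x * pe P x) ∂(sph n R) := by
      rw [integral_sub i1 i2, h P, sub_zero]
    rw [e, ← integral_const_mul]
    apply integral_mono_ae (i1.sub i2) i3
    filter_upwards [sph_ae R] with x hx
    have h1 := hG x (by simpa using hx)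
    have hP' : (MvPolynomial.aeval (R := ℝ) co P) = G := hP
    rw [← hP', hpe] at h1
    have h2 : ‖pe P x - W x‖ < ε := h1
    calc (W x) ^ 2 - W x * pe P x ≤ |W x * (pe P x - W x)| := by
          rw [show (W x) ^ 2 - W x * pe P x = - (W x * (pe P x - W x)) by ring]
          exact neg_le_abs _
      _ = |pe P x - W x| * |W x| := by rw [abs_mul, mul_comm]
      _ ≤ ε * |W x| := mul_le_mul_of_nonneg_right h2.le (abs_nonneg _)
  apply le_antisymm
  · have ht : Tendsto (fun ε : ℝ => ε * ∫ x, |W x| ∂(sph n R)) (𝓝[>] 0) (𝓝 0) := by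
      have : Tendsto (fun ε : ℝ => ε * ∫ x, |W x| ∂(sph n R)) (𝓝 0) (𝓝 (0 * ∫ x, |W x| ∂(sph n R))) :=
        (continuous_id.mul continuous_const).tendsto 0
      rw [zero_mul] at this
      exact this.mono_left nhdsWithin_le_nhds
    refine ge_of_tendsto ht ?_
    filter_upwards [self_mem_nhdsWithin] with ε hε
    exact hbound ε hε
  · exact integral_nonneg fun x => sq_nonneg _

theorem main_fwd (hn : 2 ≤ n) {R k : ℝ} (hR : 0 < R) (hk : 0 < k) (h0 : phi n (R ^ 2 * k ^ 2 / 4) = 0)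
    {V : EuclideanSpace ℝ (Fin n) → ℝ} (hV : Continuous V) (hft : ∀ ξ, ‖ξ‖ = k → ft (sph n R) V ξ = 0) :
    ∃ b : EuclideanSpace ℝ (Fin n), ∀ x, ‖x‖ = R → V x = ⟪b, x⟫ := by
  have hfin := sph_finite hn hR
  have hae : ∀ᵐ x ∂(sph n R), ‖x‖ ≤ R := (sph_ae R).mono fun x hx => hx.le
  obtain ⟨a, ha, hab⟩ := sph_second hn hR
  let b : EuclideanSpace ℝ (Fin n) := WithLp.toLp 2 (fun j => (∫ y, V y * y j ∂(sph n R)) / a)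
  have hbc : ∀ c : EuclideanSpace ℝ (Fin n), ∫ y, V y * ⟪c, y⟫ ∂(sph n R) = a * ⟪b, c⟫ := by
    intro c
    have e1 : ∀ y : EuclideanSpace ℝ (Fin n), V y * ⟪c, y⟫ = ∑ j, c j * (V y * y j) := by
      intro y
      simp only [PiLp.inner_apply, Finset.mul_sum]
      apply Finset.sum_congr rfl
      intro j _
      simp; ring
    simp only [e1]
    rw [integral_finsetSum]
    · simp only [integral_const_mul, PiLp.inner_apply, Finset.mul_sum]
      apply Finset.sum_congr rfl
      intro j _
      simp [b]; field_simp
    · intro j _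
      exact cint hae (by fun_prop)
  refine ⟨b, fun x hx => ?_⟩
  have hWc : Continuous fun y => V y - ⟪b, y⟫ := by fun_prop
  have hWft : ∀ ξ, ‖ξ‖ = k → ft (sph n R) (fun y => V y - ⟪b, y⟫) ξ = 0 := by
    intro ξ hξ
    have h1 := hft ξ hξ
    have h2 := ft_lin_zero hn hR b ξ (by rw [← norm_pos_iff, hξ]; exact hk) (by rw [hξ]; exact h0)
    have h3 : ft (sph n R) (fun y => V y - ⟪b, y⟫) ξ = ft (sph n R) V ξ - ft (sph n R) (fun y => ⟪b, y⟫) ξ := by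
      unfold ft
      rw [← integral_sub]
      · congr 1; ext y; push_cast; ring
      all_goals exact cint hae (by fun_prop)
    rw [h3, h1, h2, sub_zero]
  have key : ∀ Q ∈ Submodule.span ℝ {H : MvPolynomial (Fin n) ℝ | ∃ l, Harm l H},
      ∫ y, (V y - ⟪b, y⟫) * pe Q y ∂(sph n R) = 0 := by
    intro Q hQ
    induction hQ using Submodule.span_induction with
    | mem H hH =>
      obtain ⟨l, hH⟩ := hH
      by_cases hl : l = 1
      · subst hl
        obtain ⟨c, hc⟩ := harm_lin hH
        simp only [hc, sub_mul]
        rw [integral_sub (cint hae (by fun_prop)) (cint hae (by fun_prop)), hbc, hab, sub_self]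
      · exact orth hn hR hk h0 hWc hWft hl hH
    | zero => simp [pe]
    | add P Q _ _ hP hQ =>
      have hPc := pe_cont P
      have hQc := pe_cont Q
      have : ∀ y, pe (P + Q) y = pe P y + pe Q y := by intro y; simp [pe]
      simp only [this, mul_add]
      rw [integral_add (cint hae (by fun_prop)) (cint hae (by fun_prop)), hP, hQ, add_zero]
    | smul r P _ hP =>
      have : ∀ y, (V y - ⟪b, y⟫) * pe (r • P) y = r * ((V y - ⟪b, y⟫) * pe P y) := by intro y; simp [pe]; ring
      simp only [this]
      rw [integral_const_mul, hP, mul_zero]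
  have hall : ∀ P, ∫ y, (V y - ⟪b, y⟫) * pe P y ∂(sph n R) = 0 := by
    intro P
    obtain ⟨Q, hQ, hPQ⟩ := harm_decomp (by omega : 0 < n) R P
    rw [← key Q hQ]
    apply integral_congr_ae
    filter_upwards [sph_ae R] with y hy
    rw [hPQ y hy]
  exact sub_eq_zero.mp (dense_zero hn hR hWc hall x hx)

end Bg

theorem stmt_2 {n : ℕ} (hn : 2 ≤ n) (g : EuclideanSpace ℝ (Fin n) → ℝ)
    (hg : IsPosDefRadialKernel g) (hg0 : ∃ x, g x ≠ 0) (R : ℝ) (hR : 0 < R)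
    (hFB : (∫ x in ball (0 : EuclideanSpace ℝ (Fin n)) R,
        ∫ y in ball (0 : EuclideanSpace ℝ (Fin n)) R, g (x - y)) = 0)
    (v : EuclideanSpace ℝ (Fin n) → ℝ)
    (hv : ContinuousOn v (sphere (0 : EuclideanSpace ℝ (Fin n)) R)) :
    (∫ x in sphere (0 : EuclideanSpace ℝ (Fin n)) R,
      (∫ y in sphere (0 : EuclideanSpace ℝ (Fin n)) R,
        g (x - y) * v x * v y ∂(μH[(n : ℝ) - 1])) ∂(μH[(n : ℝ) - 1])) = 0 ↔
      ∃ b : EuclideanSpace ℝ (Fin n),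
        ∀ x ∈ sphere (0 : EuclideanSpace ℝ (Fin n)) R, v x = ⟪b, x⟫ := by
  have hfin := Bg.sph_finite hn hR
  have hae : ∀ᵐ x ∂(Bg.sph n R), ‖x‖ ≤ R := (Bg.sph_ae R).mono fun x hx => hx.le
  obtain ⟨M, hMf, hM0, hM⟩ := Bg.bochner (g := g) hg hg0
  obtain ⟨ξ0, hξ0⟩ := Bg.spectral hM0 hg.2.1 hM
  -- a function vanishing condition from the ball
  have hbf : IsFiniteMeasure (volume.restrict (ball (0 : EuclideanSpace ℝ (Fin n)) R)) :=
    ⟨by rw [Measure.restrict_apply_univ]; exact measure_ball_lt_top⟩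
  have hball : ∀ᵐ ξ ∂M, Bg.ft (volume.restrict (ball (0 : EuclideanSpace ℝ (Fin n)) R)) (fun _ => 1) ξ = 0 := by
    refine (Bg.energy_zero hM continuous_const (integrable_const _)).mp ?_
    simpa using hFB
  have hphi : ∀ ξ, Bg.ft (volume.restrict (ball (0 : EuclideanSpace ℝ (Fin n)) R)) (fun _ => 1) ξ = 0 →
      Bg.phi n (R ^ 2 * ‖ξ‖ ^ 2 / 4) = 0 ∧ ξ ≠ 0 := by
    intro ξ h
    have h1 : Bg.phi n (R ^ 2 * ‖ξ‖ ^ 2 / 4) = 0 := by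
      unfold Bg.ft at h
      simp only [Complex.ofReal_one, one_mul] at h
      rw [Bg.ball_phi hn hR] at h
      have h2 := Complex.ofReal_eq_zero.mp h
      exact (mul_eq_zero.mp h2).resolve_left (Bg.ball_vol_pos hR).ne'
    refine ⟨h1, ?_⟩
    rintro rfl
    simp [Bg.phi_zero] at h1
  have h0 := hphi ξ0 (hξ0 _ (Bg.ft_cont continuous_const (integrable_const _)) hball ξ0 rfl)
  -- continuous extension
  obtain ⟨V, hV⟩ := ContinuousMap.exists_extension (isClosed_sphere (x := (0 : EuclideanSpace ℝ (Fin n))) (ε := R)).isClosedEmbedding_subtypeVal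
    (⟨_, continuousOn_iff_continuous_restrict.mp hv⟩ : C(sphere (0 : EuclideanSpace ℝ (Fin n)) R, ℝ))
  have hVv : ∀ x, ‖x‖ = R → V x = v x := by
    intro x hx
    have := congrArg (fun f => f ⟨x, by simpa using hx⟩) hV
    simpa using this
  have hQ : ∀ f : EuclideanSpace ℝ (Fin n) → ℝ, (∀ x, ‖x‖ = R → f x = v x) →
      (∫ x in sphere (0 : EuclideanSpace ℝ (Fin n)) R,
      (∫ y in sphere (0 : EuclideanSpace ℝ (Fin n)) R,
        g (x - y) * v x * v y ∂(μH[(n : ℝ) - 1])) ∂(μH[(n : ℝ) - 1])) =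
      ∫ x, ∫ y, g (x - y) * f x * f y ∂(Bg.sph n R) ∂(Bg.sph n R) := by
    intro f hf
    change ∫ x, ∫ y, g (x - y) * v x * v y ∂(Bg.sph n R) ∂(Bg.sph n R) = _
    apply integral_congr_ae
    filter_upwards [Bg.sph_ae R] with x hx
    apply integral_congr_ae
    filter_upwards [Bg.sph_ae R] with y hy
    rw [hf x hx, hf y hy]
  constructor
  · intro h
    rw [hQ V hVv] at h
    have hVi : Integrable V (Bg.sph n R) := Bg.cint hae V.continuous
    have h1 := (Bg.energy_zero hM V.continuous hVi).mp h
    have h2 := hξ0 _ (Bg.ft_cont V.continuous hVi) h1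
    obtain ⟨b, hb⟩ := Bg.main_fwd hn hR (norm_pos_iff.mpr h0.2) h0.1 V.continuous h2
    refine ⟨b, fun x hx => ?_⟩
    have hx' : ‖x‖ = R := by simpa using hx
    rw [← hVv x hx', hb x hx']
  · rintro ⟨b, hb⟩
    rw [hQ (fun x => ⟪b, x⟫) (fun x hx => (hb x (by simpa using hx)).symm)]
    have hc : Continuous fun x : EuclideanSpace ℝ (Fin n) => ⟪b, x⟫ := by fun_prop
    refine (Bg.energy_zero hM hc (Bg.cint hae hc)).mpr ?_
    filter_upwards [hball] with ξ hξ
    exact Bg.ft_lin_zero hn hR b ξ (hphi ξ hξ).2 (hphi ξ hξ).1
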